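/- There exist at least 23 imaginary triquadratic fields K (realized as subfields of ℂ; since such fields are Galois over ℚ, subfields of ℂ correspond bijectively to isomorphism classes) with Cl(K) ≅ C₃, at least 29 with Cl(K) ≅ C₃², at least 7 with Cl(K) ≅ C₃³, and at least 1 with Cl(K) ≅ C₃⁴. -/

import Mathlib

open NumberField

/-- An `n`-quadratic field realized as a subfield of `ℂ`: a finite Galois extension of `ℚ`
with Galois group isomorphic to the elementary abelian 2-group of rank `n`. -/
def IsNQuadratic (n : ℕ) (K : IntermediateField ℚ ℂ) : Prop :=
  FiniteDimensional ℚ K ∧ IsGalois ℚ K ∧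
    Nonempty ((K ≃ₐ[ℚ] K) ≃* (Fin n → Multiplicative (ZMod 2)))

/-- A subfield of `ℂ` is imaginary if it is not contained in `ℝ`; for fields that are Galois
over `ℚ` this is equivalent to not being totally real. -/
def IsImaginary (K : IntermediateField ℚ ℂ) : Prop :=
  ∃ x : K, (x : ℂ).im ≠ 0

set_option linter.all false

namespace TQ

section norm
open Ideal

/-- a field automorphism acting on integers -/
noncomputable abbrev ra {K : Type*} [Field K] (g : K ≃+* K) : 𝓞 K ≃+* 𝓞 K :=
  RingOfIntegers.mapRingEquiv g

/-- conjugate ideal -/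
noncomputable def cj {K : Type*} [Field K] (g : K ≃+* K) (I : Ideal (𝓞 K)) : Ideal (𝓞 K) :=
  I.map (ra g)

variable {K : Type*} [Field K]

lemma ra_coe (g : K ≃+* K) (x : 𝓞 K) : ((ra g x : 𝓞 K) : K) = g (x : K) := rfl

lemma cj_mul (g : K ≃+* K) (I J : Ideal (𝓞 K)) : cj g (I * J) = cj g I * cj g J :=
  Ideal.map_mul _ _ _

lemma cj_pow (g : K ≃+* K) (I : Ideal (𝓞 K)) (n : ℕ) : cj g (I ^ n) = cj g I ^ n :=
  Ideal.map_pow _ _ _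

lemma cj_span (g : K ≃+* K) (x : 𝓞 K) : cj g (span {x}) = span {ra g x} := by
  unfold cj; rw [Ideal.map_span]; simp

lemma mem_cj (g : K ≃+* K) (I : Ideal (𝓞 K)) (x : 𝓞 K) : x ∈ cj g I ↔ ∃ y ∈ I, ra g y = x :=
  Ideal.mem_map_of_equiv (ra g) x

lemma cj_cj (g h : K ≃+* K) (I : Ideal (𝓞 K)) : cj g (cj h I) = cj (h.trans g) I := by
  ext x
  simp only [mem_cj]
  constructor
  · rintro ⟨y, ⟨z, hz, rfl⟩, rfl⟩
    exact ⟨z, hz, rfl⟩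
  · rintro ⟨z, hz, rfl⟩
    exact ⟨_, ⟨z, hz, rfl⟩, rfl⟩

lemma cj_of_id (g : K ≃+* K) (hg : ∀ x, g x = x) (I : Ideal (𝓞 K)) : cj g I = I := by
  ext x
  simp only [mem_cj]
  constructor
  · rintro ⟨y, hy, rfl⟩
    have : ra g y = y := RingOfIntegers.ext (hg _)
    rwa [this]
  · intro hx
    exact ⟨x, hx, RingOfIntegers.ext (hg _)⟩

lemma cj_ne_bot (g : K ≃+* K) (I : Ideal (𝓞 K)) (h : I ≠ ⊥) : cj g I ≠ ⊥ := by
  unfold cj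
  intro h2
  exact h ((Ideal.map_eq_bot_iff_of_injective (ra g).injective).mp h2)

lemma cj_mono (g : K ≃+* K) {I J : Ideal (𝓞 K)} (h : I ≤ J) : cj g I ≤ cj g J :=
  Ideal.map_mono h

lemma cj_prime (g : K ≃+* K) (I : Ideal (𝓞 K)) (h : I.IsPrime) : (cj g I).IsPrime :=
  Ideal.map_isPrime_of_equiv (ra g)

variable {F L : Type*} [Field F] [Field L] [NumberField F] [NumberField L] [Algebra F L]

/-- extension of ideals -/
noncomputable def ex (F L : Type*) [Field F] [Field L] [Algebra F L]
    (I : Ideal (𝓞 F)) : Ideal (𝓞 L) := I.map (algebraMap (𝓞 F) (𝓞 L))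

/-- norm of ideals -/
noncomputable def nm (F : Type*) {L : Type*} [Field F] [Field L] [NumberField F] [NumberField L]
    [Algebra F L] (I : Ideal (𝓞 L)) : Ideal (𝓞 F) := relNorm (𝓞 F) I

lemma ex_mul (I J : Ideal (𝓞 F)) : ex F L (I * J) = ex F L I * ex F L J := Ideal.map_mul _ _ _
lemma ex_pow (I : Ideal (𝓞 F)) (n : ℕ) : ex F L (I ^ n) = ex F L I ^ n := Ideal.map_pow _ _ _
lemma ex_span (x : 𝓞 F) : ex F L (span {x}) = span {algebraMap (𝓞 F) (𝓞 L) x} := by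
  unfold ex; rw [Ideal.map_span]; simp
lemma ex_ne_bot (I : Ideal (𝓞 F)) (h : I ≠ ⊥) : ex F L I ≠ ⊥ := by
  unfold ex
  intro h2
  exact h ((Ideal.map_eq_bot_iff_of_injective
    (FaithfulSMul.algebraMap_injective (𝓞 F) (𝓞 L))).mp h2)
lemma nm_mul (I J : Ideal (𝓞 L)) : nm F (I * J) = nm F I * nm F J := map_mul _ _ _
lemma nm_pow (I : Ideal (𝓞 L)) (n : ℕ) : nm F (I ^ n) = nm F I ^ n := map_pow _ _ _
lemma nm_ne_bot (I : Ideal (𝓞 L)) (h : I ≠ ⊥) : nm F I ≠ ⊥ := by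
  unfold nm; rwa [Ne, relNorm_eq_bot_iff]
lemma nm_eq_top (I : Ideal (𝓞 L)) (h : nm F I = ⊤) : I = ⊤ := by
  have := relNorm_le_comap (𝓞 F) I
  unfold nm at h
  rw [h] at this
  have h1 := this (Submodule.mem_top : (1 : 𝓞 F) ∈ _)
  rw [mem_comap, map_one] at h1
  exact (eq_top_iff_one I).mpr h1

lemma finrank_OO : Module.finrank (𝓞 F) (𝓞 L) = Module.finrank F L :=
  IsFractionRing.finrank_eq (𝓞 F) F (𝓞 L) L |>.symm ▸ rfl

lemma nm_ex (I : Ideal (𝓞 F)) : nm F (ex F L I) = I ^ Module.finrank F L := by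
  unfold nm ex
  rw [relNorm_algebraMap, finrank_OO]

lemma nm_cj (g : L ≃ₐ[F] L) (I : Ideal (𝓞 L)) : nm F (cj g.toRingEquiv I) = nm F I :=
  relNorm_map_algEquiv (RingOfIntegers.mapAlgEquiv g) I

lemma ex_inj {I J : Ideal (𝓞 F)} (h : ex F L I = ex F L J) : I = J := by
  have h2 := congrArg (nm F) h
  rw [nm_ex, nm_ex] at h2
  have h0 : Module.finrank F L ≠ 0 := Module.finrank_pos.ne'
  exact pow_left_injective h0 h2

lemma ex_le_iff {I J : Ideal (𝓞 F)} (h : ex F L I ≤ ex F L J) : I ≤ J := by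
  have h3 : ex F L (I ⊔ J) = ex F L J := by
    have : ex F L (I ⊔ J) = ex F L I ⊔ ex F L J := Ideal.map_sup _ _ _
    rw [this, sup_eq_right]
    exact h
  have := ex_inj h3
  rw [← this]
  exact le_sup_left

theorem ex_nm [IsGalois F L] (I : Ideal (𝓞 L)) :
    ex F L (nm F I) = ∏ g : L ≃ₐ[F] L, cj g.toRingEquiv I := by
  by_cases hI : I = ⊥
  · subst hI
    have : nm F (⊥ : Ideal (𝓞 L)) = ⊥ := relNorm_bot _
    rw [this]
    symm
    rw [show ex F L ⊥ = ⊥ from Ideal.map_bot]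
    exact Finset.prod_eq_zero (Finset.mem_univ (1 : L ≃ₐ[F] L)) (Ideal.map_bot)
  have hle : ex F L (nm F I) ≤ ∏ g : L ≃ₐ[F] L, cj g.toRingEquiv I := by
    unfold ex nm
    rw [map_relNorm, span_le]
    rintro _ ⟨x, hx, rfl⟩
    have : (algebraMap (𝓞 F) (𝓞 L) ∘ Algebra.intNorm (𝓞 F) (𝓞 L)) x
        = ∏ g : L ≃ₐ[F] L, ra g.toRingEquiv x := by
      apply RingOfIntegers.ext
      have h1 := Algebra.algebraMap_intNorm (A := 𝓞 F) (K := F) (L := L) (B := 𝓞 L) x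
      have h2 := Algebra.norm_eq_prod_automorphisms F (algebraMap (𝓞 L) L x)
      rw [← h1] at h2
      simp only [Function.comp]
      refine Eq.trans ?_ (h2.trans ?_)
      · rfl
      · exact (map_prod (algebraMap (𝓞 L) L) (fun g : L ≃ₐ[F] L => ra g.toRingEquiv x)
          Finset.univ).symm
    rw [this]
    exact Ideal.prod_mem_prod fun g _ => (mem_cj _ _ _).mpr ⟨x, hx, rfl⟩
  obtain ⟨C, hC⟩ := Ideal.dvd_iff_le.mpr hle
  have h2 := congrArg (nm F) hC
  rw [nm_ex, nm_mul] at h2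
  have h3 : nm F (∏ g : L ≃ₐ[F] L, cj g.toRingEquiv I) = nm F I ^ Module.finrank F L := by
    have : nm F (∏ g : L ≃ₐ[F] L, cj g.toRingEquiv I)
        = ∏ g : L ≃ₐ[F] L, nm F (cj g.toRingEquiv I) := map_prod (relNorm (𝓞 F)) _ _
    rw [this]
    simp only [nm_cj, Finset.prod_const, Finset.card_univ]
    rw [← Nat.card_eq_fintype_card, IsGalois.card_aut_eq_finrank]
  rw [h3] at h2
  have h4 : nm F C = ⊤ := by
    have hne : nm F I ^ Module.finrank F L ≠ 0 := pow_ne_zero _ (nm_ne_bot I hI)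
    have : nm F I ^ Module.finrank F L * 1 = nm F I ^ Module.finrank F L * nm F C := by
      rw [mul_one]; exact h2
    exact (mul_left_cancel₀ hne this).symm.trans Ideal.one_eq_top
  rw [hC, nm_eq_top C h4, Ideal.mul_top]

/-- class of an ideal -/
noncomputable def cl (I : Ideal (𝓞 L)) : ClassGroup (𝓞 L) :=
  open Classical in
  if h : I ≠ ⊥ then ClassGroup.mk0 ⟨I, mem_nonZeroDivisors_of_ne_zero h⟩ else 1

lemma cl_eq (I : Ideal (𝓞 L)) (h : I ≠ ⊥) :
  cl I = ClassGroup.mk0 ⟨I, mem_nonZeroDivisors_of_ne_zero h⟩ := dif_pos h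

lemma cl_mul {I J : Ideal (𝓞 L)} (hI : I ≠ ⊥) (hJ : J ≠ ⊥) : cl (I * J) = cl I * cl J := by
  rw [cl_eq I hI, cl_eq J hJ, cl_eq _ (mul_ne_zero hI hJ), ← map_mul]
  rfl

lemma cl_pow {I : Ideal (𝓞 L)} (hI : I ≠ ⊥) (n : ℕ) : cl (I ^ n) = cl I ^ n := by
  rw [cl_eq I hI, cl_eq _ (pow_ne_zero n hI), ← map_pow]
  rfl

lemma cl_surj (c : ClassGroup (𝓞 L)) : ∃ I : Ideal (𝓞 L), I ≠ ⊥ ∧ cl I = c := by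
  obtain ⟨⟨I, hI⟩, rfl⟩ := ClassGroup.mk0_surjective c
  exact ⟨I, nonZeroDivisors.ne_zero hI, cl_eq I (nonZeroDivisors.ne_zero hI)⟩

lemma cl_eq_one {I : Ideal (𝓞 L)} (hI : I ≠ ⊥) : cl I = 1 ↔ ∃ x : 𝓞 L, x ≠ 0 ∧ I = span {x} := by
  rw [cl_eq I hI, ClassGroup.mk0_eq_one_iff]
  constructor
  · intro h
    obtain ⟨x, hx⟩ := (Submodule.isPrincipal_iff _).mp h
    refine ⟨x, ?_, hx⟩
    rintro rfl
    exact hI (by rw [hx]; simp)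
  · rintro ⟨x, _, hx⟩
    exact ⟨⟨x, hx⟩⟩

lemma cl_span {x : 𝓞 L} (hx : x ≠ 0) : cl (span {x}) = 1 :=
  (cl_eq_one (by simpa using hx)).mpr ⟨x, hx, rfl⟩

/-- extension of classes -/
noncomputable def jx (F L : Type*) [Field F] [Field L] [NumberField F] [NumberField L]
    [Algebra F L] : ClassGroup (𝓞 F) →* ClassGroup (𝓞 L) := ClassGroup.extendedHom (𝓞 F) (𝓞 L)

lemma jx_cl (I : Ideal (𝓞 F)) (hI : I ≠ ⊥) : jx F L (cl I) = cl (ex F L I) := by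
  unfold jx
  rw [cl_eq I hI, cl_eq _ (ex_ne_bot I hI), ClassGroup.extendedHom_mk0]
  rfl

end norm
end TQ

namespace TQ
section herb
open Module

lemma idx2 (M : Type*) [AddCommGroup M] [Module.Finite ℤ M] :
    (nsmulAddMonoidHom (α := M) 2).range.index
      = 2 ^ finrank ℤ M * Nat.card (nsmulAddMonoidHom (α := M) 2).ker := by
  have : AddGroup.FG M := Module.Finite.iff_addGroup_fg.mp inferInstance
  obtain ⟨n, ι, _, p, hp, e, ⟨f⟩⟩ := AddCommGroup.equiv_free_prod_directSum_zmod M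
  have hne : ∀ i, NeZero (p i ^ e i) := fun i => ⟨pow_ne_zero _ (hp i).ne_zero⟩
  classical
  have fT : Finite (DirectSum ι fun i => ZMod (p i ^ e i)) :=
    Finite.of_equiv (∀ i, ZMod (p i ^ e i))
      (DirectSum.addEquivProd fun i => ZMod (p i ^ e i)).symm.toEquiv
  set T := (DirectSum ι fun i => ZMod (p i ^ e i))
  set A := (Fin n →₀ ℤ)
  have h1 : (nsmulAddMonoidHom (α := M) 2).range.index
      = (nsmulAddMonoidHom (α := A × T) 2).range.index := by
    simpa [AddEquiv.map_range_nsmulAddMonoidHom]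
        using (AddSubgroup.index_map_equiv (nsmulAddMonoidHom (α := M) 2).range f).symm
  have h2 : (nsmulAddMonoidHom (α := A × T) 2).range
      = (nsmulAddMonoidHom (α := A) 2).range.prod (nsmulAddMonoidHom (α := T) 2).range := by
    ext ⟨a, t⟩
    simp only [AddMonoidHom.mem_range, AddSubgroup.mem_prod, nsmulAddMonoidHom_apply, Prod.smul_mk,
      Prod.exists, Prod.mk.injEq]
    constructor
    · rintro ⟨x, y, h, h'⟩; exact ⟨⟨x, h⟩, ⟨y, h'⟩⟩
    · rintro ⟨⟨x, h⟩, ⟨y, h'⟩⟩; exact ⟨x, y, h, h'⟩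
  have h3 : (nsmulAddMonoidHom (α := T) 2).range.index
      = Nat.card (nsmulAddMonoidHom (α := T) 2).ker := AddSubgroup.index_range
  have h4 : Nat.card (nsmulAddMonoidHom (α := T) 2).ker
      = Nat.card (nsmulAddMonoidHom (α := M) 2).ker := by
    apply Nat.card_congr
    refine ⟨fun t => ⟨f.symm (0, t.1), ?_⟩, fun m => ⟨(f m.1).2, ?_⟩, ?_, ?_⟩
    · have := t.2
      simp only [AddMonoidHom.mem_ker, nsmulAddMonoidHom_apply] at this ⊢
      rw [← map_nsmul]; simp [this]
    · have := m.2
      simp only [AddMonoidHom.mem_ker, nsmulAddMonoidHom_apply] at this ⊢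
      rw [← Prod.smul_snd, ← map_nsmul, this]; simp
    · intro t; simp
    · intro m
      have := m.2
      simp only [AddMonoidHom.mem_ker, nsmulAddMonoidHom_apply] at this
      apply Subtype.ext
      simp only
      rw [AddEquiv.symm_apply_eq]
      have h5 : (2 : ℕ) • (f m.1).1 = 0 := by
        rw [← Prod.smul_fst, ← map_nsmul, this]; simp
      ext1
      · have : (f m.1).1 = 0 := by
          simpa using h5
        simp [this]
      · rfl
  have h5 : finrank ℤ M = finrank ℤ A := by
    rw [LinearEquiv.finrank_eq f.toIntLinearEquiv]
    have hT0 : finrank ℤ T = 0 := by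
      rw [Module.finrank_eq_zero_iff_isTorsion]
      intro t
      refine ⟨⟨(Nat.card T : ℤ), ?_⟩, ?_⟩
      · rw [mem_nonZeroDivisors_iff_ne_zero]; exact_mod_cast Nat.card_pos.ne'
      · change (Nat.card T : ℤ) • t = 0
        rw [natCast_zsmul]; exact card_nsmul_eq_zero'
    have e1 := (LinearMap.ker (LinearMap.fst ℤ A T)).finrank_quotient_add_finrank
    have e2 := LinearEquiv.finrank_eq
      ((LinearMap.fst ℤ A T).quotKerEquivOfSurjective LinearMap.fst_surjective)
    have e3 : finrank ℤ (LinearMap.ker (LinearMap.fst ℤ A T)) = 0 := by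
      have hle := LinearMap.finrank_le_finrank_of_injective (R := ℤ)
        (f := (LinearMap.snd ℤ A T).comp (LinearMap.ker (LinearMap.fst ℤ A T)).subtype) (by
          rintro ⟨⟨a, t⟩, ha⟩ ⟨⟨b, u⟩, hb⟩ h
          simp at ha hb h
          subst ha hb h
          rfl)
      omega
    change finrank ℤ (A × T) = _
    omega
  rw [h1, h2, AddSubgroup.index_prod, AddSubgroup.index_range_nsmul, h3, h4, h5]

lemma relIdx2 {A : Type*} [AddCommGroup A] [Module.Finite ℤ A] (X : AddSubgroup A)
    (hX : Nat.card {x : A // x ∈ X ∧ x + x = 0} = 2) :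
    (X.map (nsmulAddMonoidHom (α := A) 2)).relIndex X = 2 ^ finrank ℤ X.toIntSubmodule * 2 := by
  rw [AddSubgroup.relIndex, AddSubgroup.addSubgroupOf_map_nsmulAddMonoidHom_eq_range]
  have := idx2 X.toIntSubmodule
  have h2 : Nat.card (nsmulAddMonoidHom (α := X.toIntSubmodule) 2).ker = 2 := by
    refine Eq.trans ?_ hX
    apply Nat.card_congr
    refine ⟨fun x => ⟨x.1.1, x.1.2, ?_⟩, fun x => ⟨⟨x.1, x.2.1⟩, ?_⟩, ?_, ?_⟩
    · have := x.2
      simp only [AddMonoidHom.mem_ker, nsmulAddMonoidHom_apply] at this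
      rw [← two_nsmul]
      exact congrArg Subtype.val this
    · simp only [AddMonoidHom.mem_ker, nsmulAddMonoidHom_apply]
      apply Subtype.ext
      change 2 • x.1 = 0
      rw [two_nsmul, x.2.2]
    · intro x; rfl
    · intro x; rfl
  rw [h2] at this
  exact this

/-- Herbrand quotient computation. -/
theorem herb {A : Type*} [AddCommGroup A] [Module.Finite ℤ A] (σ : A →+ A) (hσ : ∀ a, σ (σ a) = a)
    (X Y : AddSubgroup A) (hX : ∀ a, a ∈ X ↔ σ a = a) (hY : ∀ a, a ∈ Y ↔ a + σ a = 0)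
    (N D : A →+ A) (hN : ∀ a, N a = a + σ a) (hD : ∀ a, D a = a - σ a)
    (hX2 : Nat.card {x : A // x ∈ X ∧ x + x = 0} = 2)
    (hY2 : Nat.card {x : A // x ∈ Y ∧ x + x = 0} = 2)
    (hr : finrank ℤ A = 2 * finrank ℤ X.toIntSubmodule + 1) :
    D.range.relIndex Y = 2 * N.range.relIndex X ∧ N.range.relIndex X ≠ 0 := by
  set q := nsmulAddMonoidHom (α := A) 2
  have hXN : X.map q ≤ N.range := by
    rintro _ ⟨x, hx, rfl⟩
    exact ⟨x, by rw [hN, (hX x).mp hx, ← two_nsmul]; rfl⟩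
  have hNX : N.range ≤ X := by
    rintro _ ⟨x, rfl⟩
    rw [hX, hN, map_add, hσ, add_comm]
  have hYD : Y.map q ≤ D.range := by
    rintro _ ⟨x, hx, rfl⟩
    refine ⟨x, ?_⟩
    have := (hY x).mp hx
    rw [hD, show σ x = -x from (neg_eq_of_add_eq_zero_right this).symm, sub_neg_eq_add,
      ← two_nsmul]
    rfl
  have hDY : D.range ≤ Y := by
    rintro _ ⟨x, rfl⟩
    rw [hY, hD, map_sub, hσ]; abel
  have i1 := AddSubgroup.relIndex_mul_relIndex _ _ _ hXN hNX
  have i2 := AddSubgroup.relIndex_mul_relIndex _ _ _ hYD hDY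
  have c1 := AddSubgroup.index_comap (X.map q) N
  have c2 := AddSubgroup.index_comap (Y.map q) D
  have e : (X.map q).comap N = (Y.map q).comap D := by
    ext a
    simp only [AddSubgroup.mem_comap, AddSubgroup.mem_map]
    constructor
    · rintro ⟨x, hx, h⟩
      have hx' := (hX x).mp hx
      have h' : x + x = a + σ a := by rw [← hN, ← h]; exact (two_nsmul x).symm
      refine ⟨a - x, ?_, ?_⟩
      · rw [hY, map_sub, hx']
        have : a - x + (σ a - x) = a + σ a - (x + x) := by abel
        rw [this, h', sub_self]
      · have : q (a - x) = (a - x) + (a - x) := two_nsmul _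
        rw [this, hD]
        have : a - x + (a - x) = a + a - (x + x) := by abel
        rw [this, h']; abel
    · rintro ⟨x, hx, h⟩
      have hx' := (hY x).mp hx
      have h' : x + x = a - σ a := by rw [← hD, ← h]; exact (two_nsmul x).symm
      have hx'' : σ x = -x := (neg_eq_of_add_eq_zero_right hx').symm
      refine ⟨a - x, ?_, ?_⟩
      · rw [hX, map_sub, hx'']
        have : a - x = σ a - -x + ((a - σ a) - (x + x)) := by abel
        rw [this, h', sub_self, add_zero]
      · have : q (a - x) = (a - x) + (a - x) := two_nsmul _
        rw [this, hN]
        have : a - x + (a - x) = a + a - (x + x) := by abel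
        rw [this, h']; abel
  rw [e, c2] at c1
  have r1 := relIdx2 X hX2
  have r2 := relIdx2 Y hY2
  have rk : finrank ℤ Y.toIntSubmodule = finrank ℤ X.toIntSubmodule + 1 := by
    have a1 := (LinearMap.ker N.toIntLinearMap).finrank_quotient_add_finrank
    have a2 := LinearEquiv.finrank_eq N.toIntLinearMap.quotKerEquivRange
    have hk : LinearMap.ker N.toIntLinearMap = Y.toIntSubmodule := by
      ext a
      change N a = 0 ↔ a ∈ Y
      rw [hN, hY]
    rw [hk] at a1 a2
    have hle1 : finrank ℤ (LinearMap.range N.toIntLinearMap) ≤ finrank ℤ X.toIntSubmodule := by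
      apply Submodule.finrank_mono
      rintro _ ⟨x, rfl⟩
      exact hNX ⟨x, rfl⟩
    have hle2 : finrank ℤ X.toIntSubmodule ≤ finrank ℤ (LinearMap.range N.toIntLinearMap) := by
      set g := N.toIntLinearMap.domRestrict X.toIntSubmodule
      have b1 := (LinearMap.ker g).finrank_quotient_add_finrank
      have b2 := LinearEquiv.finrank_eq g.quotKerEquivRange
      have b3 : finrank ℤ (LinearMap.ker g) = 0 := by
        rw [Module.finrank_eq_zero_iff_isTorsion]
        rintro ⟨⟨x, hx⟩, h⟩
        refine ⟨⟨2, by simp⟩, ?_⟩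
        apply Subtype.ext
        apply Subtype.ext
        change (2 : ℤ) • x = 0
        have h' : N x = 0 := h
        rw [hN, (hX x).mp hx] at h'
        rw [two_zsmul, h']
      have b4 : finrank ℤ (LinearMap.range g) ≤ finrank ℤ (LinearMap.range N.toIntLinearMap) := by
        apply Submodule.finrank_mono
        rintro _ ⟨x, rfl⟩
        exact ⟨x.1, rfl⟩
      omega
    omega
  rw [rk] at r2
  rw [r1] at i1
  rw [r2] at i2
  rw [← c1] at i1
  constructor
  · have hpos : (Y.map q).relIndex D.range ≠ 0 := by
      intro h0; rw [h0, zero_mul] at i1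
      have : 2 ^ finrank ℤ X.toIntSubmodule * 2 > 0 := by positivity
      omega
    apply Nat.eq_of_mul_eq_mul_left (Nat.pos_of_ne_zero hpos)
    rw [i2, pow_succ, ← i1]; ring
  · intro h0; rw [h0, mul_zero] at i1
    have : 2 ^ finrank ℤ X.toIntSubmodule * 2 > 0 := by positivity
    omega
end herb
end TQ

namespace TQ
section quadr
open Ideal

variable {F L : Type*} [Field F] [Field L] [NumberField F] [NumberField L] [Algebra F L]

lemma cj_ex (σ : L ≃ₐ[F] L) (J : Ideal (𝓞 F)) : cj σ.toRingEquiv (ex F L J) = ex F L J := by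
  unfold cj ex
  refine (Ideal.map_map (algebraMap (𝓞 F) (𝓞 L)) ((ra σ.toRingEquiv : 𝓞 L ≃+* 𝓞 L) : 𝓞 L →+* 𝓞 L)).trans ?_
  congr 1
  ext x
  exact σ.commutes x

/-- data for a quadratic extension -/
structure Quad (F L : Type*) [Field F] [Field L] [Algebra F L] (σ : L ≃ₐ[F] L) : Prop where
  fr : Module.finrank F L = 2
  ne : σ ≠ 1

variable {σ : L ≃ₐ[F] L}

lemma Quad.gal (h : Quad F L σ) : IsGalois F L := by
  have : Algebra.IsQuadraticExtension F L := { toFree := inferInstance, finrank_eq_two' := h.fr }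
  infer_instance

lemma Quad.univ (h : Quad F L σ) [DecidableEq (L ≃ₐ[F] L)] :
    (Finset.univ : Finset (L ≃ₐ[F] L)) = {1, σ} := by
  have := h.gal
  symm
  apply Finset.eq_univ_of_card
  rw [Finset.card_pair h.ne.symm, ← Nat.card_eq_fintype_card, IsGalois.card_aut_eq_finrank, h.fr]

lemma Quad.all (h : Quad F L σ) (τ : L ≃ₐ[F] L) : τ = 1 ∨ τ = σ := by
  classical
  have := Finset.mem_univ τ
  rw [h.univ] at this
  simpa using this

lemma Quad.invol (h : Quad F L σ) (x : L) : σ (σ x) = x := by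
  rcases h.all (σ * σ) with h1 | h1
  · exact DFunLike.congr_fun h1 x
  · exact absurd (mul_eq_left.mp h1) h.ne

lemma Quad.ex_nm (h : Quad F L σ) (I : Ideal (𝓞 L)) :
    ex F L (nm F I) = I * cj σ.toRingEquiv I := by
  classical
  have := h.gal
  rw [TQ.ex_nm, h.univ, Finset.prod_pair h.ne.symm]
  congr 1
  exact cj_of_id _ (fun _ => rfl) I

lemma Quad.fixed (h : Quad F L σ) (x : L) (hx : σ x = x) : ∃ y : F, algebraMap F L y = x := by
  have := h.gal
  have := (IsGalois.mem_range_algebraMap_iff_fixed (F := F) (E := L) x).mpr (by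
    intro f
    rcases h.all f with rfl | rfl
    · rfl
    · exact hx)
  simpa using this

lemma Quad.fixedO (h : Quad F L σ) (x : 𝓞 L) (hx : ra σ.toRingEquiv x = x) :
    ∃ y : 𝓞 F, algebraMap (𝓞 F) (𝓞 L) y = x := by
  obtain ⟨y, hy⟩ := h.fixed (x : L) (by
    have := congrArg (fun z : 𝓞 L => (z : L)) hx
    exact this)
  have hi : IsIntegral ℤ y := by
    have h1 : IsIntegral ℤ (algebraMap F L y) := by rw [hy]; exact x.isIntegral_coe
    exact (isIntegral_algebraMap_iff (FaithfulSMul.algebraMap_injective F L)).mp h1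
  refine ⟨⟨y, hi⟩, RingOfIntegers.ext hy⟩

lemma Quad.inv_ra (h : Quad F L σ) (x : 𝓞 L) : ra σ.toRingEquiv (ra σ.toRingEquiv x) = x :=
  RingOfIntegers.ext (h.invol _)

lemma Quad.inv_cj (h : Quad F L σ) (I : Ideal (𝓞 L)) :
    cj σ.toRingEquiv (cj σ.toRingEquiv I) = I := by
  rw [cj_cj]; exact cj_of_id _ h.invol I

lemma Quad.descent (h : Quad F L σ) (θ : 𝓞 L) (I : Ideal (𝓞 L))
    (hI : cj σ.toRingEquiv I = I) (hc : I ⊔ span {θ - ra σ.toRingEquiv θ} = ⊤) :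
    ∃ J : Ideal (𝓞 F), I = ex F L J := by
  set s := ra σ.toRingEquiv with hs
  set d := θ - s θ
  have hinv : ∀ x, s (s x) = x := h.inv_ra
  have hm : ∀ x ∈ I, s x ∈ I := fun x hx => by
    rw [← hI]; exact (mem_cj _ _ _).mpr ⟨x, hx, rfl⟩
  refine ⟨I.comap (algebraMap (𝓞 F) (𝓞 L)), le_antisymm ?_ Ideal.map_comap_le⟩
  set J := I.comap (algebraMap (𝓞 F) (𝓞 L))
  have key : ∀ x ∈ I, s x = x → x ∈ ex F L J := by
    intro x hx hxs
    obtain ⟨y, hy⟩ := h.fixedO x hxs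
    rw [← hy]
    apply Ideal.mem_map_of_mem
    rw [Ideal.mem_comap, hy]; exact hx
  have key2 : ∀ x ∈ I, x * d ∈ ex F L J := by
    intro x hx
    have e : x * d = (x * θ + s (x * θ)) - s θ * (x + s x) := by
      simp only [d, map_mul]; ring
    rw [e]
    refine Ideal.sub_mem _ (key _ ?_ ?_) (Ideal.mul_mem_left _ _ (key _ ?_ ?_))
    · exact Ideal.add_mem _ (Ideal.mul_mem_right _ _ hx) (hm _ (Ideal.mul_mem_right _ _ hx))
    · rw [map_add, hinv, add_comm]
    · exact Ideal.add_mem _ hx (hm _ hx)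
    · rw [map_add, hinv, add_comm]
  have h1 : (1 : 𝓞 L) ∈ I ⊔ span {d} := by rw [hc]; trivial
  obtain ⟨i, hi, k, hk, hik⟩ := Submodule.mem_sup.mp h1
  obtain ⟨r, rfl⟩ := Ideal.mem_span_singleton.mp hk
  have hN : i * s i ∈ ex F L J := key _ (Ideal.mul_mem_right _ _ hi) (by
    rw [map_mul, hinv, mul_comm])
  intro x hx
  have hi' : i = 1 - d * r := by rw [← hik]; ring
  have hsd : s d = -d := by simp only [d, map_sub, hinv]; ring
  have hx' : x = x * (i * s i) + (x * d) * (r - s r + d * r * s r) := by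
    rw [hi', map_sub, map_mul, map_one, hsd]; ring
  rw [hx']
  exact Ideal.add_mem _ (Ideal.mul_mem_left _ _ hN) (Ideal.mul_mem_right _ _ (key2 x hx))

open Classical in
/-- valuation -/
noncomputable def vl (P I : Ideal (𝓞 L)) : ℕ :=
  (UniqueFactorizationMonoid.normalizedFactors I).count P

lemma vl_mul (P : Ideal (𝓞 L)) {I J : Ideal (𝓞 L)} (hI : I ≠ ⊥) (hJ : J ≠ ⊥) :
    vl P (I * J) = vl P I + vl P J := by
  unfold vl
  rw [UniqueFactorizationMonoid.normalizedFactors_mul hI hJ, Multiset.count_add]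

lemma vl_pos (P : Ideal (𝓞 L)) (hP : P.IsPrime) (hP0 : P ≠ ⊥) {I : Ideal (𝓞 L)} (hI : I ≠ ⊥)
    (h : I ≤ P) : 0 < vl P I := by
  unfold vl
  rw [Multiset.count_pos, UniqueFactorizationMonoid.mem_normalizedFactors_iff hI]
  exact ⟨Ideal.prime_of_isPrime hP0 hP, Ideal.dvd_iff_le.mpr h⟩

lemma sq_dvd_of_vl (P : Ideal (𝓞 L)) (hP : P.IsPrime) (hP0 : P ≠ ⊥) {I : Ideal (𝓞 L)} (hI : I ≠ ⊥)
    (h : 2 ≤ vl P I) : P ^ 2 ∣ I := by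
  classical
  unfold vl at h
  rw [UniqueFactorizationMonoid.dvd_iff_normalizedFactors_le_normalizedFactors
    (pow_ne_zero _ hP0) hI]
  rw [UniqueFactorizationMonoid.normalizedFactors_pow,
    UniqueFactorizationMonoid.normalizedFactors_irreducible
      (Ideal.prime_of_isPrime hP0 hP).irreducible]
  rw [Multiset.nsmul_singleton]
  rw [← Multiset.le_count_iff_replicate_le]
  convert h
  simp

lemma Quad.even_descent (h : Quad F L σ) (θ : 𝓞 L) {t : ℕ} (P : Fin t → Ideal (𝓞 L))
    (hP : ∀ i, (P i).IsPrime) (hP0 : ∀ i, P i ≠ ⊥)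
    (hθ : ∀ Q : Ideal (𝓞 L), Q.IsPrime → θ - ra σ.toRingEquiv θ ∈ Q →
      ∃ i, Q = P i ∨ Q = cj σ.toRingEquiv (P i))
    (I : Ideal (𝓞 L)) (hI0 : I ≠ ⊥) (hI : cj σ.toRingEquiv I = I) (hev : ∀ i, Even (vl (P i) I)) :
    ∃ J : Ideal (𝓞 F), I = ex F L J := by
  have : WfDvdMonoid (Ideal (𝓞 L)) := inferInstance
  induction I using (wellFounded_dvdNotUnit (α := Ideal (𝓞 L))).induction with
  | _ I IH =>
  by_cases hc : I ⊔ span {θ - ra σ.toRingEquiv θ} = ⊤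
  · exact h.descent θ I hI hc
  obtain ⟨Q, hQm, hQ⟩ := Ideal.exists_le_maximal _ hc
  obtain ⟨i, hi⟩ := hθ Q hQm.isPrime (hQ (Ideal.mem_sup_right (Ideal.mem_span_singleton_self _)))
  have hIQ : I ≤ Q := le_trans le_sup_left hQ
  have hIP : I ≤ P i := by
    rcases hi with rfl | rfl
    · exact hIQ
    · have := cj_mono σ.toRingEquiv hIQ
      rwa [hI, h.inv_cj] at this
  have hv := vl_pos (P i) (hP i) (hP0 i) hI0 hIP
  have hv2 : 2 ≤ vl (P i) I := by
    obtain ⟨k, hk⟩ := hev i; omega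
  have hd := sq_dvd_of_vl (P i) (hP i) (hP0 i) hI0 hv2
  have main : ∃ (M : Ideal (𝓞 L)) (J0 : Ideal (𝓞 F)), M ≠ ⊥ ∧ M ≤ P i ∧ M ^ 2 = ex F L J0 ∧ M ^ 2 ∣ I := by
    by_cases hs : cj σ.toRingEquiv (P i) = P i
    · refine ⟨P i, nm F (P i), hP0 i, le_rfl, ?_, hd⟩
      rw [h.ex_nm, hs, sq]
    · refine ⟨P i * cj σ.toRingEquiv (P i), nm F (P i) ^ 2,
        mul_ne_zero (hP0 i) (cj_ne_bot _ _ (hP0 i)), Ideal.mul_le_left, ?_, ?_⟩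
      · rw [ex_pow, h.ex_nm]
      · rw [mul_pow]
        apply IsCoprime.mul_dvd _ hd
        · obtain ⟨C, hC⟩ := hd
          refine ⟨cj σ.toRingEquiv C, ?_⟩
          rw [← hI, hC, cj_mul, cj_pow]
        · apply IsCoprime.pow
          have hp := hP i
          have hp' := cj_prime σ.toRingEquiv _ hp
          rw [Ideal.isCoprime_iff_sup_eq]
          have m1 := hp.isMaximal (hP0 i)
          have m2 := hp'.isMaximal (cj_ne_bot _ _ (hP0 i))
          exact Ideal.IsMaximal.coprime_of_ne m1 m2 (Ne.symm hs)
  obtain ⟨M, J0, hM0, hMP, hMJ, I', rfl⟩ := main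
  have hI'0 : I' ≠ ⊥ := fun h0 => hI0 (by rw [h0]; exact mul_zero _)
  have hM2 : M ^ 2 ≠ ⊥ := pow_ne_zero _ hM0
  have hI' : cj σ.toRingEquiv I' = I' := by
    rw [cj_mul, hMJ, cj_ex] at hI
    rw [hMJ] at hM2
    exact mul_left_cancel₀ hM2 hI
  obtain ⟨J', hJ'⟩ := IH I' ⟨hI'0, M ^ 2, by
      intro hu
      have hu' : IsUnit M := isUnit_pow_iff (two_ne_zero) |>.mp hu
      rw [Ideal.isUnit_iff] at hu'
      rw [hu'] at hMP
      exact (hP i).ne_top (top_le_iff.mp hMP), mul_comm _ _⟩ hI'0 hI' (by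
      intro j
      have := hev j
      rw [vl_mul _ hM2 hI'0, sq, vl_mul _ hM0 hM0, ← two_mul] at this
      rw [Nat.even_add] at this
      exact this.mp (even_two_mul _))
  exact ⟨J0 * J', by rw [ex_mul, hMJ, hJ']⟩

lemma Quad.h90 (h : Quad F L σ) (z : L) (hz : z * σ z = 1) :
    ∃ β : 𝓞 L, β ≠ 0 ∧ (β : L) = z * σ β := by
  have h1 : ∃ b : L, b ≠ 0 ∧ b = z * σ b := by
    by_cases hz1 : z = -1
    · have : ∃ x, σ x ≠ x := by
        by_contra hcon
        push Not at hcon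
        exact h.ne (AlgEquiv.ext hcon)
      obtain ⟨x, hx⟩ := this
      refine ⟨x - σ x, sub_ne_zero.mpr (Ne.symm hx), ?_⟩
      rw [hz1, map_sub, h.invol]; ring
    · refine ⟨1 + z, ?_, ?_⟩
      · intro h0; exact hz1 (by linear_combination h0)
      · rw [map_add, map_one, mul_add, hz]; ring
  obtain ⟨b, hb0, hb⟩ := h1
  obtain ⟨m, hm0, hm⟩ := IsAlgebraic.exists_integral_multiple (R := ℤ)
    ((IsFractionRing.isAlgebraic_iff ℤ ℚ L).mpr (Algebra.IsAlgebraic.isAlgebraic (R := ℚ) b))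
  refine ⟨⟨m • b, hm⟩, ?_, ?_⟩
  · intro h0
    have : m • b = 0 := congrArg (fun z : 𝓞 L => (z : L)) h0
    rw [zsmul_eq_mul] at this
    rcases mul_eq_zero.mp this with h2 | h2
    · exact hm0 (by exact_mod_cast h2)
    · exact hb0 h2
  · change m • b = z * σ (m • b)
    rw [map_zsmul]
    nth_rewrite 1 [hb]
    simp only [zsmul_eq_mul]; ring

end quadr
end TQ

namespace TQ
section chev
open Ideal Module

variable {F L : Type*} [Field F] [Field L] [NumberField F] [NumberField L] [Algebra F L]

lemma odd_principal (hodd : Odd (Nat.card (ClassGroup (𝓞 F)))) (J : Ideal (𝓞 F)) (hJ : J ≠ ⊥)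
    (h : cl (J ^ 2) = 1) : cl J = 1 := by
  rw [cl_pow hJ] at h
  have h2 : cl J ^ Nat.card (ClassGroup (𝓞 F)) = 1 := pow_card_eq_one'
  obtain ⟨k, hk⟩ := hodd
  rw [hk, pow_succ, pow_mul, h, one_pow, one_mul] at h2
  exact h2

lemma odd_of_no_two (h : ∀ c : ClassGroup (𝓞 L), c ^ 2 = 1 → c = 1) :
    Odd (Nat.card (ClassGroup (𝓞 L))) := by
  by_contra hn
  rw [Nat.not_odd_iff_even] at hn
  have := Fact.mk Nat.prime_two
  obtain ⟨c, hc⟩ := exists_prime_orderOf_dvd_card' (G := ClassGroup (𝓞 L)) 2 hn.two_dvd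
  have h1 := h c (by rw [← hc]; exact pow_orderOf_eq_one c)
  rw [h1, orderOf_one] at hc
  omega

lemma rank_tc (K : Type*) [Field K] [NumberField K] [IsTotallyComplex K] :
    2 * (finrank ℤ (Additive (𝓞 K)ˣ) + 1) = finrank ℚ K := by
  rw [NumberField.Units.finrank_eq, NumberField.Units.rank]
  have h1 := InfinitePlace.card_eq_nrRealPlaces_add_nrComplexPlaces K
  have h2 := InfinitePlace.card_add_two_mul_card_eq_rank K
  have h3 : InfinitePlace.nrRealPlaces K = 0 := nrRealPlaces_eq_zero_iff.mpr inferInstance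
  have h4 : 0 < finrank ℚ K := finrank_pos
  omega

variable {σ : L ≃ₐ[F] L}

/-- action on units -/
noncomputable def su (σ : L ≃ₐ[F] L) : Additive (𝓞 L)ˣ →+ Additive (𝓞 L)ˣ :=
  MonoidHom.toAdditive (Units.map ((ra σ.toRingEquiv : 𝓞 L ≃+* 𝓞 L) : 𝓞 L →* 𝓞 L))

lemma su_coe (a : Additive (𝓞 L)ˣ) :
    (((su σ a).toMul : (𝓞 L)ˣ) : 𝓞 L) = ra σ.toRingEquiv ((a.toMul : (𝓞 L)ˣ) : 𝓞 L) := rfl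

lemma unit_ext {a b : Additive (𝓞 L)ˣ} (h : ((a.toMul : (𝓞 L)ˣ) : 𝓞 L) = (b.toMul : (𝓞 L)ˣ)) :
    a = b := Additive.toMul.injective (Units.ext h)

theorem Quad.unit_facts (h : Quad F L σ) [IsTotallyComplex F] [IsTotallyComplex L]
    (hodd : Odd (Nat.card (ClassGroup (𝓞 F))))
    (θ : 𝓞 L) {t : ℕ} (P : Fin t → Ideal (𝓞 L))
    (hP : ∀ i, (P i).IsPrime) (hP0 : ∀ i, P i ≠ ⊥)
    (hθ : ∀ Q : Ideal (𝓞 L), Q.IsPrime → θ - ra σ.toRingEquiv θ ∈ Q →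
      ∃ i, Q = P i ∨ Q = cj σ.toRingEquiv (P i))
    (ht : t = 1 ∨ t = 2 ∧ ∃ u : (𝓞 F)ˣ, ∀ x : L, x * σ x ≠ algebraMap F L ((u : 𝓞 F) : F)) :
    (∀ v : Fin t → ZMod 2, ∃ β : 𝓞 L, β ≠ 0 ∧ cj σ.toRingEquiv (span {β}) = span {β} ∧
      ∀ i, (vl (P i) (span {β}) : ZMod 2) = v i) ∧
    (∀ ε : (𝓞 F)ˣ, (∃ x : L, x * σ x = algebraMap F L ((ε : 𝓞 F) : F)) →
      ∃ η : (𝓞 L)ˣ, ((η : 𝓞 L) : L) * σ ((η : 𝓞 L) : L) = algebraMap F L ((ε : 𝓞 F) : F)) := by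
  classical
  set A := Additive (𝓞 L)ˣ
  have hinv : ∀ a : A, su σ (su σ a) = a := fun a => unit_ext (h.inv_ra _)
  let N : A →+ A := AddMonoidHom.id A + su σ
  let D : A →+ A := AddMonoidHom.id A - su σ
  let X : AddSubgroup A := (AddMonoidHom.id A - su σ).ker
  let Y : AddSubgroup A := (AddMonoidHom.id A + su σ).ker
  have hX : ∀ a, a ∈ X ↔ su σ a = a := fun a => by
    change a - su σ a = 0 ↔ _
    rw [sub_eq_zero, eq_comm]
  have hY : ∀ a, a ∈ Y ↔ a + su σ a = 0 := fun a => Iff.rfl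
  let m1 : A := Additive.ofMul (-1 : (𝓞 L)ˣ)
  have hm1 : m1 ≠ 0 := by
    intro h0
    have : (-1 : 𝓞 L) = 1 := congrArg (fun a : A => ((a.toMul : (𝓞 L)ˣ) : 𝓞 L)) h0
    have h2 : (2 : 𝓞 L) = 0 := by linear_combination -this
    exact two_ne_zero h2
  have htwo : ∀ x : A, x + x = 0 → x = 0 ∨ x = m1 := by
    intro x hx
    have : ((x.toMul : (𝓞 L)ˣ) : 𝓞 L) * ((x.toMul : (𝓞 L)ˣ) : 𝓞 L) = 1 :=
      congrArg (fun a : A => ((a.toMul : (𝓞 L)ˣ) : 𝓞 L)) hx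
    rcases mul_self_eq_one_iff.mp this with h1 | h1
    · left; exact unit_ext h1
    · right; exact unit_ext (by rw [h1]; simp [m1])
  have hm1X : su σ m1 = m1 := unit_ext (by
    rw [su_coe]; simp [m1])
  have hm12 : m1 + m1 = 0 := unit_ext (by
    change (-1 : 𝓞 L) * (-1) = 1
    ring)
  have card2 : ∀ Z : AddSubgroup A, m1 ∈ Z → Nat.card {x : A // x ∈ Z ∧ x + x = 0} = 2 := by
    intro Z hZ
    rw [Nat.card_eq_two_iff]
    refine ⟨⟨0, Z.zero_mem, add_zero 0⟩, ⟨m1, hZ, hm12⟩, ?_, ?_⟩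
    · intro h0; exact hm1 (congrArg Subtype.val h0).symm
    · ext ⟨x, hx, hx2⟩
      simp only [Set.mem_insert_iff, Set.mem_singleton_iff, Set.mem_univ, iff_true, Subtype.mk.injEq]
      exact htwo x hx2
  let fF : Additive (𝓞 F)ˣ →+ A :=
    MonoidHom.toAdditive (Units.map (algebraMap (𝓞 F) (𝓞 L) : 𝓞 F →* 𝓞 L))
  have fF_coe : ∀ a, (((fF a).toMul : (𝓞 L)ˣ) : 𝓞 L) = algebraMap (𝓞 F) (𝓞 L) (a.toMul : (𝓞 F)ˣ) :=
    fun a => rfl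
  have fF_inj : Function.Injective fF := by
    intro a b hab
    apply Additive.toMul.injective
    apply Units.ext
    apply FaithfulSMul.algebraMap_injective (𝓞 F) (𝓞 L)
    rw [← fF_coe, ← fF_coe, hab]
  have fF_X : ∀ a, fF a ∈ X := fun a => by
    rw [hX]; apply unit_ext
    apply RingOfIntegers.ext
    exact σ.commutes _
  have X_fF : ∀ x ∈ X, ∃ a, fF a = x := by
    intro x hx
    rw [hX] at hx
    obtain ⟨y, hy⟩ := h.fixedO ((x.toMul : (𝓞 L)ˣ) : 𝓞 L) (by rw [← su_coe, hx])
    have hx' : su σ (-x) = -x := by rw [map_neg, hx]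
    obtain ⟨z, hz⟩ := h.fixedO (((-x).toMul : (𝓞 L)ˣ) : 𝓞 L) (by rw [← su_coe, hx'])
    have hyz : y * z = 1 := by
      apply FaithfulSMul.algebraMap_injective (𝓞 F) (𝓞 L)
      rw [map_mul, hy, hz, map_one]
      exact Units.mul_inv _
    refine ⟨Additive.ofMul ⟨y, z, hyz, by rw [mul_comm]; exact hyz⟩, unit_ext ?_⟩
    rw [fF_coe]
    exact hy
  have rkX : finrank ℤ X.toIntSubmodule = finrank ℤ (Additive (𝓞 F)ˣ) := by
    rw [← LinearMap.finrank_range_of_inj (f := fF.toIntLinearMap) fF_inj]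
    have : X.toIntSubmodule = LinearMap.range fF.toIntLinearMap := by
      ext x
      constructor
      · intro hx; exact X_fF x hx
      · rintro ⟨a, rfl⟩; exact fF_X a
    rw [this]
  have hr : finrank ℤ A = 2 * finrank ℤ X.toIntSubmodule + 1 := by
    have r1 := rank_tc F
    have r2 := rank_tc L
    have r3 := Module.finrank_mul_finrank ℚ F L
    rw [h.fr] at r3
    rw [rkX]
    change finrank ℤ (Additive (𝓞 L)ˣ) = _
    omega
  have fin : Module.Finite ℤ A := inferInstance
  obtain ⟨hb1, hb2⟩ := herb (su σ) hinv X Y hX hY N D (fun a => rfl) (fun a => rfl)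
    (card2 X ((hX _).mpr hm1X)) (card2 Y ((hY _).mpr (by rw [hm1X, hm12]))) hr
  have hch : ∀ y : Y, ∃ β : 𝓞 L, β ≠ 0 ∧
      β = ((y.1.toMul : (𝓞 L)ˣ) : 𝓞 L) * ra σ.toRingEquiv β := by
    intro y
    have hy := (hY _).mp y.2
    have hy' : ((y.1.toMul : (𝓞 L)ˣ) : 𝓞 L) * ra σ.toRingEquiv ((y.1.toMul : (𝓞 L)ˣ) : 𝓞 L) = 1 :=
      congrArg (fun a : A => ((a.toMul : (𝓞 L)ˣ) : 𝓞 L)) hy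
    obtain ⟨β, hβ0, hβ⟩ := h.h90 (((y.1.toMul : (𝓞 L)ˣ) : 𝓞 L) : L)
      (congrArg (fun z : 𝓞 L => (z : L)) hy')
    exact ⟨β, hβ0, RingOfIntegers.ext hβ⟩
  choose β hβ0 hβ using hch
  have hβf : ∀ y, cj σ.toRingEquiv (span {β y}) = span {β y} := by
    intro y
    rw [cj_span]
    apply Ideal.span_singleton_eq_span_singleton.mpr
    refine ⟨(y.1.toMul : (𝓞 L)ˣ), ?_⟩
    rw [mul_comm]; exact (hβ y).symm
  let φ : Y → (Fin t → ZMod 2) := fun y i => (vl (P i) (span {β y}) : ZMod 2)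
  have hφ : ∀ y y' : Y, φ y = φ y' → y.1 - y'.1 ∈ D.range := by
    intro y y' hyy
    have hs0 : ∀ y, span {β y} ≠ ⊥ := fun y => by simpa using hβ0 y
    obtain ⟨J, hJ⟩ := h.even_descent θ P hP hP0 hθ (span {β y} * span {β y'})
      (mul_ne_zero (hs0 y) (hs0 y')) (by rw [cj_mul, hβf, hβf]) (by
        intro i
        rw [vl_mul _ (hs0 y) (hs0 y'), ← ZMod.natCast_eq_zero_iff_even]
        have := congrFun hyy i
        simp only [φ] at this
        push_cast
        rw [this]
        exact CharTwo.add_self_eq_zero _)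
    have hJ0 : J ≠ ⊥ := by
      rintro rfl
      rw [show ex F L ⊥ = ⊥ from Ideal.map_bot] at hJ
      exact mul_ne_zero (hs0 y) (hs0 y') hJ
    have hJ2 : nm F (ex F L J) = J ^ 2 := by rw [nm_ex, h.fr]
    rw [← hJ, Ideal.span_singleton_mul_span_singleton] at hJ2
    have hJp : cl J = 1 := by
      apply odd_principal hodd J hJ0
      rw [← hJ2]
      unfold nm
      rw [relNorm_singleton]
      apply cl_span
      intro h0
      have : nm F (span {β y * β y'}) = ⊥ := by
        unfold nm; rw [relNorm_singleton, h0]; simp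
      rw [hJ2] at this
      exact pow_ne_zero 2 hJ0 this
    obtain ⟨a, ha0, ha⟩ := (cl_eq_one hJ0).mp hJp
    rw [ha, ex_span, Ideal.span_singleton_mul_span_singleton,
      Ideal.span_singleton_eq_span_singleton] at hJ
    obtain ⟨e, he⟩ := hJ
    have hsa : ra σ.toRingEquiv (algebraMap (𝓞 F) (𝓞 L) a) = algebraMap (𝓞 F) (𝓞 L) a :=
      RingOfIntegers.ext (σ.commutes _)
    have he2 := congrArg (ra σ.toRingEquiv) he
    rw [hsa, ← he, map_mul, map_mul] at he2
    have hne : ra σ.toRingEquiv (β y) * ra σ.toRingEquiv (β y') ≠ 0 := by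
      apply mul_ne_zero <;> (rw [Ne, map_eq_zero_iff _ (ra σ.toRingEquiv).injective]; exact hβ0 _)
    have key : y.1 + y'.1 = - D (Additive.ofMul e) := by
      rw [eq_neg_iff_add_eq_zero]
      change _ + (Additive.ofMul e - su σ (Additive.ofMul e)) = 0
      rw [← add_sub_assoc, sub_eq_zero]
      apply unit_ext
      rw [su_coe]
      change ((y.1.toMul : (𝓞 L)ˣ) : 𝓞 L) * ((y'.1.toMul : (𝓞 L)ˣ) : 𝓞 L) * (e : 𝓞 L)
        = ra σ.toRingEquiv (e : 𝓞 L)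
      apply mul_left_cancel₀ hne
      rw [he2]
      conv_rhs => rw [hβ y, hβ y']
      ring
    have key2 : y.1 - y'.1 = - D (Additive.ofMul e) - D y'.1 := by
      rw [← key]
      have : su σ y'.1 = - y'.1 := (neg_eq_of_add_eq_zero_right ((hY _).mp y'.2)).symm
      change _ = _ - (y'.1 - su σ y'.1)
      rw [this]; abel
    rw [key2]
    exact AddSubgroup.sub_mem _ (AddSubgroup.neg_mem _ ⟨_, rfl⟩) ⟨_, rfl⟩
  let ψ : Y ⧸ (D.range.addSubgroupOf Y) → (Fin t → ZMod 2) := fun q => φ q.out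
  have hψ : Function.Injective ψ := by
    intro a b hab
    have := hφ _ _ hab
    rw [← QuotientAddGroup.out_eq' a, ← QuotientAddGroup.out_eq' b]
    rw [eq_comm]
    apply QuotientAddGroup.eq.mpr
    rw [AddSubgroup.mem_addSubgroupOf]
    change - (b.out : Y).1 + (a.out : Y).1 ∈ _
    rwa [neg_add_eq_sub]
  have fq : Finite (Y ⧸ (D.range.addSubgroupOf Y)) := Finite.of_injective ψ hψ
  have cq : Nat.card (Y ⧸ (D.range.addSubgroupOf Y)) = 2 * N.range.relIndex X := hb1
  have ct : Nat.card (Fin t → ZMod 2) = 2 ^ t := by simp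
  have cle := Nat.card_le_card_of_injective ψ hψ
  rw [cq, ct] at cle
  have hu : t = 2 → N.range.relIndex X ≠ 1 := by
    intro ht2 h1
    rcases ht with ht | ⟨_, u, hu⟩
    · omega
    have := (AddSubgroup.relIndex_eq_one.mp h1) (fF_X (Additive.ofMul u))
    obtain ⟨a, ha⟩ := this
    apply hu (((a.toMul : (𝓞 L)ˣ) : 𝓞 L) : L)
    exact congrArg (fun a : A => (((a.toMul : (𝓞 L)ˣ) : 𝓞 L) : L)) ha
  have hk : 2 * N.range.relIndex X = 2 ^ t := by
    rcases ht with rfl | ⟨rfl, _⟩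
    · omega
    · have := hu rfl; omega
  constructor
  · have hbij : Function.Bijective ψ := (Nat.bijective_iff_injective_and_card ψ).mpr
      ⟨hψ, by rw [cq, ct, hk]⟩
    intro v
    obtain ⟨q, hq⟩ := hbij.2 v
    exact ⟨β q.out, hβ0 _, hβf _, fun i => congrFun hq i⟩
  · rintro ε ⟨x, hx⟩
    have fin : ∀ e : (𝓞 F)ˣ, fF (Additive.ofMul e) ∈ N.range → ∃ η : (𝓞 L)ˣ, ((η : 𝓞 L) : L) * σ ((η : 𝓞 L) : L)
        = algebraMap F L ((e : 𝓞 F) : F) := by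
      rintro e ⟨a, ha⟩
      exact ⟨a.toMul, congrArg (fun a : A => (((a.toMul : (𝓞 L)ˣ) : 𝓞 L) : L)) ha⟩
    by_cases hmem : fF (Additive.ofMul ε) ∈ N.range
    · exact fin ε hmem
    exfalso
    rcases ht with rfl | ⟨rfl, u, hu⟩
    · have h1 : N.range.relIndex X = 1 := by omega
      exact hmem ((AddSubgroup.relIndex_eq_one.mp h1) (fF_X _))
    · have h1 : (N.range.addSubgroupOf X).index = 2 := by
        change N.range.relIndex X = 2
        omega
      have h2 := AddSubgroup.add_mem_iff_of_index_two h1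
        (a := ⟨fF (Additive.ofMul ε), fF_X _⟩) (b := ⟨fF (Additive.ofMul u), fF_X _⟩)
      have hu' : fF (Additive.ofMul u) ∉ N.range := by
        intro hm
        obtain ⟨η, hη⟩ := fin u hm
        exact hu _ hη
      simp only [AddSubgroup.mem_addSubgroupOf] at h2
      have h3 := h2.mpr ⟨fun h => absurd h hmem, fun h => absurd h hu'⟩
      have h4 : fF (Additive.ofMul (ε * u)) ∈ N.range := by
        rw [ofMul_mul, map_add]; exact h3
      obtain ⟨η, hη⟩ := fin _ h4
      have hx0 : x ≠ 0 := by
        rintro rfl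
        rw [zero_mul] at hx
        have := (map_eq_zero (algebraMap F L)).mp hx.symm
        have h5 : (ε : 𝓞 F) = 0 := RingOfIntegers.ext this
        exact ε.ne_zero h5
      have hsx0 : σ x ≠ 0 := by simpa using hx0
      apply hu (((η : 𝓞 L) : L) / x)
      rw [map_div₀, div_mul_div_comm, hη, hx]
      have hε0 : algebraMap F L ((ε : 𝓞 F) : F) ≠ 0 := by rw [← hx]; exact mul_ne_zero hx0 hsx0
      rw [div_eq_iff hε0]
      have h6 : ((((ε * u : (𝓞 F)ˣ)) : 𝓞 F) : F) = ((ε : 𝓞 F) : F) * ((u : 𝓞 F) : F) := rfl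
      rw [h6, map_mul, mul_comm]

theorem Quad.chev (h : Quad F L σ) [IsTotallyComplex F] [IsTotallyComplex L]
    (hodd : Odd (Nat.card (ClassGroup (𝓞 F))))
    (θ : 𝓞 L) {t : ℕ} (P : Fin t → Ideal (𝓞 L))
    (hP : ∀ i, (P i).IsPrime) (hP0 : ∀ i, P i ≠ ⊥)
    (hθ : ∀ Q : Ideal (𝓞 L), Q.IsPrime → θ - ra σ.toRingEquiv θ ∈ Q →
      ∃ i, Q = P i ∨ Q = cj σ.toRingEquiv (P i))
    (ht : t = 1 ∨ t = 2 ∧ ∃ u : (𝓞 F)ˣ, ∀ x : L, x * σ x ≠ algebraMap F L ((u : 𝓞 F) : F)) :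
    Odd (Nat.card (ClassGroup (𝓞 L))) := by
  obtain ⟨A1, A2⟩ := h.unit_facts hodd θ P hP hP0 hθ ht
  apply odd_of_no_two
  intro c hc
  set hh := Nat.card (ClassGroup (𝓞 F)) with hhdef
  have hch : ∀ c : ClassGroup (𝓞 L), c ^ 2 = 1 → c ^ hh = c := by
    intro c hc
    obtain ⟨k, hk⟩ := hodd
    rw [hk, pow_succ, pow_mul, hc, one_pow, one_mul]
  obtain ⟨I0, hI0, rfl⟩ := cl_surj c
  set I := I0 ^ hh with hIdef
  have hI : I ≠ ⊥ := pow_ne_zero _ hI0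
  have hcI : cl I = cl I0 := by rw [hIdef, cl_pow hI0, hch _ hc]
  rw [← hcI] at hc ⊢
  have hn : cl (nm F I) = 1 := by
    rw [hIdef, nm_pow, cl_pow (nm_ne_bot _ hI0)]
    exact pow_card_eq_one'
  obtain ⟨a, ha0, ha⟩ := (cl_eq_one (nm_ne_bot _ hI)).mp hn
  have ha1 : I * cj σ.toRingEquiv I = span {algebraMap (𝓞 F) (𝓞 L) a} := by
    rw [← h.ex_nm, ha, ex_span]
  rw [← cl_pow hI] at hc
  obtain ⟨b, hb0, hb⟩ := (cl_eq_one (pow_ne_zero 2 hI)).mp hc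
  set a' := algebraMap (𝓞 F) (𝓞 L) a with ha'
  have ha'0 : a' ≠ 0 := by
    rw [ha', Ne, map_eq_zero_iff _ (FaithfulSMul.algebraMap_injective (𝓞 F) (𝓞 L))]; exact ha0
  have hsb : span {b} * span {ra σ.toRingEquiv b} = span {a' ^ 2} := by
    rw [← cj_span, ← hb, cj_pow, ← mul_pow, ha1, span_singleton_pow]
  rw [span_singleton_mul_span_singleton, span_singleton_eq_span_singleton] at hsb
  obtain ⟨e, he⟩ := hsb
  have hsa : ra σ.toRingEquiv a' = a' := RingOfIntegers.ext (σ.commutes _)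
  have hsb0 : ra σ.toRingEquiv b ≠ 0 := by
    rw [Ne, map_eq_zero_iff _ (ra σ.toRingEquiv).injective]; exact hb0
  have hse : ra σ.toRingEquiv (e : 𝓞 L) = e := by
    have := congrArg (ra σ.toRingEquiv) he
    rw [map_mul, map_mul, h.inv_ra, map_pow, hsa, ← he, mul_comm (ra σ.toRingEquiv b) b] at this
    exact mul_left_cancel₀ (mul_ne_zero hb0 hsb0) this
  have hse' : ra σ.toRingEquiv ((e⁻¹ : (𝓞 L)ˣ) : 𝓞 L) = ((e⁻¹ : (𝓞 L)ˣ) : 𝓞 L) := by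
    have h1 : ra σ.toRingEquiv ((e⁻¹ : (𝓞 L)ˣ) : 𝓞 L) * e = 1 := by
      rw [← hse, ← map_mul, Units.inv_mul, map_one]
    exact mul_right_cancel₀ e.ne_zero (by rw [h1, Units.inv_mul])
  obtain ⟨y, hy⟩ := h.fixedO _ hse
  obtain ⟨z, hz⟩ := h.fixedO _ hse'
  have hyz : z * y = 1 := by
    apply FaithfulSMul.algebraMap_injective (𝓞 F) (𝓞 L)
    rw [map_mul, hy, hz, map_one]
    exact Units.inv_mul _
  let ε : (𝓞 F)ˣ := ⟨z, y, hyz, by rw [mul_comm]; exact hyz⟩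
  have hεL : algebraMap F L ((ε : 𝓞 F) : F) = (((e⁻¹ : (𝓞 L)ˣ) : 𝓞 L) : L) := by
    rw [← hz]; rfl
  have cof : ∀ x : 𝓞 L, x ≠ 0 → (x : L) ≠ 0 := fun x hx h0 => hx (RingOfIntegers.ext h0)
  have heL : (b : L) * σ (b : L) * ((e : 𝓞 L) : L) = (a' : L) ^ 2 :=
    congrArg (fun z : 𝓞 L => (z : L)) he
  have hee : ((e : 𝓞 L) : L) * (((e⁻¹ : (𝓞 L)ˣ) : 𝓞 L) : L) = 1 :=
    congrArg (fun z : 𝓞 L => (z : L)) (Units.mul_inv e)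
  have hsaL : σ (a' : L) = a' := congrArg (fun z : 𝓞 L => (z : L)) hsa
  have haL := cof a' ha'0
  obtain ⟨η, hη⟩ := A2 ε ⟨(b : L) / a', by
    rw [map_div₀, hsaL, div_mul_div_comm, hεL, div_eq_iff (mul_ne_zero haL haL)]
    linear_combination (-(b : L) * σ b) * hee + (((e⁻¹ : (𝓞 L)ˣ) : 𝓞 L) : L) * heL⟩
  rw [hεL] at hη
  have hηL := cof η η.ne_zero
  have hsηL : σ ((η : 𝓞 L) : L) ≠ 0 := by simpa using hηL
  have hden : ((a' : L) * η) * (a' * σ ((η : 𝓞 L) : L)) ≠ 0 :=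
    mul_ne_zero (mul_ne_zero haL hηL) (mul_ne_zero haL hsηL)
  obtain ⟨β, hβ0, hβ⟩ := h.h90 ((b : L) / (a' * η)) (by
    rw [map_div₀, map_mul, hsaL, div_mul_div_comm, div_eq_one_iff_eq hden]
    linear_combination (-(b : L) * σ b) * hee + (((e⁻¹ : (𝓞 L)ˣ) : 𝓞 L) : L) * heL
      - (a' : L) ^ 2 * hη)
  have hβ' : β * (a' * η) = b * ra σ.toRingEquiv β := by
    apply RingOfIntegers.ext
    change (β : L) * (a' * η) = b * σ β
    have hd : (a' : L) * η ≠ 0 := mul_ne_zero haL hηL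
    have h7 := hβ
    rw [div_mul_eq_mul_div, eq_div_iff hd] at h7
    exact h7
  set s := σ.toRingEquiv
  have hid : span {β} * cj s I = I * span {ra s β} := by
    have h1 : span {β} * (span {a'} * span {(η : 𝓞 L)}) = span {b} * span {ra s β} := by
      rw [span_singleton_mul_span_singleton, span_singleton_mul_span_singleton,
        span_singleton_mul_span_singleton, hβ']
    rw [Ideal.span_singleton_eq_top.mpr η.isUnit, Ideal.mul_top, ← ha1, ← hb] at h1
    apply mul_left_cancel₀ (a := I) hI
    rw [← mul_assoc, ← mul_assoc, mul_comm I (span {β}), mul_assoc, h1, sq]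
  have hsβ0 : ra s β ≠ 0 := by
    rw [Ne, map_eq_zero_iff _ (ra s).injective]; exact hβ0
  set M := I * span {ra s β} with hM
  have hsp0 : span {ra s β} ≠ ⊥ := by simpa using hsβ0
  have hM0 : M ≠ ⊥ := mul_ne_zero hI hsp0
  have hMf : cj s M = M := by
    rw [hM, cj_mul, cj_span, h.inv_ra, mul_comm, hid]
  have hMc : cl M = cl I := by
    rw [hM, cl_mul hI hsp0, cl_span hsβ0, mul_one]
  obtain ⟨γ, hγ0, hγf, hγ⟩ := A1 (fun i => (vl (P i) M : ZMod 2))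
  have hγ0' : span {γ} ≠ ⊥ := by simpa using hγ0
  obtain ⟨J, hJ⟩ := h.even_descent θ P hP hP0 hθ (M * span {γ}) (mul_ne_zero hM0 hγ0')
    (by rw [cj_mul, hMf, hγf]) (by
      intro i
      rw [vl_mul _ hM0 hγ0', ← ZMod.natCast_eq_zero_iff_even]
      push_cast
      rw [hγ]
      exact CharTwo.add_self_eq_zero _)
  have hJ0 : J ≠ ⊥ := by
    rintro rfl
    rw [show ex F L ⊥ = ⊥ from Ideal.map_bot] at hJ
    exact mul_ne_zero hM0 hγ0' hJ
  have hcJ : cl I = jx F L (cl J) := by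
    rw [jx_cl J hJ0, ← hJ, cl_mul hM0 hγ0', cl_span hγ0, mul_one, hMc]
  rw [cl_pow hI] at hc
  rw [← hch _ hc, hcJ, ← map_pow, hhdef, pow_card_eq_one', map_one]

end chev
end TQ

namespace TQ
section quadfield
open Ideal

/-- fundamental discriminant test -/
def fund (D : ℤ) : Bool :=
  (D % 4 == 1 || D % 16 == 8 || D % 16 == 12) && D != 1 && decide (D.natAbs < 65536) &&
    (List.range 256).all (fun q => decide (q ≤ 2) || decide (D.natAbs % (q * q) ≠ 0))

lemma fund_sq {D : ℤ} (h : fund D = true) (q : ℕ) (hq : (q : ℤ) ^ 2 ∣ D) : q ≤ 2 := by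
  simp only [fund, Bool.and_eq_true, List.all_eq_true, Bool.or_eq_true, decide_eq_true_eq,
    List.mem_range] at h
  obtain ⟨⟨⟨hm, h1⟩, hlt⟩, hall⟩ := h
  by_contra hc
  have hd : q ^ 2 ∣ D.natAbs := by
    have := Int.natAbs_dvd_natAbs.mpr hq
    simpa [Int.natAbs_pow] using this
  have hD0 : D.natAbs ≠ 0 := by
    intro h0
    rw [Int.natAbs_eq_zero] at h0
    subst h0; simp at hm
  have hle := Nat.le_of_dvd (Nat.pos_of_ne_zero hD0) hd
  have hq2 : q < 256 := by nlinarith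
  rcases hall q hq2 with h2 | h2
  · omega
  · apply h2; rw [← sq]; exact Nat.mod_eq_zero_of_dvd hd

lemma fund_mod {D : ℤ} (h : fund D = true) : D % 4 = 1 ∨ D % 16 = 8 ∨ D % 16 = 12 := by
  simp only [fund, Bool.and_eq_true, Bool.or_eq_true, beq_iff_eq] at h
  tauto

lemma fund_ne_one {D : ℤ} (h : fund D = true) : D ≠ 1 := by
  simp only [fund, Bool.and_eq_true, bne_iff_ne] at h
  tauto

/-- rational squares times `D` integral -/
lemma rat_sq_int {D : ℤ} (b : ℚ) (m : ℤ) (h : (D : ℚ) * b ^ 2 = m) : (b.den : ℤ) ^ 2 ∣ D := by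
  have hb : b = b.num / b.den := (Rat.num_div_den b).symm
  have hd : (b.den : ℚ) ≠ 0 := by exact_mod_cast b.den_nz
  rw [hb, div_pow, ← mul_div_assoc, div_eq_iff (pow_ne_zero 2 hd)] at h
  have h2 : D * b.num ^ 2 = m * (b.den : ℤ) ^ 2 := by exact_mod_cast h
  have hc : IsCoprime ((b.den : ℤ) ^ 2) (b.num ^ 2) := by
    apply IsCoprime.pow
    exact (Int.isCoprime_iff_nat_coprime.mpr (by simpa using b.reduced)).symm
  exact hc.dvd_of_dvd_mul_right (Dvd.intro_left _ h2.symm)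

lemma fund_nonsq {D : ℤ} (h : fund D = true) (a : ℚ) : a ^ 2 ≠ D := by
  intro ha
  have hden : a.den = 1 := by
    have := rat_sq_int (D := 1) a D (by push_cast; rw [one_mul, ha])
    have := Int.natAbs_dvd_natAbs.mpr this
    simpa [Int.natAbs_pow] using this
  have h1 : (a.num : ℚ) = a := Rat.coe_int_num_of_den_eq_one hden
  rw [← h1] at ha
  have h2 : a.num ^ 2 = D := by exact_mod_cast ha
  have h3 : ((a.num.natAbs : ℕ) : ℤ) ^ 2 ∣ D := by rw [Int.natAbs_sq, h2]
  have h4 := fund_sq h _ h3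
  have h5 : ((a.num.natAbs : ℕ) : ℤ) ^ 2 = D := by rw [Int.natAbs_sq, h2]
  have := fund_mod h
  have h6 := fund_ne_one h
  generalize a.num.natAbs = q at *
  interval_cases q <;> simp at h5 <;> omega

/-- a quadratic field with a square root of `D` -/
structure QS (k : Type*) [Field k] [NumberField k] (s : k) (D : ℤ) : Prop where
  fr : Module.finrank ℚ k = 2
  sq : s ^ 2 = (D : k)
  fd : fund D = true

variable {k : Type*} [Field k] [NumberField k] {s : k} {D : ℤ}

lemma QS.irr (h : QS k s D) (a : ℚ) : (a : k) ≠ s := by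
  rintro rfl
  apply fund_nonsq h.fd a
  have := h.sq
  exact_mod_cast this

lemma QS.s0 (h : QS k s D) : s ≠ 0 := fun h0 => h.irr 0 (by simp [h0])

lemma QS.ind (h : QS k s D) (a b : ℚ) (hab : (a : k) + b * s = 0) : a = 0 ∧ b = 0 := by
  by_cases hb : b = 0
  · subst hb
    simp at hab
    exact ⟨hab, rfl⟩
  · exfalso
    apply h.irr (-a / b)
    have : (b : k) ≠ 0 := by exact_mod_cast hb
    push_cast
    field_simp
    linear_combination -hab

lemma QS.rep (h : QS k s D) (x : k) : ∃ a b : ℚ, x = (a : k) + b * s := by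
  have hli : LinearIndependent ℚ ![(1 : k), s] := by
    rw [LinearIndependent.pair_iff]
    intro a b hab
    apply h.ind
    simpa [Algebra.smul_def] using hab
  have htop := hli.span_eq_top_of_card_eq_finrank (by rw [h.fr]; simp)
  have hx : x ∈ Submodule.span ℚ (Set.range ![(1 : k), s]) := by rw [htop]; trivial
  rw [Matrix.range_cons, Matrix.range_cons, Matrix.range_empty, Set.union_empty,
    Set.singleton_union] at hx
  obtain ⟨a, b, hab⟩ := Submodule.mem_span_pair.mp hx
  exact ⟨a, b, by rw [← hab]; simp [Algebra.smul_def]⟩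

lemma QS.conj (h : QS k s D) : ∃ σ : k ≃ₐ[ℚ] k, Quad ℚ k σ ∧ σ s = -s := by
  have : Algebra.IsQuadraticExtension ℚ k := { toFree := inferInstance, finrank_eq_two' := h.fr }
  have hc : Nat.card (k ≃ₐ[ℚ] k) = 2 := by rw [IsGalois.card_aut_eq_finrank, h.fr]
  have : Nontrivial (k ≃ₐ[ℚ] k) := by
    rw [← Finite.one_lt_card_iff_nontrivial, hc]; norm_num
  obtain ⟨σ, hσ⟩ := exists_ne (1 : k ≃ₐ[ℚ] k)
  refine ⟨σ, ⟨h.fr, hσ⟩, ?_⟩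
  have h2 : (σ s) ^ 2 = s ^ 2 := by rw [← map_pow, h.sq]; simp
  rcases sq_eq_sq_iff_eq_or_eq_neg.mp h2 with h3 | h3
  · exfalso
    apply hσ
    ext x
    obtain ⟨a, b, rfl⟩ := h.rep x
    simp [h3]
  · exact h3

lemma co_lin (a b : ℤ) (ω : 𝓞 k) : (((a : 𝓞 k) + b * ω : 𝓞 k) : k) = a + b * (ω : k) := by
  change algebraMap (𝓞 k) k _ = a + b * algebraMap (𝓞 k) k ω
  rw [map_add, map_mul, map_intCast, map_intCast]

/-- integral generator data -/
structure QO (k : Type*) [Field k] [NumberField k] (D t n : ℤ) (ω : 𝓞 k)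
    (c : 𝓞 k ≃+* 𝓞 k) : Prop where
  D_eq : D = t ^ 2 - 4 * n
  rel : ω ^ 2 = t * ω - n
  gen : ∀ x : 𝓞 k, ∃ a b : ℤ, x = a + b * ω
  ind : ∀ a b : ℤ, (a : 𝓞 k) + b * ω = 0 → a = 0 ∧ b = 0
  conj : c ω = t - ω
  dis : |discr k| = |D|
  fr : Module.finrank ℚ k = 2
  fd : fund D = true

/-- the `t` -/
def tt (D : ℤ) : ℤ := D % 4
/-- the `n` -/
def nn (D : ℤ) : ℤ := (D % 4 - D) / 4

lemma tn {D : ℤ} (h : fund D = true) : (tt D = 0 ∨ tt D = 1) ∧ D = tt D ^ 2 - 4 * nn D := by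
  unfold tt nn
  rcases fund_mod h with h1 | h1 | h1
  · have : D % 4 = 1 := h1
    rw [this]; constructor; · simp
    omega
  · have : D % 4 = 0 := by omega
    rw [this]; constructor; · simp
    omega
  · have : D % 4 = 0 := by omega
    rw [this]; constructor; · simp
    omega

lemma rat_int_of_isIntegral (y : ℚ) (h : IsIntegral ℤ (y : k)) : ∃ m : ℤ, (m : ℚ) = y := by
  have h1 : IsIntegral ℤ (algebraMap ℚ k y) := by simpa using h
  have h2 : IsIntegral ℤ y := (isIntegral_algebraMap_iff (algebraMap ℚ k).injective).mp h1
  obtain ⟨m, hm⟩ := IsIntegrallyClosed.isIntegral_iff.mp h2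
  exact ⟨m, by simpa using hm⟩

lemma ints {D : ℤ} (h : fund D = true) (a b : ℚ) (T N : ℤ) (hT : 2 * a + tt D * b = T)
    (hN : (2 * a + tt D * b) ^ 2 - D * b ^ 2 = 4 * N) : ∃ m n : ℤ, a = m ∧ b = n := by
  have hd := rat_sq_int (D := D) b (T ^ 2 - 4 * N) (by push_cast; rw [← hT]; linarith)
  have h2 := fund_sq h _ hd
  have h0 := b.den_pos
  have hb2 : ∃ B : ℤ, 2 * b = B := by
    have hb : b = b.num / b.den := (Rat.num_div_den b).symm
    interval_cases hq : b.den
    · exact ⟨2 * b.num, by push_cast at hb ⊢; linarith⟩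
    · exact ⟨b.num, by push_cast at hb ⊢; linarith⟩
  obtain ⟨B, hB⟩ := hb2
  have hbB : b = B / 2 := by linarith
  have e1 : 4 * T ^ 2 - D * B ^ 2 = 16 * N := by
    have : (4 * T ^ 2 - D * B ^ 2 : ℚ) = 16 * N := by
      rw [← hT, ← hB]; linarith
    exact_mod_cast this
  have hBe : B % 2 = 0 := by
    by_contra hBo
    have hB1 : B % 2 = 1 := by omega
    have hBs : B ^ 2 % 8 = 1 := by
      have : B % 8 = 1 ∨ B % 8 = 3 ∨ B % 8 = 5 ∨ B % 8 = 7 := by omega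
      rcases this with h | h | h | h <;> simp [pow_two, Int.mul_emod, h]
    obtain ⟨q, hq⟩ : ∃ q, B ^ 2 = 8 * q + 1 := ⟨B ^ 2 / 8, by omega⟩
    have hTs : T ^ 2 % 4 = 0 ∨ T ^ 2 % 4 = 1 := by
      have : T % 4 = 0 ∨ T % 4 = 1 ∨ T % 4 = 2 ∨ T % 4 = 3 := by omega
      rcases this with h | h | h | h <;> simp [pow_two, Int.mul_emod, h]
    rw [hq] at e1
    have e2 : 4 * T ^ 2 - D - 8 * (D * q) = 16 * N := by linarith
    rcases fund_mod h with h3 | h3 | h3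
    · generalize T ^ 2 = Z at *
      generalize D * q = W at *
      omega
    · obtain ⟨e, he⟩ : ∃ e, D = 4 * e := ⟨D / 4, by omega⟩
      have : D * q = 4 * (e * q) := by rw [he]; ring
      rw [this] at e2
      generalize T ^ 2 = Z at *
      generalize e * q = W at *
      omega
    · obtain ⟨e, he⟩ : ∃ e, D = 4 * e := ⟨D / 4, by omega⟩
      have : D * q = 4 * (e * q) := by rw [he]; ring
      rw [this] at e2
      generalize T ^ 2 = Z at *
      generalize e * q = W at *
      omega
  obtain ⟨b', hb'⟩ : ∃ b', B = 2 * b' := ⟨B / 2, by omega⟩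
  have hbb : b = b' := by rw [hbB, hb']; push_cast; ring
  have e2 : T ^ 2 - D * b' ^ 2 = 4 * N := by rw [hb'] at e1; linarith
  have hA : ∃ A : ℤ, 2 * a = A := ⟨T - tt D * b', by push_cast; rw [← hT, hbb]; ring⟩
  obtain ⟨A, hA⟩ := hA
  have hT2 : T = A + tt D * b' := by
    have : (T : ℚ) = A + tt D * b' := by rw [← hT, hA, hbb]
    exact_mod_cast this
  have hAe : A % 2 = 0 := by
    obtain ⟨h3, h4⟩ := tn h
    have e3 : A ^ 2 + 2 * (A * (tt D * b')) = 4 * (N - nn D * b' ^ 2) := by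
      have : (A + tt D * b') ^ 2 - (tt D ^ 2 - 4 * nn D) * b' ^ 2 = 4 * N := by
        rw [← h4, ← hT2]; exact e2
      linarith
    have e4 : (A ^ 2) % 2 = 0 := by omega
    rcases Int.emod_two_eq_zero_or_one A with h5 | h5
    · exact h5
    · rw [pow_two, Int.mul_emod, h5] at e4; norm_num at e4
  exact ⟨A / 2, b', by rw [show a = (A : ℚ) / 2 by linarith]; obtain ⟨c, hc⟩ : ∃ c, A = 2 * c := ⟨A / 2, by omega⟩
                       rw [hc]; simp, hbb⟩

theorem QS.qo (h : QS k s D) : ∃ ω c, QO k D (tt D) (nn D) ω c ∧ (ω : k) = ((tt D : ℤ) + s) / 2 := by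
  obtain ⟨ht, hD⟩ := tn h.fd
  obtain ⟨σ, hq, hσ⟩ := h.conj
  set t := tt D
  set n := nn D
  set w : k := ((t : ℤ) + s) / 2 with hw
  have hsw : s = 2 * w - t := by rw [hw]; ring
  have hrel : w ^ 2 = t * w - n := by
    have h1 := h.sq
    rw [hsw] at h1
    have h2 : (D : k) = (t : k) ^ 2 - 4 * n := by exact_mod_cast congrArg (Int.cast : ℤ → k) hD
    linear_combination (1 / 4) * h1 + (1 / 4) * h2
  have hwi : IsIntegral ℤ w := by
    refine ⟨Polynomial.X ^ 2 - Polynomial.C t * Polynomial.X + Polynomial.C n, ?_, ?_⟩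
    · monicity!
    · simp only [Polynomial.eval₂_add, Polynomial.eval₂_sub, Polynomial.eval₂_mul,
        Polynomial.eval₂_pow, Polynomial.eval₂_X, Polynomial.eval₂_C, hrel]
      simp
  have hσw : σ w = t - w := by rw [hw]; rw [map_div₀, map_add, hσ, map_intCast, map_ofNat]; ring
  let ω : 𝓞 k := ⟨w, hwi⟩
  have hωc : (ω : k) = w := rfl
  have hωrel : ω ^ 2 = t * ω - n := RingOfIntegers.ext (by push_cast; exact hrel)
  have hind : ∀ a b : ℤ, (a : 𝓞 k) + b * ω = 0 → a = 0 ∧ b = 0 := by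
    intro a b hab
    have h1 : (a : k) + b * w = 0 := by
      have := congrArg (fun z : 𝓞 k => (z : k)) hab
      simp only [co_lin, map_zero] at this
      exact this
    have h2 := h.ind (a + b * t / 2) (b / 2) (by
      push_cast; rw [hsw]; linear_combination h1)
    have hb : b = 0 := by have := h2.2; field_simp at this; exact_mod_cast this
    subst hb
    have := h2.1; simp at this
    exact ⟨this, rfl⟩
  have hgen : ∀ x : 𝓞 k, ∃ a b : ℤ, x = a + b * ω := by
    intro x
    obtain ⟨a', b', hx⟩ := h.rep (x : k)
    set b : ℚ := 2 * b'
    set a : ℚ := a' - t * b'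
    have hx2 : (x : k) = a + b * w := by
      rw [hx, hsw]; simp only [a, b]; push_cast; ring
    have hσx : σ (x : k) = a + b * (t - w) := by rw [hx2]; simp [hσw]
    have hix : IsIntegral ℤ (x : k) := x.isIntegral_coe
    have his : IsIntegral ℤ (σ (x : k)) := hix.map σ
    obtain ⟨T, hT⟩ := rat_int_of_isIntegral (k := k) (2 * a + t * b) (by
      have := hix.add his
      rw [hσx, hx2] at this
      have e : ((2 * a + t * b : ℚ) : k) = (a + b * w + (a + b * (t - w)) : k) := by push_cast; ring
      rw [e]; exact this)
    obtain ⟨N, hN⟩ := rat_int_of_isIntegral (k := k) (a ^ 2 + t * a * b + n * b ^ 2) (by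
      have := hix.mul his
      rw [hσx, hx2] at this
      have e : ((a ^ 2 + t * a * b + n * b ^ 2 : ℚ) : k) = ((a + b * w) * (a + b * (t - w)) : k) := by
        push_cast; linear_combination (b : k) ^ 2 * hrel
      rw [e]; exact this)
    obtain ⟨m, l, hm, hl⟩ := ints h.fd a b T N hT.symm (by
      rw [hN]
      have h2 : (D : ℚ) = (t : ℚ) ^ 2 - 4 * n := by exact_mod_cast congrArg (Int.cast : ℤ → ℚ) hD
      rw [h2]; change (2 * a + t * b) ^ 2 - _ = _; ring)
    refine ⟨m, l, RingOfIntegers.ext ?_⟩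
    rw [co_lin, hx2, hm, hl, Rat.cast_intCast, Rat.cast_intCast, hωc]
  refine ⟨ω, ra σ.toRingEquiv, ⟨hD, hωrel, hgen, hind, RingOfIntegers.ext ?_, ?_, h.fr, h.fd⟩, rfl⟩
  · change σ w = _
    rw [hσw]; push_cast; rfl
  · classical
    have := hq.gal
    have hli : LinearIndependent ℤ ![(1 : 𝓞 k), ω] := by
      rw [LinearIndependent.pair_iff]
      intro a b hab
      apply hind
      simpa using hab
    have hsp : ⊤ ≤ Submodule.span ℤ (Set.range ![(1 : 𝓞 k), ω]) := by
      intro x _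
      rw [Matrix.range_cons, Matrix.range_cons, Matrix.range_empty, Set.union_empty,
        Set.singleton_union]
      obtain ⟨a, b, hab⟩ := hgen x
      exact Submodule.mem_span_pair.mpr ⟨a, b, by rw [hab]; simp⟩
    let B := Module.Basis.mk hli hsp
    have htr : ∀ x : 𝓞 k, ((Algebra.trace ℤ (𝓞 k) x : ℤ) : k) = x + σ (x : k) := by
      intro x
      have h1 : algebraMap ℚ k (Algebra.trace ℚ k (x : k)) = x + σ (x : k) := by
        rw [trace_eq_sum_automorphisms, hq.univ, Finset.sum_pair hq.ne.symm]
        rfl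
      rw [← h1, ← Algebra.coe_trace_int]; simp
    have tr1 : Algebra.trace ℤ (𝓞 k) 1 = 2 := by
      have h1 := htr 1
      have : ((Algebra.trace ℤ (𝓞 k) 1 : ℤ) : k) = ((2 : ℤ) : k) := by
        rw [h1]; simp; norm_num
      exact_mod_cast this
    have tr2 : Algebra.trace ℤ (𝓞 k) ω = t := by
      have h1 := htr ω
      have : ((Algebra.trace ℤ (𝓞 k) ω : ℤ) : k) = ((t : ℤ) : k) := by
        rw [h1, hωc, hσw]; ring
      exact_mod_cast this
    have tr3 : Algebra.trace ℤ (𝓞 k) (ω * ω) = t ^ 2 - 2 * n := by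
      have h1 := htr (ω * ω)
      have : ((Algebra.trace ℤ (𝓞 k) (ω * ω) : ℤ) : k) = ((t ^ 2 - 2 * n : ℤ) : k) := by
        rw [h1, show ((ω * ω : 𝓞 k) : k) = w * w from rfl, map_mul, hσw]; push_cast; linear_combination 2 * hrel
      exact_mod_cast this
    rw [← discr_eq_discr k B]
    congr 1
    rw [Algebra.discr_def, Matrix.det_fin_two]
    simp [Algebra.traceMatrix_apply, Algebra.traceForm_apply, B, tr1, tr2, tr3]
    rw [hD]; ring

end quadfield
end TQ

namespace TQ
section qideal
open Ideal

variable {k : Type*} [Field k] [NumberField k] {D t n : ℤ} {ω : 𝓞 k} {c : 𝓞 k ≃+* 𝓞 k}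

/-- the polynomial -/
def ff (t n r : ℤ) : ℤ := r ^ 2 - t * r + n

/-- the ideal `(a, ω - r)` -/
noncomputable def J (ω : 𝓞 k) (a r : ℤ) : Ideal (𝓞 k) := span {(a : 𝓞 k), ω - r}

lemma mem_J (ω : 𝓞 k) (a r : ℤ) (x : 𝓞 k) : x ∈ J ω a r ↔ ∃ u v, u * (a : 𝓞 k) + v * (ω - r) = x :=
  mem_span_pair

lemma J_le {ω : 𝓞 k} {a r : ℤ} {I : Ideal (𝓞 k)} (h1 : (a : 𝓞 k) ∈ I) (h2 : ω - r ∈ I) :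
    J ω a r ≤ I := by
  unfold J; rw [span_le]
  rintro x (rfl | rfl)
  · exact h1
  · exact h2

lemma J_a (ω : 𝓞 k) (a r : ℤ) : (a : 𝓞 k) ∈ J ω a r := (mem_J _ _ _ _).mpr ⟨1, 0, by ring⟩
lemma J_w (ω : 𝓞 k) (a r : ℤ) : ω - r ∈ J ω a r := (mem_J _ _ _ _).mpr ⟨0, 1, by ring⟩

lemma J_congr (ω : 𝓞 k) {a r r' : ℤ} (h : a ∣ r' - r) : J ω a r' = J ω a r := by
  obtain ⟨m, hm⟩ := h
  have h2 : (r' : 𝓞 k) = r + a * m := by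
    have : r' = r + a * m := by linarith
    exact_mod_cast congrArg (Int.cast : ℤ → 𝓞 k) this
  apply le_antisymm
  · exact J_le (J_a _ _ _) ((mem_J _ _ _ _).mpr ⟨-m, 1, by rw [h2]; ring⟩)
  · exact J_le (J_a _ _ _) ((mem_J _ _ _ _).mpr ⟨m, 1, by rw [h2]; ring⟩)

lemma J_neg (ω : 𝓞 k) (a r : ℤ) : J ω (-a) r = J ω a r := by
  apply le_antisymm
  · exact J_le ((mem_J _ _ _ _).mpr ⟨-1, 0, by push_cast; ring⟩) (J_w _ _ _)
  · exact J_le ((mem_J _ _ _ _).mpr ⟨-1, 0, by push_cast; ring⟩) (J_w _ _ _)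

lemma J_ne_bot (ω : 𝓞 k) {a : ℤ} (r : ℤ) (ha : a ≠ 0) : J ω a r ≠ ⊥ := by
  intro h
  have := J_a ω a r
  rw [h, mem_bot] at this
  exact ha (by exact_mod_cast this)

lemma J_one (ω : 𝓞 k) (r : ℤ) : J ω 1 r = ⊤ := by
  rw [eq_top_iff_one]; simpa using J_a ω 1 r

lemma QO.ff_eq (h : QO k D t n ω c) (r : ℤ) : (ω - r) * (ω - ((t - r : ℤ) : 𝓞 k)) = -(ff t n r : ℤ) := by
  unfold ff; push_cast
  linear_combination h.rel

lemma QO.wr (h : QO k D t n ω c) (r : ℤ) : ω - (r : 𝓞 k) ≠ 0 := by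
  intro h0
  have := h.ind (-r) 1 (by push_cast; linear_combination h0)
  exact one_ne_zero this.2

lemma cl_of_mul {I I' : Ideal (𝓞 k)} (hI : I ≠ ⊥) (hI' : I' ≠ ⊥) {x y : 𝓞 k} (hx : x ≠ 0)
    (hy : y ≠ 0) (h : span {x} * I = span {y} * I') : cl I = cl I' := by
  have hx' : span {x} ≠ ⊥ := by simpa using hx
  have hy' : span {y} ≠ ⊥ := by simpa using hy
  have := congrArg cl h
  rwa [cl_mul hx' hI, cl_mul hy' hI', cl_span hx, cl_span hy, one_mul, one_mul] at this

lemma QO.swap (h : QO k D t n ω c) {a b r : ℤ} (ha : a ≠ 0) (hb : b ≠ 0) (hab : a * b = ff t n r) :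
    cl (J ω a r) = cl (J ω b (t - r)) := by
  refine cl_of_mul (x := (b : 𝓞 k)) (y := ω - r) (J_ne_bot _ _ ha) (J_ne_bot _ _ hb)
    (by exact_mod_cast hb) (h.wr r) ?_
  have e := h.ff_eq r
  rw [← hab] at e
  push_cast at e
  unfold J
  rw [span_mul_span, span_mul_span]
  simp only [Set.singleton_mul, Set.image_pair]
  push_cast
  rw [show (ω - (r : 𝓞 k)) * (ω - (t - r)) = -((b : 𝓞 k) * a) by rw [e]; ring, 
    show (ω - (r : 𝓞 k)) * b = b * (ω - r) by ring]
  apply le_antisymm <;> rw [span_le] <;> rintro x (rfl | rfl)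
  · exact mem_span_pair.mpr ⟨0, -1, by ring⟩
  · exact mem_span_pair.mpr ⟨1, 0, by ring⟩
  · exact mem_span_pair.mpr ⟨0, 1, by ring⟩
  · exact mem_span_pair.mpr ⟨-1, 0, by ring⟩

lemma J_mul_le {ω : 𝓞 k} {a r a' r' : ℤ} {I : Ideal (𝓞 k)} (h1 : (a * a' : 𝓞 k) ∈ I)
    (h2 : a * (ω - r') ∈ I) (h3 : (ω - r) * a' ∈ I) (h4 : (ω - r) * (ω - r') ∈ I) :
    J ω a r * J ω a' r' ≤ I := by
  rw [Ideal.mul_le]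
  intro x hx y hy
  obtain ⟨u, v, rfl⟩ := (mem_J _ _ _ _).mp hx
  obtain ⟨u', v', rfl⟩ := (mem_J _ _ _ _).mp hy
  have : (u * (a : 𝓞 k) + v * (ω - r)) * (u' * (a' : 𝓞 k) + v' * (ω - r'))
    = (u * u') * (a * a') + (u * v') * (a * (ω - r')) + (v * u') * ((ω - r) * a')
      + (v * v') * ((ω - r) * (ω - r')) := by ring
  rw [this]
  exact add_mem (add_mem (add_mem (mul_mem_left _ _ h1) (mul_mem_left _ _ h2))
    (mul_mem_left _ _ h3)) (mul_mem_left _ _ h4)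

lemma QO.mulJ (h : QO k D t n ω c) {a a' r : ℤ} (hd : a * a' ∣ ff t n r)
    (hc : IsCoprime a (2 * r - t)) : J ω a r * J ω a' r = J ω (a * a') r := by
  obtain ⟨m, hm⟩ := hd
  have hsq : (ω - (r : 𝓞 k)) * (ω - r) = (t - 2 * r) * (ω - r) - (a * a') * m := by
    have : ((ff t n r : ℤ) : 𝓞 k) = a * a' * m := by rw [hm]; push_cast; rfl
    rw [← this]; unfold ff; push_cast; linear_combination h.rel
  apply le_antisymm
  · apply J_mul_le
    · exact (mem_J _ _ _ _).mpr ⟨1, 0, by push_cast; ring⟩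
    · exact mul_mem_left _ _ (J_w _ _ _)
    · exact mul_mem_right _ _ (J_w _ _ _)
    · exact mul_mem_left _ _ (J_w _ _ _)
  · set P := J ω a r * J ω a' r
    have p1 : (a : 𝓞 k) * a' ∈ P := mul_mem_mul (J_a _ _ _) (J_a _ _ _)
    have p2 : (a : 𝓞 k) * (ω - r) ∈ P := mul_mem_mul (J_a _ _ _) (J_w _ _ _)
    have p4 : (ω - (r : 𝓞 k)) * (ω - r) ∈ P := mul_mem_mul (J_w _ _ _) (J_w _ _ _)
    apply J_le
    · push_cast; exact p1
    · obtain ⟨u, v, huv⟩ := hc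
      have e : (u : 𝓞 k) * a + v * (2 * r - t) = 1 := by
        exact_mod_cast congrArg (Int.cast : ℤ → 𝓞 k) huv
      have : ω - (r : 𝓞 k) = u * (a * (ω - r)) - v * ((ω - r) * (ω - r)) - (v * m) * (a * a') := by
        rw [hsq]; linear_combination (-(ω - (r : 𝓞 k))) * e
      rw [this]
      exact sub_mem (sub_mem (mul_mem_left _ _ p2) (mul_mem_left _ _ p4)) (mul_mem_left _ _ p1)

lemma QO.conjJ (h : QO k D t n ω c) {a b r : ℤ} (hab : a * b = ff t n r)
    (hc : IsCoprime a (2 * r - t) ∨ IsCoprime a b) : J ω a r * J ω a (t - r) = span {(a : 𝓞 k)} := by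
  have e := h.ff_eq r
  rw [← hab] at e
  apply le_antisymm
  · apply J_mul_le
    · exact mul_mem_left _ _ (mem_span_singleton_self _)
    · exact mul_mem_right _ _ (mem_span_singleton_self _)
    · exact mul_mem_left _ _ (mem_span_singleton_self _)
    · rw [e]; exact mem_span_singleton.mpr ⟨-b, by push_cast; ring⟩
  · rw [span_singleton_le_iff_mem]
    set P := J ω a r * J ω a (t - r)
    have p1 : (a : 𝓞 k) * a ∈ P := mul_mem_mul (J_a _ _ _) (J_a _ _ _)
    have p2 : (a : 𝓞 k) * (ω - ((t - r : ℤ) : 𝓞 k)) ∈ P := mul_mem_mul (J_a _ _ _) (J_w _ _ _)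
    have p3 : (ω - (r : 𝓞 k)) * a ∈ P := mul_mem_mul (J_w _ _ _) (J_a _ _ _)
    have p4 : (ω - (r : 𝓞 k)) * (ω - ((t - r : ℤ) : 𝓞 k)) ∈ P := mul_mem_mul (J_w _ _ _) (J_w _ _ _)
    rw [e] at p4
    push_cast at p2 p4
    rcases hc with ⟨u, v, huv⟩ | ⟨u, v, huv⟩
    · have e : (u : 𝓞 k) * a + v * (2 * r - t) = 1 := by
        exact_mod_cast congrArg (Int.cast : ℤ → 𝓞 k) huv
      have : (a : 𝓞 k) = u * (a * a) + v * (a * (ω - (t - r)) - (ω - r) * a) := by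
        linear_combination (-(a : 𝓞 k)) * e
      rw [this]
      exact add_mem (mul_mem_left _ _ p1) (mul_mem_left _ _ (sub_mem p2 p3))
    · have e : (u : 𝓞 k) * a + v * b = 1 := by
        exact_mod_cast congrArg (Int.cast : ℤ → 𝓞 k) huv
      have : (a : 𝓞 k) = u * (a * a) - v * (-(a * b)) := by
        linear_combination (-(a : 𝓞 k)) * e
      rw [this]
      exact sub_mem (mul_mem_left _ _ p1) (mul_mem_left _ _ p4)

/-- primes of the quadratic ring -/
lemma QO.primes (h : QO k D t n ω c) (P : Ideal (𝓞 k)) (hP : P.IsPrime) (ℓ : ℕ) (hl : ℓ.Prime)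
    (hm : (ℓ : 𝓞 k) ∈ P) : P = span {(ℓ : 𝓞 k)} ∨
      ∃ r : ℕ, r < ℓ ∧ (ℓ : ℤ) ∣ ff t n r ∧ P = J ω ℓ r := by
  have hl0 : (0 : ℤ) < ℓ := by exact_mod_cast hl.pos
  have hmZ : ∀ m : ℤ, (m : 𝓞 k) ∈ P ↔ (ℓ : ℤ) ∣ m := by
    intro m
    constructor
    · intro h1
      by_contra h2
      have : IsCoprime (ℓ : ℤ) m := by
        rw [Int.isCoprime_iff_gcd_eq_one]
        have := (Nat.Prime.coprime_iff_not_dvd hl).mpr (fun h3 => h2 (Int.natCast_dvd.mpr h3))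
        simpa [Int.gcd] using this
      obtain ⟨u, v, huv⟩ := this
      have e : (u : 𝓞 k) * ℓ + v * m = 1 := by
        exact_mod_cast congrArg (Int.cast : ℤ → 𝓞 k) huv
      apply hP.ne_top
      rw [eq_top_iff_one, ← e]
      exact add_mem (mul_mem_left _ _ hm) (mul_mem_left _ _ h1)
    · rintro ⟨q, rfl⟩
      push_cast
      exact mul_mem_right _ _ hm
  by_cases hr : ∃ r : ℤ, ω - r ∈ P
  · right
    obtain ⟨r, hr⟩ := hr
    have hr2 : ω - ((r % ℓ : ℤ) : 𝓞 k) ∈ P := by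
      have : ω - ((r % ℓ : ℤ) : 𝓞 k) = (ω - r) + ((r - r % ℓ : ℤ) : 𝓞 k) := by push_cast; ring
      rw [this]
      exact add_mem hr ((hmZ _).mpr (Int.dvd_self_sub_emod))
    obtain ⟨q, hq⟩ := Int.eq_ofNat_of_zero_le (Int.emod_nonneg r hl0.ne')
    have hql : q < ℓ := by
      have := Int.emod_lt_of_pos r hl0
      rw [hq] at this; exact_mod_cast this
    rw [hq] at hr2
    refine ⟨q, hql, ?_, ?_⟩
    · have e := h.ff_eq q
      rw [← dvd_neg, ← hmZ]
      push_cast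
      rw [← e]
      exact mul_mem_right _ _ hr2
    · apply le_antisymm
      · intro x hx
        obtain ⟨a, b, rfl⟩ := h.gen x
        have : (a : 𝓞 k) + b * ω = ((a + b * q : ℤ) : 𝓞 k) + b * (ω - ((q : ℤ) : 𝓞 k)) := by
          push_cast; ring
        rw [this] at hx ⊢
        have h2 : ((a + b * q : ℤ) : 𝓞 k) ∈ P := by
          have := sub_mem hx (mul_mem_left P (b : 𝓞 k) hr2)
          rwa [add_sub_cancel_right] at this
        obtain ⟨w, hw⟩ := (hmZ _).mp h2
        rw [hw]
        exact (mem_J _ _ _ _).mpr ⟨w, b, by push_cast; ring⟩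
      · exact J_le (by exact_mod_cast hm) hr2
  · left
    apply le_antisymm
    · intro x hx
      obtain ⟨a, b, rfl⟩ := h.gen x
      have hb : (ℓ : ℤ) ∣ b := by
        by_contra h2
        have : IsCoprime (ℓ : ℤ) b := by
          rw [Int.isCoprime_iff_gcd_eq_one]
          have := (Nat.Prime.coprime_iff_not_dvd hl).mpr (fun h3 => h2 (Int.natCast_dvd.mpr h3))
          simpa [Int.gcd] using this
        obtain ⟨u, v, huv⟩ := this
        have e : (u : 𝓞 k) * ℓ + v * b = 1 := by
          exact_mod_cast congrArg (Int.cast : ℤ → 𝓞 k) huv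
        apply hr
        refine ⟨-(v * a), ?_⟩
        have : ω - ((-(v * a) : ℤ) : 𝓞 k) = v * (a + b * ω) + (u * ω) * ℓ := by
          push_cast; linear_combination (-ω) * e
        rw [this]
        exact add_mem (mul_mem_left _ _ hx) (mul_mem_left _ _ hm)
      obtain ⟨b', rfl⟩ := hb
      have ha : (a : 𝓞 k) ∈ P := by
        have := sub_mem hx (mul_mem_left P (b' * ω : 𝓞 k) hm)
        convert this using 1; push_cast; ring
      obtain ⟨a', rfl⟩ := (hmZ _).mp ha
      exact mem_span_singleton.mpr ⟨a' + b' * ω, by push_cast; ring⟩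
    · rwa [span_singleton_le_iff_mem]

/-- Minkowski -/
lemma QO.mink (h : QO k D t n ω c) (C : ClassGroup (𝓞 k)) :
    ∃ I : Ideal (𝓞 k), I ≠ ⊥ ∧ cl I = C ∧ 49 * absNorm I ^ 2 ≤ 20 * D.natAbs := by
  obtain ⟨I, hI, hN⟩ := exists_ideal_in_class_of_norm_le C
  have hI0 : (I : Ideal (𝓞 k)) ≠ ⊥ := nonZeroDivisors.ne_zero I.2
  refine ⟨I, hI0, by rw [cl_eq _ hI0]; exact hI, ?_⟩
  have hr : InfinitePlace.nrComplexPlaces k ≤ 1 := by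
    have := InfinitePlace.card_add_two_mul_card_eq_rank k
    rw [h.fr] at this
    omega
  rw [h.fr] at hN
  have hπ := Real.pi_gt_d2
  have hπ4 := Real.pi_le_four
  have h4 : (1 : ℝ) ≤ 4 / Real.pi := by rw [le_div_iff₀ Real.pi_pos]; linarith
  have h5 : (4 / Real.pi) ^ InfinitePlace.nrComplexPlaces k ≤ 4 / Real.pi := by
    calc _ ≤ (4 / Real.pi) ^ 1 := pow_le_pow_right₀ h4 hr
      _ = _ := pow_one _
  have h6 : (absNorm (I : Ideal (𝓞 k)) : ℝ) ≤ (4 / Real.pi) * (1 / 2 * √|(D : ℝ)|) := by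
    refine hN.trans ?_
    have hd : (|discr k| : ℝ) = |(D : ℝ)| := by
      have := h.dis
      exact_mod_cast this
    rw [hd]
    have : (((2 : ℕ).factorial : ℕ) : ℝ) / ((2 : ℕ) : ℝ) ^ 2 = 1 / 2 := by norm_num [Nat.factorial]
    rw [this]
    apply mul_le_mul_of_nonneg_right h5
    positivity
  have h7 : (absNorm (I : Ideal (𝓞 k)) : ℝ) ^ 2 ≤ ((4 / Real.pi) * (1 / 2 * √|(D : ℝ)|)) ^ 2 :=
    pow_le_pow_left₀ (by positivity) h6 2
  have h8 : ((4 / Real.pi) * (1 / 2 * √|(D : ℝ)|)) ^ 2 = 4 / Real.pi ^ 2 * |(D : ℝ)| := by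
    rw [mul_pow, mul_pow, Real.sq_sqrt (abs_nonneg _)]; field_simp; norm_num
  have h9 : 4 / Real.pi ^ 2 ≤ 20 / 49 := by
    rw [div_le_div_iff₀ (by positivity) (by norm_num)]; nlinarith
  have h10 : (49 : ℝ) * (absNorm (I : Ideal (𝓞 k)) : ℝ) ^ 2 ≤ 20 * |(D : ℝ)| := by
    have := mul_le_mul_of_nonneg_right h9 (abs_nonneg (D : ℝ))
    rw [h8] at h7
    linarith
  have h11 : |(D : ℝ)| = ((D.natAbs : ℕ) : ℝ) := by simp [Nat.cast_natAbs]
  rw [h11] at h10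
  exact_mod_cast h10

end qideal
end TQ

namespace TQ
section alg
open Ideal

/-- strict evaluation helper -/
def force {α : Type} (x : ℤ) (f : ℤ → α) : α :=
  match x with
  | Int.ofNat 0 => f 0
  | Int.ofNat (m + 1) => f (Int.ofNat (m + 1))
  | Int.negSucc 0 => f (-1)
  | Int.negSucc (m + 1) => f (Int.negSucc (m + 1))

lemma force_eq {α : Type} (x : ℤ) (f : ℤ → α) : force x f = f x := by
  unfold force; split <;> rfl

/-- normalised residue -/
def nrm (t R a r : ℤ) : ℤ :=
  if R < |a| then ((t - |a|) / 2 + 1) + (r - ((t - |a|) / 2 + 1)) % |a| +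
    (if |a| = -R then (if ((t - |a|) / 2 + 1) + (r - ((t - |a|) / 2 + 1)) % |a| ≤ 0 then |a| else -|a|)
      else 0)
  else (R + t) / 2 - ((R + t) / 2 - r) % |a|

/-- hit the target class -/
def hit (t a0 r0 a r : ℤ) : Bool :=
  (a == 1 || a == -1) || ((a == a0 || a == -a0) && ((r - r0) % a0 == 0 || (r + r0 - t) % a0 == 0))

/-- reduction of the ideal `J a r` -/
def red (t n R a0 r0 : ℤ) : ℕ → ℤ → ℤ → Bool
  | 0, _, _ => false
  | f + 1, a, r =>
    hit t a0 r0 a r ||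
    force (nrm t R a r) (fun r' => force (ff t n r' / a) (fun b =>
      (a * b == ff t n r') && (r' - r) % a == 0 && b != 0 &&
        force (t - r') (fun q => red t n R a0 r0 f b q)))

variable {k : Type*} [Field k] [NumberField k] {D t n : ℤ} {ω : 𝓞 k} {c : 𝓞 k ≃+* 𝓞 k}

lemma QO.hit (h : QO k D t n ω c) {a0 r0 : ℤ} (ha0 : a0 ≠ 0) (hd : a0 ∣ ff t n r0)
    (hc : IsCoprime a0 (2 * r0 - t)) (a r : ℤ) (hh : hit t a0 r0 a r = true) :
    cl (J ω a r) ∈ Subgroup.zpowers (cl (J ω a0 r0)) := by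
  simp only [TQ.hit, Bool.or_eq_true, Bool.and_eq_true, beq_iff_eq] at hh
  have htop : cl (⊤ : Ideal (𝓞 k)) = 1 := by
    rw [← Ideal.span_singleton_one]; exact cl_span one_ne_zero
  obtain ⟨b, hb⟩ := hd
  have key : cl (J ω a0 r0) * cl (J ω a0 (t - r0)) = 1 := by
    rw [← cl_mul (J_ne_bot _ _ ha0) (J_ne_bot _ _ ha0), h.conjJ hb.symm (Or.inl hc), cl_span]
    exact_mod_cast ha0
  rcases hh with (rfl | rfl) | ⟨h1, h2⟩
  · rw [J_one, htop]; exact one_mem _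
  · rw [J_neg, J_one, htop]; exact one_mem _
  · have h3 : J ω a r = J ω a0 r := by
      rcases h1 with rfl | rfl
      · rfl
      · exact J_neg _ _ _
    rw [h3]
    rcases h2 with h2 | h2
    · rw [J_congr ω (Int.dvd_of_emod_eq_zero h2)]
      exact Subgroup.mem_zpowers _
    · rw [J_congr ω (r' := r) (r := t - r0) (Int.dvd_of_emod_eq_zero (by rw [← h2]; congr 1; ring)),
        eq_inv_of_mul_eq_one_right key]
      exact inv_mem (Subgroup.mem_zpowers _)

lemma QO.red (h : QO k D t n ω c) {R a0 r0 : ℤ} (ha0 : a0 ≠ 0) (hd : a0 ∣ ff t n r0)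
    (hc : IsCoprime a0 (2 * r0 - t)) (f : ℕ) : ∀ (a r : ℤ), a ≠ 0 → red t n R a0 r0 f a r = true →
    cl (J ω a r) ∈ Subgroup.zpowers (cl (J ω a0 r0)) := by
  induction f with
  | zero => intro a r _ hh; simp [TQ.red] at hh
  | succ f ih =>
    intro a r ha hh
    simp only [TQ.red, force_eq, Bool.or_eq_true, Bool.and_eq_true, beq_iff_eq, bne_iff_ne] at hh
    rcases hh with hh | ⟨⟨⟨h1, h2⟩, h3⟩, h4⟩
    · exact h.hit ha0 hd hc a r hh
    · rw [← J_congr ω (Int.dvd_of_emod_eq_zero h2), h.swap ha h3 h1]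
      exact ih _ _ h3 h4

/-- check for one root -/
def okr (t n R a0 r0 : ℤ) (e2 : Bool) (fuel : ℕ) (l r : ℤ) : Bool :=
  if e2 then
    if (2 * r - t) % l == 0 then (ff t n r / l) % l != 0
    else force (r + l * ((-(ff t n r / l) * ((2 * r - t) ^ (l.toNat - 2))) % l)) (fun r' =>
      ff t n r' % (l * l) == 0 && red t n R a0 r0 fuel (l * l) r')
  else red t n R a0 r0 fuel l r

/-- weak primality test -/
def wp (l : ℕ) : Bool := l != 1 && [2, 3, 5, 7, 11].all (fun q => l % q != 0 || l == q)

lemma wp_prime {l : ℕ} (hl : l.Prime) : wp l = true := by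
  simp only [wp, List.all_eq_true, Bool.or_eq_true, bne_iff_ne, beq_iff_eq, Bool.and_eq_true]
  refine ⟨hl.ne_one, ?_⟩
  intro q hq
  by_contra hc
  push Not at hc
  have h1 := (Nat.dvd_prime hl).mp (Nat.dvd_of_mod_eq_zero hc.1)
  rcases h1 with h1 | h1
  · subst h1; simp at hq
  · exact hc.2 h1.symm

/-- check for one prime -/
def okl (t n R a0 r0 : ℤ) (e2 : Bool) (fuel : ℕ) (l : ℕ) : Bool :=
  (List.range l).all (fun r => ff t n r % l != 0 || okr t n R a0 r0 e2 fuel l r)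

/-- full check -/
def chk (D R a0 r0 : ℤ) (e2 : Bool) (fuel : ℕ) : Bool :=
  fund D && a0 != 0 && ff (tt D) (nn D) r0 % (a0 ^ 3) == 0 && Int.gcd a0 (2 * r0 - tt D) == 1 &&
  red (tt D) (nn D) R 1 0 fuel (a0 ^ 3) r0 &&
  (List.range 170).all (fun l => decide (20 * D.natAbs < 49 * (l * l)) || !(wp l) ||
    okl (tt D) (nn D) R a0 r0 e2 fuel l)

/-- the exponent -/
def exq (e2 : Bool) : ℕ := if e2 then 2 else 1

lemma QO.okr (h : QO k D t n ω c) {R a0 r0 : ℤ} (ha0 : a0 ≠ 0) (hd : a0 ∣ ff t n r0)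
    (hc : IsCoprime a0 (2 * r0 - t)) (e2 : Bool) (f : ℕ) (l : ℕ) (hl : l.Prime) (r : ℤ)
    (hr : (l : ℤ) ∣ ff t n r) (hok : okr t n R a0 r0 e2 f l r = true) :
    cl (J ω l r) ^ (exq e2) ∈ Subgroup.zpowers (cl (J ω a0 r0)) := by
  have hl0 : (l : ℤ) ≠ 0 := by exact_mod_cast hl.ne_zero
  have hlp := Nat.prime_iff_prime_int.mp hl
  cases e2 with
  | false =>
    simp only [TQ.okr, exq, pow_one, Bool.false_eq_true, if_false] at hok ⊢
    exact h.red ha0 hd hc f _ _ hl0 hok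
  | true =>
    simp only [TQ.okr, exq, if_true, force_eq] at hok ⊢
    split_ifs at hok with h1
    · rw [beq_iff_eq] at h1
      rw [bne_iff_ne] at hok
      obtain ⟨b, hb⟩ := hr
      rw [hb, Int.mul_ediv_cancel_left _ hl0] at hok
      have hcp : IsCoprime (l : ℤ) b := by
        rw [Prime.coprime_iff_not_dvd hlp]
        exact fun h2 => hok (Int.emod_eq_zero_of_dvd h2)
      have := h.conjJ hb.symm (Or.inr hcp)
      rw [J_congr ω (r := r) (r' := t - r) (by
        rw [← dvd_neg]; exact Int.dvd_of_emod_eq_zero (by rw [← h1]; congr 1; ring))] at this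
      rw [sq, ← cl_mul (J_ne_bot _ _ hl0) (J_ne_bot _ _ hl0), this, cl_span]
      · exact one_mem _
      · exact_mod_cast hl0
    · simp only [Bool.and_eq_true, beq_iff_eq] at hok h1
      set r' := r + (l : ℤ) * ((-(ff t n r / l) * ((2 * r - t) ^ (((l : ℕ) : ℤ).toNat - 2))) % l)
      have e : J ω l r = J ω l r' := (J_congr ω (r := r) (r' := r') ⟨_, by simp only [r']; rw [add_sub_cancel_left]⟩).symm
      have hcp : IsCoprime (l : ℤ) (2 * r' - t) := by
        rw [Prime.coprime_iff_not_dvd hlp]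
        intro h2
        apply h1
        apply Int.emod_eq_zero_of_dvd
        have h3 : (2 * r - t) = (2 * r' - t) - l * (2 * ((-(ff t n r / l) * ((2 * r - t) ^ (((l : ℕ) : ℤ).toNat - 2))) % l)) := by
          simp only [r']; ring
        rw [h3]
        exact dvd_sub h2 (dvd_mul_right _ _)
      rw [e, sq, ← cl_mul (J_ne_bot _ _ hl0) (J_ne_bot _ _ hl0),
        h.mulJ (Int.dvd_of_emod_eq_zero hok.1) hcp]
      exact h.red ha0 hd hc f _ _ (mul_ne_zero hl0 hl0) hok.2

theorem QO.chk (h : QO k D (tt D) (nn D) ω c) {R a0 r0 : ℤ} {e2 : Bool} {f : ℕ}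
    (hk : chk D R a0 r0 e2 f = true) :
    cl (J ω a0 r0) ^ 3 = 1 ∧
      ∀ C : ClassGroup (𝓞 k), C ^ (exq e2) ∈ Subgroup.zpowers (cl (J ω a0 r0)) := by
  simp only [TQ.chk, Bool.and_eq_true, bne_iff_ne, beq_iff_eq, List.all_eq_true, List.mem_range,
    Bool.or_eq_true, decide_eq_true_eq, Bool.not_eq_true'] at hk
  obtain ⟨⟨⟨⟨⟨hf, ha0⟩, hd3⟩, hg⟩, hr3⟩, hall⟩ := hk
  have hc : IsCoprime a0 (2 * r0 - tt D) := Int.isCoprime_iff_gcd_eq_one.mpr hg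
  have hd3 := Int.dvd_of_emod_eq_zero hd3
  have hd : a0 ∣ ff (tt D) (nn D) r0 := (dvd_pow_self a0 (by norm_num)).trans hd3
  constructor
  · have h1 := h.red (R := R) (a0 := 1) (r0 := 0) one_ne_zero (one_dvd _) isCoprime_one_left f _ _
      (pow_ne_zero 3 ha0) hr3
    have htop : cl (⊤ : Ideal (𝓞 k)) = 1 := by
      rw [← Ideal.span_singleton_one]; exact cl_span one_ne_zero
    rw [J_one, htop, Subgroup.zpowers_one_eq_bot, Subgroup.mem_bot] at h1
    have e1 : J ω a0 r0 * J ω a0 r0 = J ω (a0 * a0) r0 :=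
      h.mulJ ((Dvd.intro _ (by ring : a0 * a0 * a0 = a0 ^ 3)).trans hd3) hc
    have e2 : J ω a0 r0 * J ω (a0 * a0) r0 = J ω (a0 * (a0 * a0)) r0 :=
      h.mulJ (by rw [show a0 * (a0 * a0) = a0 ^ 3 by ring]; exact hd3) hc
    rw [← cl_pow (J_ne_bot _ _ ha0), ← h1, pow_succ', sq, e1, e2]
    congr 2; ring
  · intro C
    obtain ⟨I, hI0, hIC, hN⟩ := h.mink C
    rw [← hIC]
    clear hIC C
    have key : ∀ m : ℕ, ∀ I : Ideal (𝓞 k), absNorm I = m → I ≠ ⊥ → 49 * absNorm I ^ 2 ≤ 20 * D.natAbs →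
        cl I ^ (exq e2) ∈ Subgroup.zpowers (cl (J ω a0 r0)) := by
      intro m
      induction m using Nat.strong_induction_on with
      | _ m ih =>
        intro I hm hI0 hN
        by_cases hT : I = ⊤
        · rw [hT, ← Ideal.span_singleton_one, cl_span one_ne_zero, one_pow]; exact one_mem _
        obtain ⟨P, hP, hIP⟩ := Ideal.exists_le_maximal I hT
        have hPp := hP.isPrime
        obtain ⟨I', hI'⟩ := Ideal.dvd_iff_le.mpr hIP
        have hP0 : P ≠ ⊥ := by rintro rfl; apply hI0; rw [hI', Ideal.bot_mul]
        have hI'0 : I' ≠ ⊥ := by rintro rfl; apply hI0; rw [hI', Ideal.mul_bot]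
        have hmul : absNorm I = absNorm P * absNorm I' := by rw [hI', map_mul]
        have n1 : absNorm P ≠ 0 := absNorm_eq_zero_iff.not.mpr hP0
        have n2 : absNorm I' ≠ 0 := absNorm_eq_zero_iff.not.mpr hI'0
        have n3 : absNorm P ≠ 1 := fun h1 => hP.ne_top (absNorm_eq_one_iff.mp h1)
        have l1 : absNorm P ≤ absNorm I := by
          rw [hmul]; exact Nat.le_mul_of_pos_right _ (Nat.pos_of_ne_zero n2)
        have l2 : absNorm I' ≤ absNorm I := by
          rw [hmul]; exact Nat.le_mul_of_pos_left _ (Nat.pos_of_ne_zero n1)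
        have l3 : absNorm I' < absNorm I := by
          rw [hmul]
          have : 2 ≤ absNorm P := by omega
          nlinarith [Nat.pos_of_ne_zero n2]
        rw [hI', cl_mul hP0 hI'0, mul_pow]
        refine mul_mem ?_ (ih _ (hm ▸ l3) I' rfl hI'0 (le_trans (by gcongr) hN))
        have hPm : ((absNorm P : ℕ) : 𝓞 k) ∈ P := absNorm_mem P
        obtain ⟨l, hl, hlP, hlN⟩ : ∃ l : ℕ, l.Prime ∧ (l : 𝓞 k) ∈ P ∧ l ∣ absNorm P := by
          have gen : ∀ N : ℕ, N ≠ 0 → (N : 𝓞 k) ∈ P → ∃ l : ℕ, l.Prime ∧ (l : 𝓞 k) ∈ P ∧ l ∣ N := by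
            intro N
            induction N using Nat.strong_induction_on with
            | _ N ih2 =>
              intro hN0 hNP
              by_cases hN1 : N = 1
              · subst hN1
                exact absurd ((eq_top_iff_one P).mpr (by simpa using hNP)) hP.ne_top
              have hp := Nat.minFac_prime hN1
              obtain ⟨M, hM⟩ := Nat.minFac_dvd N
              rw [hM] at hNP
              push_cast at hNP
              rcases hPp.mem_or_mem hNP with h1 | h1
              · exact ⟨_, hp, h1, Nat.minFac_dvd N⟩
              · have hM0 : M ≠ 0 := by rintro rfl; exact hN0 (by rw [hM, mul_zero])
                have : M < N := by
                  have h2 := hp.two_le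
                  have : 0 < M := Nat.pos_of_ne_zero hM0
                  calc M < N.minFac * M := by nlinarith
                    _ = N := hM.symm
                obtain ⟨l, a1, a2, a3⟩ := ih2 M this hM0 h1
                exact ⟨l, a1, a2, a3.trans (Dvd.intro_left _ hM.symm)⟩
          exact gen _ n1 hPm
        have hlle : l ≤ absNorm P := Nat.le_of_dvd (Nat.pos_of_ne_zero n1) hlN
        have hlB : 49 * l ^ 2 ≤ 20 * D.natAbs := le_trans (by gcongr; exact hlle.trans l1) hN
        have hDlt : D.natAbs < 65536 := by
          simp only [fund, Bool.and_eq_true, decide_eq_true_eq] at hf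
          exact hf.1.2
        have hl170 : l < 170 := by nlinarith
        rcases h.primes P hPp l hl hlP with h1 | ⟨r, hr, hrd, h1⟩
        · rw [h1, cl_span, one_pow]
          · exact one_mem _
          · exact_mod_cast hl.ne_zero
        · rw [h1]
          have := hall l hl170
          rw [wp_prime hl] at this
          have hnl : ¬ (20 * D.natAbs < 49 * (l * l)) := by rw [← sq]; omega
          simp only [hnl, false_or, okl, List.all_eq_true, List.mem_range, Bool.or_eq_true,
            bne_iff_ne] at this
          have h2 := (this.resolve_left (by simp)) r hr
          have h3 := h2.resolve_left (fun h4 => h4 (Int.emod_eq_zero_of_dvd hrd))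
          exact h.okr ha0 hd hc e2 f l hl r hrd h3
    exact key _ I rfl hI0 hN

end alg
end TQ

namespace TQ
section npr
open Ideal

variable {k : Type*} [Field k] [NumberField k] {D t n : ℤ} {ω : 𝓞 k} {c : 𝓞 k ≃+* 𝓞 k}

lemma QO.coef (h : QO k D t n ω c) {a b a' b' : ℤ} (e : (a : 𝓞 k) + b * ω = a' + b' * ω) :
    a = a' ∧ b = b' := by
  have := h.ind (a - a') (b - b') (by push_cast; linear_combination e)
  constructor <;> linarith [this.1, this.2]

lemma QO.dvd_int (h : QO k D t n ω c) {a b : ℤ} (e : (a : 𝓞 k) ∣ b) : a ∣ b := by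
  obtain ⟨x, hx⟩ := e
  obtain ⟨p, q, rfl⟩ := h.gen x
  have := h.coef (a := b) (b := 0) (a' := a * p) (b' := a * q) (by push_cast; linear_combination hx)
  exact ⟨p, this.1⟩

/-- a generator gives a norm equation -/
lemma QO.norm_eq (h : QO k D t n ω c) {a r : ℤ} (ha : 1 < a) (hd : a ∣ ff t n r)
    (hc : IsCoprime a (2 * r - t)) (h1 : cl (J ω a r) = 1) :
    ∃ X Y : ℤ, Y ≠ 0 ∧ (X ^ 2 - D * Y ^ 2 = 4 * a ∨ X ^ 2 - D * Y ^ 2 = -(4 * a)) := by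
  obtain ⟨x, hx0, hx⟩ := (cl_eq_one (J_ne_bot _ _ (by omega))).mp h1
  obtain ⟨b, hb⟩ := hd
  have h2 := h.conjJ hb.symm (Or.inl hc)
  have h3 : J ω a (t - r) = span {c x} := by
    have h4 : (J ω a r).map c = span {c x} := by rw [hx, Ideal.map_span]; simp
    rw [← h4]
    unfold J
    rw [Ideal.map_span, Set.image_pair, map_sub, h.conj, map_intCast, map_intCast]
    have : (t : 𝓞 k) - ω - r = -(ω - ((t - r : ℤ) : 𝓞 k)) := by push_cast; ring
    rw [this]
    apply le_antisymm
    · rw [span_le]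
      rintro y (rfl | rfl)
      · exact subset_span (by simp)
      · rw [← neg_neg (ω - _)]
        exact neg_mem (subset_span (by simp))
    · rw [span_le]
      rintro y (rfl | rfl)
      · exact subset_span (by simp)
      · exact neg_mem (subset_span (by simp))
  obtain ⟨u, v, rfl⟩ := h.gen x
  rw [hx, h3, span_singleton_mul_span_singleton] at h2
  have h5 : ((u : 𝓞 k) + v * ω) * c (u + v * ω) = ((u ^ 2 + t * u * v + n * v ^ 2 : ℤ) : 𝓞 k) := by
    simp only [map_add, map_mul, map_intCast, h.conj]
    push_cast
    linear_combination (- (v : 𝓞 k) ^ 2) * h.rel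
  rw [h5] at h2
  have d1 : (u ^ 2 + t * u * v + n * v ^ 2) ∣ a :=
    h.dvd_int (span_singleton_le_span_singleton.mp h2.ge)
  have d2 : a ∣ (u ^ 2 + t * u * v + n * v ^ 2) :=
    h.dvd_int (span_singleton_le_span_singleton.mp h2.le)
  have h6 := Int.associated_iff.mp (associated_of_dvd_dvd d1 d2)
  refine ⟨2 * u + t * v, v, ?_, ?_⟩
  · rintro rfl
    have h7 : ω - (r : 𝓞 k) ∈ span {(u : 𝓞 k) + ((0 : ℤ) : 𝓞 k) * ω} := hx ▸ J_w ω a r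
    rw [mem_span_singleton] at h7
    obtain ⟨y, hy⟩ := h7
    obtain ⟨p, q, rfl⟩ := h.gen y
    have h8 := (h.coef (a := -r) (b := 1) (a' := u * p) (b' := u * q)
      (by push_cast at hy ⊢; linear_combination hy)).2
    have h9 : u ^ 2 = 1 := by
      rcases Int.isUnit_iff.mp (IsUnit.of_mul_eq_one _ h8.symm) with rfl | rfl <;> rfl
    rcases h6 with h6 | h6 <;> nlinarith
  · have hD := h.D_eq
    subst hD
    rcases h6 with h6 | h6
    · left; rw [← h6]; ring
    · right; linear_combination 4 * h6

lemma no_sol {D T U a : ℤ} (ha : 0 < a) (hD : 0 < D) (hT : 2 < T) (hU : 0 < U) (hTU : T ^ 2 - D * U ^ 2 = 4)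
    (hf : ∀ Y : ℕ, (T - 2) * Y ^ 2 ≤ a * U ^ 2 → ∀ X : ℤ, X ^ 2 - D * Y ^ 2 ≠ 4 * a ∧ X ^ 2 - D * Y ^ 2 ≠ -(4 * a)) :
    ∀ (m : ℕ) (X Y : ℤ), Y.natAbs = m → ¬ (X ^ 2 - D * Y ^ 2 = 4 * a ∨ X ^ 2 - D * Y ^ 2 = -(4 * a)) := by
  intro m
  induction m using Nat.strong_induction_on with
  | _ m ih =>
    intro X Y hm hs
    have hs' : |X| ^ 2 - D * |Y| ^ 2 = 4 * a ∨ |X| ^ 2 - D * |Y| ^ 2 = -(4 * a) := by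
      rwa [sq_abs, sq_abs]
    by_cases hb : (T - 2) * Y ^ 2 ≤ a * U ^ 2
    · have := hf Y.natAbs (by rwa [Int.natCast_natAbs, sq_abs]) X
      rw [Int.natCast_natAbs, sq_abs] at this
      rcases hs with h | h
      · exact this.1 h
      · exact this.2 h
    · push Not at hb
      have hY : |Y| = (m : ℤ) := by rw [← hm, Int.natCast_natAbs]
      have hb' : a * U ^ 2 < (T - 2) * |Y| ^ 2 := by rwa [sq_abs]
      have hx0 := abs_nonneg X
      have hy0 := abs_nonneg Y
      generalize |X| = x at *
      generalize |Y| = y at *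
      have hy1 : 0 < y := by
        rcases hy0.eq_or_lt with h | h
        · subst h; nlinarith [mul_pos ha (pow_pos hU 2)]
        · exact h
      have hyy := mul_pos hy1 hy1
      have k1 : x ^ 2 ≤ D * y ^ 2 + 4 * a ∧ D * y ^ 2 - 4 * a ≤ x ^ 2 := by
        rcases hs' with h | h <;> constructor <;> linarith
      have kA : U ^ 2 * x ^ 2 ≤ (T ^ 2 - 4) * y ^ 2 + 4 * (a * U ^ 2) := by
        have := mul_le_mul_of_nonneg_left k1.1 (sq_nonneg U)
        nlinarith
      have kB : (T ^ 2 - 4) * y ^ 2 - 4 * (a * U ^ 2) ≤ U ^ 2 * x ^ 2 := by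
        have := mul_le_mul_of_nonneg_left k1.2 (sq_nonneg U)
        nlinarith
      have l1 : (T - 2) * y < U * x := by
        apply lt_of_pow_lt_pow_left₀ 2 (by positivity)
        nlinarith
      have l2 : U * x < (T + 2) * y := by
        apply lt_of_pow_lt_pow_left₀ 2 (by nlinarith)
        nlinarith
      have par : ∀ z : ℤ, (z ^ 2 - z) % 2 = 0 := by
        intro z
        have : z ^ 2 - z = z * (z - 1) := by ring
        rw [this]
        rcases Int.emod_two_eq_zero_or_one z with h | h
        · exact Int.emod_eq_zero_of_dvd (Dvd.dvd.mul_right (Int.dvd_of_emod_eq_zero h) _)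
        · exact Int.emod_eq_zero_of_dvd (Dvd.dvd.mul_left (by omega) _)
      have pT : (2 : ℤ) ∣ T - D * U := by
        have e1 := Int.dvd_of_emod_eq_zero (par T)
        have e2 := Int.dvd_of_emod_eq_zero (par U)
        have : T - D * U = 4 - (T ^ 2 - T) + D * (U ^ 2 - U) := by linarith
        rw [this]
        exact dvd_add (dvd_sub (by norm_num) e1) (e2.mul_left _)
      have pX : (2 : ℤ) ∣ x - D * y := by
        have e1 := Int.dvd_of_emod_eq_zero (par x)
        have e2 := Int.dvd_of_emod_eq_zero (par y)
        have : x - D * y = (x ^ 2 - D * y ^ 2) - (x ^ 2 - x) + D * (y ^ 2 - y) := by ring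
        rw [this]
        refine dvd_add (dvd_sub ?_ e1) (e2.mul_left _)
        rcases hs' with h | h <;> rw [h]
        · exact ⟨2 * a, by ring⟩
        · exact ⟨-2 * a, by ring⟩
      have p1 : (2 : ℤ) ∣ T * y - U * x := by
        have : T * y - U * x = (T - D * U) * y - U * (x - D * y) := by ring
        rw [this]
        exact dvd_sub (pT.mul_right _) (pX.mul_left _)
      have p2 : (2 : ℤ) ∣ T * x - D * U * y := by
        have e1 := Int.dvd_of_emod_eq_zero (par D)
        have : T * x - D * U * y = (T - D * U) * x + D * U * (x - D * y) + (D ^ 2 - D) * U * y := by ring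
        rw [this]
        exact dvd_add (dvd_add (pT.mul_right _) (pX.mul_left _)) ((e1.mul_right _).mul_right _)
      obtain ⟨y', hy'⟩ := p1
      obtain ⟨x', hx'⟩ := p2
      refine ih y'.natAbs ?_ x' y' rfl ?_
      · have : |y'| < y := by rw [abs_lt]; constructor <;> linarith
        have h5 : ((y'.natAbs : ℕ) : ℤ) < m := by rw [Int.natCast_natAbs, ← hY]; exact this
        exact_mod_cast h5
      · have e : 4 * (x' ^ 2 - D * y' ^ 2) = 4 * (x ^ 2 - D * y ^ 2) := by
          have : 4 * (x' ^ 2 - D * y' ^ 2) = (T * x - D * U * y) ^ 2 - D * (T * y - U * x) ^ 2 := by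
            rw [hy', hx']; ring
          rw [this]
          linear_combination (x ^ 2 - D * y ^ 2) * hTU
        have e' : x' ^ 2 - D * y' ^ 2 = x ^ 2 - D * y ^ 2 := by linarith
        rwa [e']

def nsq : ℕ → ℕ → ℕ → ℕ
  | 0, _, g => g
  | f + 1, m, g => nsq f m ((g + m / g) / 2)

/-- certified nonsquare with a guess -/
def nst (s : ℕ) (m : ℤ) : Bool := decide ((s * s : ℕ) < m) && decide (m < ((s + 1) * (s + 1) : ℕ))

/-- certified nonsquare -/
def nsqt (m : ℤ) : Bool :=
  decide (m < 0) || nst (nsq 12 m.toNat 5000) m || nst (nsq 13 m.toNat 5000) m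

lemma nst_ok {s : ℕ} {m : ℤ} (h : nst s m = true) (X : ℤ) : X ^ 2 ≠ m := by
  rintro rfl
  simp only [nst, Bool.and_eq_true, decide_eq_true_eq] at h
  obtain ⟨h1, h2⟩ := h
  push_cast at h1 h2
  rw [← sq, sq_lt_sq] at h1
  rw [← sq, sq_lt_sq] at h2
  rw [abs_of_nonneg (by positivity)] at h1
  rw [abs_of_nonneg (by positivity : (0 : ℤ) ≤ (s : ℤ) + 1)] at h2
  omega

lemma nsqt_ok {m : ℤ} (h : nsqt m = true) (X : ℤ) : X ^ 2 ≠ m := by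
  simp only [nsqt, Bool.or_eq_true, decide_eq_true_eq] at h
  rcases h with (h | h) | h
  · nlinarith [sq_nonneg X]
  · exact nst_ok h X
  · exact nst_ok h X

/-- test of nonprincipality -/
def npr (D a T U : ℤ) : Bool :=
  decide (1 < a) && ((decide (D < 0) && decide (4 * a < -D)) ||
  (decide (0 < D) && decide (2 < T) && decide (0 < U) && T ^ 2 - D * U ^ 2 == 4 &&
    decide (a * U ^ 2 < (T - 2) * 220 ^ 2) &&
    (List.range 220).all (fun Y => nsqt (D * (Y : ℤ) ^ 2 + 4 * a) && nsqt (D * (Y : ℤ) ^ 2 - 4 * a))))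

lemma QO.npr (h : QO k D t n ω c) {a r T U : ℤ} (hn : npr D a T U = true) (hd : a ∣ ff t n r)
    (hc : IsCoprime a (2 * r - t)) : cl (J ω a r) ≠ 1 := by
  simp only [TQ.npr, Bool.or_eq_true, Bool.and_eq_true, decide_eq_true_eq, beq_iff_eq,
    List.all_eq_true, List.mem_range] at hn
  intro h1
  obtain ⟨ha, hn⟩ := hn
  obtain ⟨X, Y, hY, hXY⟩ := h.norm_eq ha hd hc h1
  rcases hn with ⟨h2, h3⟩ | ⟨⟨⟨⟨⟨h2, h3⟩, h4⟩, h5⟩, h6⟩, h7⟩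
  · have : 1 ≤ Y ^ 2 := by
      have := sq_nonneg Y
      have h8 : Y ^ 2 ≠ 0 := pow_ne_zero _ hY
      omega
    rcases hXY with e | e <;> nlinarith [sq_nonneg X]
  · refine no_sol (by omega) h2 h3 h4 h5 ?_ _ X Y rfl hXY
    intro Z hZ W
    have hZ2 : Z < 220 := by
      by_contra hc
      push Not at hc
      have : (220 : ℤ) ≤ Z := by exact_mod_cast hc
      have h8 : (220 : ℤ) ^ 2 ≤ (Z : ℤ) ^ 2 := by gcongr
      have h9 := mul_le_mul_of_nonneg_left h8 (by omega : 0 ≤ T - 2)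
      linarith
    obtain ⟨q1, q2⟩ := h7 Z hZ2
    constructor
    · intro e; exact nsqt_ok q1 W (by linarith)
    · intro e; exact nsqt_ok q2 W (by linarith)

/-- class group data of a quadratic field -/
theorem QS.cls {s : k} (h : QS k s D) {R a0 r0 T U : ℤ} {f : ℕ} (hk : chk D R a0 r0 true f = true)
    (hn : a0 = 1 ∨ TQ.npr D a0 T U = true) :
    ∃ g : ClassGroup (𝓞 k), g ^ 3 = 1 ∧ (a0 = 1 → g = 1) ∧ (a0 ≠ 1 → g ≠ 1) ∧
      ∀ C, C ^ 2 ∈ Subgroup.zpowers g := by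
  obtain ⟨ω, c, ho, -⟩ := h.qo
  obtain ⟨h1, h2⟩ := ho.chk hk
  refine ⟨_, h1, ?_, ?_, h2⟩
  · rintro rfl
    rw [J_one, ← Ideal.span_singleton_one, cl_span one_ne_zero]
  · intro h3
    refine ho.npr (hn.resolve_left h3) ?_ ?_
    all_goals
      simp only [TQ.chk, Bool.and_eq_true, bne_iff_ne, beq_iff_eq] at hk
    · exact (dvd_pow_self a0 (by norm_num)).trans (Int.dvd_of_emod_eq_zero hk.1.1.1.2)
    · exact Int.isCoprime_iff_gcd_eq_one.mpr hk.1.1.2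

/-- odd class number -/
theorem QS.odd {s : k} (h : QS k s D) {R a0 r0 : ℤ} {f : ℕ} (hk : chk D R a0 r0 false f = true) :
    Odd (Nat.card (ClassGroup (𝓞 k))) := by
  obtain ⟨ω, c, ho, -⟩ := h.qo
  obtain ⟨h1, h2⟩ := ho.chk hk
  have h3 : Nat.card (ClassGroup (𝓞 k)) ∣ 3 := by
    have e : Nat.card (Subgroup.zpowers (cl (J ω a0 r0))) = Nat.card (ClassGroup (𝓞 k)) := by
      have : Subgroup.zpowers (cl (J ω a0 r0)) = ⊤ := by
        rw [eq_top_iff]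
        intro C _
        simpa [exq] using h2 C
      rw [this, Subgroup.card_top]
    rw [← e, Nat.card_zpowers]
    exact orderOf_dvd_of_pow_eq_one h1
  exact Odd.of_dvd_nat (by decide) h3

end npr
end TQ

namespace TQ
section fld
open IntermediateField

lemma quad_rep {F M : Type*} [Field F] [Field M] [Algebra F M] (s : M) (c : F)
    (hs : s ^ 2 = algebraMap F M c) (x : M) (hx : x ∈ F⟮s⟯) :
    ∃ a b : F, x = algebraMap F M a + algebraMap F M b * s := by
  have hi : IsIntegral F s := ⟨Polynomial.X ^ 2 - Polynomial.C c, Polynomial.monic_X_pow_sub_C c two_ne_zero,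
    by simp [hs]⟩
  have h1 : x ∈ Algebra.adjoin F {s} := by
    rw [← IntermediateField.adjoin_simple_toSubalgebra_of_isAlgebraic hi.isAlgebraic]
    exact hx
  induction h1 using Algebra.adjoin_induction with
  | mem y hy =>
    rw [Set.mem_singleton_iff] at hy
    exact ⟨0, 1, by simp [hy]⟩
  | algebraMap r => exact ⟨r, 0, by simp⟩
  | add y z hy hz iy iz =>
    have t1 : ∀ w ∈ Algebra.adjoin F {s}, w ∈ F⟮s⟯ := by
      rw [← IntermediateField.adjoin_simple_toSubalgebra_of_isAlgebraic hi.isAlgebraic]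
      exact fun w hw => hw
    obtain ⟨a, b, e⟩ := iy (t1 _ hy)
    obtain ⟨a', b', e'⟩ := iz (t1 _ hz)
    exact ⟨a + a', b + b', by rw [e, e']; simp only [map_add]; ring⟩
  | mul y z hy hz iy iz =>
    have t1 : ∀ w ∈ Algebra.adjoin F {s}, w ∈ F⟮s⟯ := by
      rw [← IntermediateField.adjoin_simple_toSubalgebra_of_isAlgebraic hi.isAlgebraic]
      exact fun w hw => hw
    obtain ⟨a, b, e⟩ := iy (t1 _ hy)
    obtain ⟨a', b', e'⟩ := iz (t1 _ hz)
    refine ⟨a * a' + b * b' * c, a * b' + a' * b, ?_⟩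
    rw [e, e']; simp only [map_add, map_mul, ← hs]; ring

lemma quad_sq {F M : Type*} [Field F] [Field M] [Algebra F M] [CharZero F] (s : M) (c : F)
    (hs : s ^ 2 = algebraMap F M c) (x : M) (hx : x ∈ F⟮s⟯) (e : F) (hx2 : x ^ 2 = algebraMap F M e) :
    (∃ a : F, x = algebraMap F M a) ∨ ∃ b : F, x * s = algebraMap F M b := by
  have hch : (2 : F) ≠ 0 := two_ne_zero
  obtain ⟨a, b, rfl⟩ := quad_rep s c hs x hx
  by_cases ha : a = 0
  · right; refine ⟨b * c, ?_⟩
    rw [ha, map_zero, map_mul, ← hs]; ring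
  by_cases hb : b = 0
  · left; exact ⟨a, by rw [hb]; simp⟩
  left
  have h2 : algebraMap F M (2 * a * b) * s = algebraMap F M (e - a ^ 2 - b ^ 2 * c) := by
    simp only [map_mul, map_sub, map_pow, ← hs, ← hx2, map_ofNat]; ring
  have h3 : s = algebraMap F M ((e - a ^ 2 - b ^ 2 * c) / (2 * a * b)) := by
    rw [map_div₀, ← h2, mul_div_cancel_left₀]
    rw [map_ne_zero]
    exact mul_ne_zero (mul_ne_zero hch ha) hb
  exact ⟨a + b * ((e - a ^ 2 - b ^ 2 * c) / (2 * a * b)), by rw [map_add, map_mul, ← h3]⟩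

lemma finrank_sq {F M : Type*} [Field F] [Field M] [Algebra F M] (s : M) (c : F)
    (hs : s ^ 2 = algebraMap F M c) (hn : ∀ a : F, s ≠ algebraMap F M a) :
    Module.finrank F F⟮s⟯ = 2 := by
  have hm : (Polynomial.X ^ 2 - Polynomial.C c).Monic := Polynomial.monic_X_pow_sub_C c two_ne_zero
  have hi : IsIntegral F s := ⟨Polynomial.X ^ 2 - Polynomial.C c, hm, by simp [hs]⟩
  rw [adjoin.finrank hi]
  apply le_antisymm
  · have := Polynomial.natDegree_le_natDegree (minpoly.min F s hm (by simp [hs]))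
    simpa [Polynomial.natDegree_X_pow_sub_C] using this
  · rw [minpoly.two_le_natDegree_iff hi]
    rintro ⟨a, ha⟩
    exact hn a ha.symm

lemma gal_gen {F K : Type*} [Field F] [Field K] [Algebra F K] [CharZero F] {n : ℕ} (s : Fin n → K)
    (d : Fin n → F) (h : ∀ i, s i ^ 2 = algebraMap F K (d i)) (hg : adjoin F (Set.range s) = ⊤) :
    IsGalois F K := by
  have h1 : ∀ i, Normal F F⟮s i⟯ := by
    intro i
    by_cases hr : ∃ a : F, s i = algebraMap F K a
    · obtain ⟨a, ha⟩ := hr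
      have : F⟮s i⟯ = ⊥ := by
        rw [adjoin_simple_eq_bot_iff, ha]; exact IntermediateField.algebraMap_mem _ _
      rw [this]
      exact Normal.of_algEquiv (botEquiv F K).symm
    · push Not at hr
      have h2 := finrank_sq (s i) (d i) (h i) hr
      have : Algebra.IsQuadraticExtension F F⟮s i⟯ := { toFree := inferInstance, finrank_eq_two' := h2 }
      infer_instance
  have h3 : (⨆ i, F⟮s i⟯) = ⊤ := by
    rw [eq_top_iff, ← hg, adjoin_le_iff]
    rintro _ ⟨i, rfl⟩
    exact (le_iSup (fun i => F⟮s i⟯) i) (mem_adjoin_simple_self F (s i))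
  have h4 : Normal F (⨆ i, F⟮s i⟯ : IntermediateField F K) := inferInstance
  rw [h3] at h4
  have h5 : Normal F K := Normal.of_algEquiv (topEquiv (F := F) (E := K))
  exact { }

end fld

section sf
open IntermediateField
variable {K : Type*} [Field K] [NumberField K] {n : ℕ} {s : Fin n → K} {d : Fin n → ℤ}

/-- multiquadratic field -/
structure SF (n : ℕ) (K : Type*) [Field K] [NumberField K] (s : Fin n → K) (d : Fin n → ℤ) : Prop where
  sq : ∀ i, s i ^ 2 = (d i : K)
  nz : ∀ i, d i ≠ 0
  fr : Module.finrank ℚ K = 2 ^ n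
  gen : adjoin ℚ (Set.range s) = ⊤

lemma SF.s0 (h : SF n K s d) (i : Fin n) : s i ≠ 0 := by
  intro h0
  have := h.sq i
  rw [h0] at this
  have h2 : (d i : K) = 0 := by rw [← this]; ring
  exact h.nz i (by exact_mod_cast h2)

lemma SF.gal (h : SF n K s d) : IsGalois ℚ K :=
  gal_gen s (fun i => (d i : ℚ)) (fun i => by rw [h.sq]; simp) h.gen

lemma SF.ext (h : SF n K s d) {g g' : K ≃ₐ[ℚ] K} (e : ∀ i, g (s i) = g' (s i)) : g = g' := by
  have : (g : K →ₐ[ℚ] K) = g' := by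
    have h1 : ∀ x ∈ (⊤ : IntermediateField ℚ K), g x = g' x := by
      rw [← h.gen]
      intro x hx
      induction hx using adjoin_induction with
      | mem y hy => obtain ⟨i, rfl⟩ := hy; exact e i
      | algebraMap r => simp
      | add y z _ _ iy iz => simp [iy, iz]
      | mul y z _ _ iy iz => simp [iy, iz]
      | inv y _ iy => simp [iy]
    ext x; exact h1 x mem_top
  ext x; exact DFunLike.congr_fun this x

lemma SF.pm (h : SF n K s d) (g : K ≃ₐ[ℚ] K) (i : Fin n) : g (s i) = s i ∨ g (s i) = - s i := by
  apply sq_eq_sq_iff_eq_or_eq_neg.mp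
  rw [← map_pow, h.sq, map_intCast]

open Classical in
/-- sign map -/
noncomputable def sg (s : Fin n → K) (g : K ≃ₐ[ℚ] K) (i : Fin n) : ℤˣ := if g (s i) = s i then 1 else -1

lemma SF.sg_spec (h : SF n K s d) (g : K ≃ₐ[ℚ] K) (i : Fin n) : g (s i) = ((sg s g i : ℤˣ) : ℤ) * s i := by
  unfold sg
  split_ifs with h1
  · simp [h1]
  · simp [(h.pm g i).resolve_left h1]

lemma SF.sg_uniq (h : SF n K s d) {i : Fin n} {a b : ℤˣ} (e : ((a : ℤ) : K) * s i = ((b : ℤ) : K) * s i) : a = b := by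
  have := mul_right_cancel₀ (h.s0 i) e
  exact Units.ext (by exact_mod_cast this)

/-- the sign isomorphism -/
lemma SF.iso (h : SF n K s d) : ∃ e : (K ≃ₐ[ℚ] K) ≃* (Fin n → ℤˣ), ∀ g i, g (s i) = ((e g i : ℤˣ) : ℤ) * s i := by
  have := h.gal
  let f : (K ≃ₐ[ℚ] K) →* (Fin n → ℤˣ) :=
    { toFun := sg s
      map_one' := by
        ext1 i; apply h.sg_uniq (i := i); rw [← h.sg_spec]; simp
      map_mul' := by
        intro g g'
        ext1 i; apply h.sg_uniq (i := i); rw [← h.sg_spec, AlgEquiv.mul_apply, h.sg_spec g', map_mul,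
          map_intCast, h.sg_spec g, Pi.mul_apply]
        push_cast; ring }
  have hf : Function.Injective f := by
    intro g g' e
    apply h.ext
    intro i
    rw [h.sg_spec, h.sg_spec]
    have : sg s g i = sg s g' i := congrFun e i
    rw [this]
  have hb : Function.Bijective f := by
    rw [Fintype.bijective_iff_injective_and_card]
    refine ⟨hf, ?_⟩
    rw [← Nat.card_eq_fintype_card, IsGalois.card_aut_eq_finrank, h.fr]
    simp
  exact ⟨MulEquiv.ofBijective f hb, fun g i => h.sg_spec g i⟩

end sf
end TQ

namespace TQ
section dec
open IntermediateField
variable {K : Type*} [Field K] [NumberField K] {s : Fin 3 → K} {d : Fin 3 → ℤ}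

/-- bits -/
def bt (i : Fin 7) (j : Fin 3) : Bool := ((i : ℕ) + 1).testBit j

/-- characters -/
def chi (i : Fin 7) (ε : Fin 3 → ℤˣ) : ℤˣ := ∏ j, if bt i j then ε j else 1

/-- generators -/
def ee {M : Type*} [CommMonoid M] (s : Fin 3 → M) (i : Fin 7) : M := ∏ j, if bt i j then s j else 1

/-- quadratic subfields -/
noncomputable def kk (s : Fin 3 → K) (i : Fin 7) : IntermediateField ℚ K := ℚ⟮ee s i⟯

lemma chi_sep : ∀ i l : Fin 7, i ≠ l → ∃ ε : Fin 3 → ℤˣ, chi l ε = -1 ∧ chi i ε = 1 := by decide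

lemma chi_one : ∀ i : Fin 7, chi i 1 = 1 := by decide
lemma chi_mul (i : Fin 7) (a b : Fin 3 → ℤˣ) : chi i (a * b) = chi i a * chi i b := by
  unfold chi; rw [← Finset.prod_mul_distrib]
  apply Finset.prod_congr rfl
  intro j _; split_ifs <;> simp

lemma chi_count : ∀ ε : Fin 3 → ℤˣ, (Finset.univ.filter (fun i => chi i ε = 1)).card =
    3 + if ε = 1 then 4 else 0 := by decide

lemma chi_index : ∀ i : Fin 7, (Finset.univ.filter (fun ε : Fin 3 → ℤˣ => chi i ε = 1)).card = 4 := by decide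

lemma chi_prod {M : Type*} [CommMonoid M] (x : (Fin 3 → ℤˣ) → M) :
    ∏ i, ∏ ε with chi i ε = 1, x ε = x 1 ^ 4 * (∏ ε, x ε) ^ 3 := by
  simp_rw [Finset.prod_filter]
  rw [Finset.prod_comm]
  have : ∀ ε, (∏ i, if chi i ε = 1 then x ε else 1) = x ε ^ 3 * (if ε = 1 then x ε ^ 4 else 1) := by
    intro ε
    rw [← Finset.prod_filter, Finset.prod_const, chi_count, pow_add]
    split_ifs <;> simp
  simp_rw [this]
  rw [Finset.prod_mul_distrib, Finset.prod_ite_eq' Finset.univ (1 : Fin 3 → ℤˣ), if_pos (Finset.mem_univ _),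
    Finset.prod_pow, mul_comm]

lemma SF.e_g (h : SF 3 K s d) (e : (K ≃ₐ[ℚ] K) ≃* (Fin 3 → ℤˣ))
    (he : ∀ g i, g (s i) = ((e g i : ℤˣ) : ℤ) * s i) (g : K ≃ₐ[ℚ] K) (i : Fin 7) :
    g (ee s i) = ((chi i (e g) : ℤˣ) : ℤ) * ee s i := by
  unfold ee chi
  rw [map_prod]
  push_cast
  rw [← Finset.prod_mul_distrib]
  apply Finset.prod_congr rfl
  intro j _
  split_ifs
  · exact he g j
  · simp

lemma SF.e0 (h : SF 3 K s d) (i : Fin 7) : ee s i ≠ 0 := by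
  unfold ee
  rw [Finset.prod_ne_zero_iff]
  intro j _
  split_ifs
  · exact h.s0 j
  · exact one_ne_zero

lemma SF.fix_iff (h : SF 3 K s d) (e : (K ≃ₐ[ℚ] K) ≃* (Fin 3 → ℤˣ))
    (he : ∀ g i, g (s i) = ((e g i : ℤˣ) : ℤ) * s i) (g : K ≃ₐ[ℚ] K) (i : Fin 7) :
    g (ee s i) = ee s i ↔ chi i (e g) = 1 := by
  rw [h.e_g e he]
  constructor
  · intro h1
    have h2 := mul_right_cancel₀ (h.e0 i) (h1.trans (one_mul _).symm)
    have h3 : ((chi i (e g) : ℤˣ) : ℤ) = 1 := by exact_mod_cast h2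
    exact Units.ext h3
  · intro h1; rw [h1]; simp

/-- automorphisms over a subfield -/
lemma prod_fix (F : IntermediateField ℚ K) {M : Type*} [CommMonoid M] (f : (K ≃+* K) → M) (A : Finset (K ≃ₐ[ℚ] K))
    (hA : ∀ g, g ∈ A ↔ ∀ x ∈ F, g x = x) :
    ∏ g : K ≃ₐ[F] K, f g.toRingEquiv = ∏ g ∈ A, f g.toRingEquiv := by
  refine Finset.prod_bij' (fun g _ => g.restrictScalars ℚ)
    (fun g hg => { g.toRingEquiv with commutes' := fun x => (hA g).mp hg x x.2 }) ?_ ?_ ?_ ?_ ?_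
  · intro g _
    rw [hA]; intro x hx
    exact g.commutes ⟨x, hx⟩
  · intro g _; exact Finset.mem_univ _
  · intro g _; ext x; rfl
  · intro g _; ext x; rfl
  · intro g _; rfl

lemma mem_simple {x : K} (g : K ≃ₐ[ℚ] K) : (∀ y ∈ ℚ⟮x⟯, g y = y) ↔ g x = x := by
  constructor
  · intro h; exact h x (mem_adjoin_simple_self ℚ x)
  · intro h y hy
    induction hy using adjoin_induction with
    | mem y hy => rw [Set.mem_singleton_iff.mp hy]; exact h
    | algebraMap r => simp
    | add y z _ _ iy iz => simp [iy, iz]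
    | mul y z _ _ iy iz => simp [iy, iz]
    | inv y _ iy => simp [iy]

lemma cl_prod {L ι : Type*} [Field L] [NumberField L] (S : Finset ι) (I : ι → Ideal (𝓞 L)) (hI : ∀ i, I i ≠ ⊥) :
    cl (∏ i ∈ S, I i) = ∏ i ∈ S, cl (I i) ∧ ∏ i ∈ S, I i ≠ ⊥ := by
  classical
  induction S using Finset.induction_on with
  | empty =>
    simp only [Finset.prod_empty]
    refine ⟨?_, ?_⟩
    · rw [Ideal.one_eq_top, ← Ideal.span_singleton_one]; exact cl_span one_ne_zero
    · exact one_ne_zero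
  | insert a S ha ih =>
    rw [Finset.prod_insert ha, Finset.prod_insert ha, cl_mul (hI a) ih.2, ih.1]
    exact ⟨rfl, mul_ne_zero (hI a) ih.2⟩

lemma cl_rat (N : Ideal (𝓞 ℚ)) : cl N = 1 := by
  have h1 : Fintype.card (ClassGroup (𝓞 ℚ)) = 1 := Rat.classNumber_eq
  have := Fintype.card_le_one_iff_subsingleton.mp h1.le
  exact Subsingleton.elim _ _

lemma cl_exrat {L : Type*} [Field L] [NumberField L] (N : Ideal (𝓞 ℚ)) (hN : N ≠ ⊥) : cl (ex ℚ L N) = 1 := by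
  rw [← jx_cl N hN, cl_rat, map_one]

lemma ex_tower (F : IntermediateField ℚ K) (N : Ideal (𝓞 ℚ)) : ex F K (ex ℚ F N) = ex ℚ K N := by
  unfold ex
  rw [Ideal.map_map]
  congr 1

theorem SF.step1 (h : SF 3 K s d) (a : ClassGroup (𝓞 K)) :
    ∃ c : ∀ i, ClassGroup (𝓞 (kk s i)), a ^ 4 = ∏ i, jx (kk s i) K (c i) := by
  classical
  have hgal := h.gal
  obtain ⟨e, he⟩ := h.iso
  obtain ⟨I, hI, rfl⟩ := cl_surj a
  refine ⟨fun i => cl (nm (kk s i) I), ?_⟩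
  have h1 : ∀ i, ex (kk s i) K (nm (kk s i) I) = ∏ ε with chi i ε = 1, cj (e.symm ε).toRingEquiv I := by
    intro i
    rw [ex_nm, prod_fix (kk s i) (fun g => cj g I) (Finset.univ.filter (fun g => chi i (e g) = 1))]
    · refine Finset.prod_bij' (fun g _ => e g) (fun ε _ => e.symm ε) ?_ ?_ ?_ ?_ ?_ <;> simp
    · intro g
      rw [Finset.mem_filter, ← h.fix_iff e he, kk, mem_simple]
      simp
  have h2 : ∏ i, ex (kk s i) K (nm (kk s i) I) = I ^ 4 * (ex ℚ K (nm ℚ I)) ^ 3 := by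
    simp_rw [h1]
    rw [chi_prod (fun ε => cj (e.symm ε).toRingEquiv I), ex_nm]
    congr 2
    · exact cj_of_id _ (fun x => by simp) I
    · rw [← Equiv.prod_comp e.symm.toEquiv]; rfl
  have h3 := congrArg cl h2
  have hn : nm ℚ I ≠ ⊥ := nm_ne_bot I hI
  rw [(cl_prod _ _ (fun i => ex_ne_bot _ (nm_ne_bot I hI))).1, cl_mul (pow_ne_zero _ hI)
    (pow_ne_zero _ (ex_ne_bot _ hn)), cl_pow hI, cl_pow (ex_ne_bot _ hn), cl_exrat _ hn, one_pow, mul_one] at h3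
  rw [← h3]
  apply Finset.prod_congr rfl
  intro i _
  rw [jx_cl _ (nm_ne_bot I hI)]

lemma SF.fr4 (h : SF 3 K s d) (i : Fin 7) : Module.finrank (kk s i) K = 4 := by
  classical
  have hgal := h.gal
  obtain ⟨e, he⟩ := h.iso
  rw [← IsGalois.card_aut_eq_finrank, Nat.card_eq_fintype_card, ← Finset.card_univ, Finset.card_eq_sum_ones]
  have h1 := prod_fix (kk s i) (fun g => Multiplicative.ofAdd 1) (Finset.univ.filter (fun g => chi i (e g) = 1))
    (by
      intro g
      rw [Finset.mem_filter, ← h.fix_iff e he, kk, mem_simple]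
      simp)
  have h2 : (Finset.univ.filter (fun g => chi i (e g) = 1)).card = 4 := by
    rw [← chi_index i]
    refine Finset.card_bij' (fun g _ => e g) (fun ε _ => e.symm ε) ?_ ?_ ?_ ?_ <;> simp
  simp only [Finset.prod_const, h2] at h1
  simpa using congrArg Multiplicative.toAdd h1

lemma SF.nm_other (h : SF 3 K s d) (i l : Fin 7) (hil : i ≠ l) (J : Ideal (𝓞 (kk s i))) (hJ : J ≠ ⊥) :
    cl (nm (kk s l) (ex (kk s i) K J)) ^ 2 = 1 := by
  classical
  have hgal := h.gal
  obtain ⟨e, he⟩ := h.iso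
  obtain ⟨ε, hε1, hε2⟩ := chi_sep i l hil
  set τ := e.symm ε with hτ
  set X : (Fin 3 → ℤˣ) → Ideal (𝓞 K) := fun η => cj (e.symm η).toRingEquiv (ex (kk s i) K J) with hX
  set M := nm (kk s l) (ex (kk s i) K J) with hM
  have hJK : ex (kk s i) K J ≠ ⊥ := ex_ne_bot _ hJ
  have hM0 : M ≠ ⊥ := nm_ne_bot _ hJK
  have hXe : ∀ η, X (η * ε) = X η := by
    intro η
    have h1 : cj τ.toRingEquiv (ex (kk s i) K J) = ex (kk s i) K J := by
      have hfix : ∀ x ∈ kk s i, τ x = x := by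
        rw [kk, mem_simple, h.fix_iff e he, hτ]; simpa using hε2
      let τ' : K ≃ₐ[kk s i] K := { τ.toRingEquiv with commutes' := fun x => hfix x x.2 }
      exact cj_ex τ' J
    simp only [hX]
    conv_rhs => rw [← h1, cj_cj]
    congr 1
    rw [map_mul, hτ]; rfl
  have h1 : ex (kk s l) K M = ∏ η with chi l η = 1, X η := by
    rw [hM, ex_nm, prod_fix (kk s l) (fun g => cj g _) (Finset.univ.filter (fun g => chi l (e g) = 1))]
    · refine Finset.prod_bij' (fun g _ => e g) (fun ε _ => e.symm ε) ?_ ?_ ?_ ?_ ?_ <;> simp [hX]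
    · intro g
      rw [Finset.mem_filter, ← h.fix_iff e he, kk, mem_simple]
      simp
  have h2 : ∏ η with ¬ chi l η = 1, X η = ∏ η with chi l η = 1, X η := by
    have hεε : ε * ε = 1 := by ext1 j; exact Int.units_mul_self _
    refine Finset.prod_bij' (fun η _ => η * ε) (fun η _ => η * ε) ?_ ?_ ?_ ?_ ?_
    · intro η hη
      simp only [Finset.mem_filter, Finset.mem_univ, true_and] at hη ⊢
      rw [chi_mul, hε1, (Int.units_eq_one_or _).resolve_left hη]; rfl
    · intro η hη
      simp only [Finset.mem_filter, Finset.mem_univ, true_and] at hη ⊢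
      rw [chi_mul, hε1, hη]; decide
    · intro η _; rw [mul_assoc, hεε, mul_one]
    · intro η _; rw [mul_assoc, hεε, mul_one]
    · intro η _; exact (hXe η).symm
  have h3 : ex (kk s l) K (M ^ 2) = ex (kk s l) K (ex ℚ (kk s l) (nm ℚ (ex (kk s i) K J))) := by
    rw [ex_tower, ex_nm, ex_pow, pow_two]
    nth_rw 2 [h1]
    rw [← h2, h1, Finset.prod_filter_mul_prod_filter_not, ← Equiv.prod_comp e.symm.toEquiv]; rfl
  rw [← cl_pow hM0, ex_inj h3, cl_exrat _ (nm_ne_bot _ hJK)]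

theorem SF.step2 (h : SF 3 K s d) (c : ∀ i, ClassGroup (𝓞 (kk s i)))
    (hc : ∏ i, jx (kk s i) K (c i) = 1) (l : Fin 7) : c l ^ 8 = 1 := by
  classical
  choose J hJ0 hJ using fun i => cl_surj (c i)
  have h1 : ∀ i, jx (kk s i) K (c i) = cl (ex (kk s i) K (J i)) := by
    intro i; rw [← hJ i, jx_cl _ (hJ0 i)]
  simp_rw [h1] at hc
  rw [← (cl_prod _ _ (fun i => ex_ne_bot _ (hJ0 i))).1, cl_eq_one (cl_prod _ _ (fun i => ex_ne_bot _ (hJ0 i))).2] at hc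
  obtain ⟨x, hx0, hx⟩ := hc
  have h2 := congrArg (fun I => cl (nm (kk s l) I)) hx
  have h3 : cl (nm (kk s l) (Ideal.span {x})) = 1 := by
    unfold nm
    rw [Ideal.relNorm_singleton]
    apply cl_span
    rwa [Ne, Algebra.intNorm_eq_zero]
  have h4 : nm (kk s l) (∏ i, ex (kk s i) K (J i)) = ∏ i, nm (kk s l) (ex (kk s i) K (J i)) := by
    unfold nm; rw [map_prod]
  simp only [h3, h4] at h2
  rw [(cl_prod _ _ (fun i => nm_ne_bot _ (ex_ne_bot _ (hJ0 i)))).1] at h2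
  have h5 := congrArg (fun y => y ^ 2) h2
  simp only [one_pow] at h5
  rw [← Finset.prod_pow, Finset.prod_eq_single l, nm_ex, h.fr4, cl_pow (hJ0 l), hJ, ← pow_mul] at h5
  · exact h5
  · intro i _ hi; exact h.nm_other i l hi _ (hJ0 i)
  · simp
end dec
end TQ

namespace TQ

lemma z3pow {A : Type*} [Group A] {g x : A} (hg : g ^ 3 = 1) (hx : x ∈ Subgroup.zpowers g) : ∃ m : ℕ, x = g ^ m := by
  obtain ⟨z, rfl⟩ := hx
  refine ⟨(z % 3).toNat, ?_⟩
  have h1 : 0 ≤ z % 3 := Int.emod_nonneg _ (by norm_num)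
  show g ^ z = _
  rw [← zpow_natCast, Int.toNat_of_nonneg h1]
  conv_lhs => rw [← Int.emod_add_mul_ediv z 3]
  rw [zpow_add, zpow_mul]
  have : g ^ (3:ℤ) = 1 := by exact_mod_cast hg
  rw [this]; simp

theorem grp_iso {A : Type*} [CommGroup A] (hA : Odd (Nat.card A)) {n r : ℕ} {C : Fin n → Type*} [∀ i, CommGroup (C i)]
    (j : ∀ i, C i →* A) (g : ∀ i, C i) (hg3 : ∀ i, g i ^ 3 = 1) (hg : ∀ i (c : C i), c ^ 2 ∈ Subgroup.zpowers (g i))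
    (s1 : ∀ a : A, ∃ c : ∀ i, C i, a ^ 4 = ∏ i, j i (c i))
    (s2 : ∀ c : ∀ i, C i, ∏ i, j i (c i) = 1 → ∀ l, c l ^ 8 = 1)
    (e : Fin r → Fin n) (he : Function.Injective e) (hne : ∀ k, g (e k) ≠ 1)
    (h1 : ∀ i, (∀ k, e k ≠ i) → g i = 1) :
    Nonempty (A ≃* (Fin r → Multiplicative (ZMod 3))) := by
  classical
  have hfin : Finite A := Nat.finite_of_card_ne_zero (by rintro h; rw [h] at hA; revert hA; decide)
  have key : ∀ a : A, ∃ m : Fin n → ℕ, a ^ 16 = ∏ i, j i (g i) ^ (2 * m i) := by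
    intro a
    obtain ⟨c, hc⟩ := s1 a
    choose m hm using fun i => z3pow (hg3 i) (hg i (c i))
    refine ⟨m, ?_⟩
    calc a ^ 16 = (a ^ 4) ^ 4 := by rw [← pow_mul]
      _ = ∏ i, (j i (c i)) ^ 4 := by rw [hc, Finset.prod_pow]
      _ = _ := by
        refine Finset.prod_congr rfl fun i _ => ?_
        rw [← map_pow, ← map_pow]
        congr 1
        rw [show 4 = 2 * 2 from rfl, pow_mul, hm i, ← pow_mul, mul_comm]
  have a3 : ∀ a : A, a ^ 3 = 1 := by
    intro a
    obtain ⟨m, hm⟩ := key a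
    have h48 : (a ^ 3) ^ 16 = 1 := by
      rw [← pow_mul, mul_comm, pow_mul, hm, ← Finset.prod_pow]
      refine Finset.prod_eq_one fun i _ => ?_
      rw [← pow_mul, mul_comm, pow_mul, ← map_pow, hg3, map_one, one_pow]
    have hcard : (a ^ 3) ^ Nat.card A = 1 := pow_card_eq_one'
    have hc : Nat.Coprime 16 (Nat.card A) := by
      rw [show 16 = 2 ^ 4 from rfl]
      exact Nat.Coprime.pow_left 4 (Nat.coprime_two_left.mpr hA)
    have := pow_gcd_eq_one.mpr ⟨h48, hcard⟩
    rwa [hc, pow_one] at this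
  let v : Fin r → A := fun k => j (e k) (g (e k))
  let Φ : (Fin r → Multiplicative (ZMod 3)) →* A :=
    { toFun := fun x => ∏ k, v k ^ (x k).toAdd.val
      map_one' := by simp
      map_mul' := by
        intro x y
        rw [← Finset.prod_mul_distrib]
        refine Finset.prod_congr rfl fun k _ => ?_
        rw [Pi.mul_apply, toAdd_mul, ZMod.val_add, ← pow_eq_pow_mod _ (a3 (v k)), pow_add] }
  have hinj : Function.Injective Φ := by
    rw [injective_iff_map_eq_one]
    intro x hx
    have hx' : ∏ k, v k ^ (x k).toAdd.val = 1 := hx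
    let N : Fin n → ℕ := fun i => ∑ k, if e k = i then (x k).toAdd.val else 0
    have hp : ∏ i, j i (g i ^ N i) = 1 := by
      rw [← hx']
      simp only [map_pow, N]
      simp only [← Finset.prod_pow_eq_pow_sum]
      rw [Finset.prod_comm]
      refine Finset.prod_congr rfl fun k _ => ?_
      rw [Finset.prod_eq_single (e k)]
      · simp [v]
      · intro i _ hi; rw [if_neg (Ne.symm hi), pow_zero]
      · simp
    funext l
    have h8 := s2 _ hp (e l)
    have hN : N (e l) = (x l).toAdd.val := by
      simp only [N]
      rw [Finset.sum_eq_single l]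
      · simp
      · intro k _ hk; rw [if_neg (fun h => hk (he h))]
      · simp
    rw [hN] at h8
    have hlt := ZMod.val_lt (x l).toAdd
    have hv0 : (x l).toAdd.val = 0 := by
      by_contra h0
      have h3 := hg3 (e l)
      generalize hw : (x l).toAdd.val = w at h8 hlt h0
      apply hne l
      generalize g (e l) = y at h3 h8
      have : w = 1 ∨ w = 2 := by omega
      rcases this with rfl | rfl
      · calc y = (y ^ 3) ^ 3 * ((y^1) ^ 8)⁻¹ := by group
          _ = 1 := by rw [h3, h8]; simp
      · calc y = (y^2) ^ 8 * ((y ^ 3) ^ 5)⁻¹ := by group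
          _ = 1 := by rw [h3, h8]; simp
    have := (ZMod.val_eq_zero _).mp hv0
    show x l = 1
    rw [← ofAdd_toAdd (x l), this]; rfl
  have hsur : Function.Surjective Φ := by
    intro a
    obtain ⟨m, hm⟩ := key a
    refine ⟨fun k => Multiplicative.ofAdd ((2 * m (e k) : ℕ) : ZMod 3), ?_⟩
    show ∏ k, v k ^ _ = a
    have ha : a = a ^ 16 := by
      rw [show 16 = 3 * 5 + 1 from rfl, pow_succ, pow_mul, a3]; simp
    rw [ha, hm]
    have : ∀ k, v k ^ (Multiplicative.ofAdd ((2 * m (e k) : ℕ) : ZMod 3)).toAdd.val = v k ^ (2 * m (e k)) := by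
      intro k
      rw [toAdd_ofAdd, ZMod.val_natCast, ← pow_eq_pow_mod _ (a3 (v k))]
    simp only [this]
    rw [← Finset.prod_image (s := Finset.univ) (g := e) (f := fun i => j i (g i) ^ (2 * m i)) (fun _ _ _ _ h => he h)]
    refine Finset.prod_subset (Finset.subset_univ _) fun i _ hi => ?_
    rw [h1 i (fun k hk => hi (Finset.mem_image.mpr ⟨k, Finset.mem_univ _, hk⟩)), map_one, one_pow]
  exact ⟨(MulEquiv.ofBijective Φ ⟨hinj, hsur⟩).symm⟩

/-- Certificate data for one quadratic subfield -/
structure QC where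
  D : ℤ
  R : ℤ
  a : ℤ
  r : ℤ
  T : ℤ
  U : ℤ

def QC.ok (q : QC) : Bool := fund q.D && chk q.D q.R q.a q.r true 64 && (q.a == 1 || npr q.D q.a q.T q.U)

/-- products -/
def pd (d : Fin 3 → ℤ) (i : Fin 7) : ℤ := ∏ j, if bt i j then d j else 1

section
open IntermediateField
variable {K : Type*} [Field K] [NumberField K] {s : Fin 3 → K} {d : Fin 3 → ℤ}

lemma QS.of_gen (x : K) (D m : ℤ) (hm : m ≠ 0) (hD : fund D = true)
    (hs : x ^ 2 = ((m ^ 2 * D : ℤ) : K)) :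
    QS ℚ⟮x⟯ ((⟨x, IntermediateField.mem_adjoin_simple_self ℚ _⟩ : ℚ⟮x⟯) / (m : ℤ)) D := by
  have hfr : Module.finrank ℚ ℚ⟮x⟯ = 2 := by
    refine finrank_sq x ((m ^ 2 * D : ℤ) : ℚ) (by rw [hs]; simp) ?_
    intro a ha
    rw [ha] at hs
    have h2 : a ^ 2 = ((m ^ 2 * D : ℤ) : ℚ) := by
      apply (algebraMap ℚ K).injective; rw [map_pow, hs]; simp
    have hmq : (m : ℚ) ≠ 0 := by exact_mod_cast hm
    apply fund_nonsq hD (a / m)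
    rw [div_pow, h2]; push_cast; field_simp
  have hmk : ((m : ℤ) : ℚ⟮x⟯) ≠ 0 := by exact_mod_cast hm
  refine ⟨?_, ?_, hD⟩
  · convert hfr
  · have : (⟨x, IntermediateField.mem_adjoin_simple_self ℚ _⟩ : ℚ⟮x⟯) ^ 2 = ((m ^ 2 * D : ℤ) : ℚ⟮x⟯) :=
      Subtype.ext (by show x ^ 2 = _; rw [hs]; simp)
    rw [div_pow, this]; push_cast; field_simp

lemma SF.ee_sq (h : SF 3 K s d) (i : Fin 7) : ee s i ^ 2 = ((pd d i : ℤ) : K) := by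
  unfold ee pd
  rw [← Finset.prod_pow]
  push_cast
  refine Finset.prod_congr rfl fun j _ => ?_
  split_ifs
  · exact h.sq j
  · simp

theorem SF.final (h : SF 3 K s d) (hodd : Odd (Nat.card (ClassGroup (𝓞 K)))) (q : Fin 7 → QC) (m : Fin 7 → ℤ)
    (hq : ∀ i, (q i).ok = true) (hm : ∀ i, m i ≠ 0 ∧ pd d i = m i ^ 2 * (q i).D) {r : ℕ} (e : Fin r → Fin 7)
    (he : Function.Injective e) (hne : ∀ k, (q (e k)).a ≠ 1) (h1 : ∀ i, (∀ k, e k ≠ i) → (q i).a = 1) :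
    Nonempty (ClassGroup (𝓞 K) ≃* (Fin r → Multiplicative (ZMod 3))) := by
  have hQ : ∀ i, QS (kk s i) ((⟨ee s i, IntermediateField.mem_adjoin_simple_self ℚ _⟩ : kk s i) / (m i : ℤ)) (q i).D := by
    intro i
    have hok := hq i
    simp only [QC.ok, Bool.and_eq_true] at hok
    refine QS.of_gen _ _ _ (hm i).1 hok.1.1 ?_
    · rw [← (hm i).2]
      unfold ee pd
      rw [← Finset.prod_pow]
      push_cast
      refine Finset.prod_congr rfl fun j _ => ?_
      split_ifs
      · exact h.sq j
      · simp
  have hc : ∀ i, ∃ g : ClassGroup (𝓞 (kk s i)), g ^ 3 = 1 ∧ ((q i).a = 1 → g = 1) ∧ ((q i).a ≠ 1 → g ≠ 1) ∧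
      ∀ C : ClassGroup (𝓞 (kk s i)), C ^ 2 ∈ Subgroup.zpowers g := by
    intro i
    have hok := hq i
    simp only [QC.ok, Bool.and_eq_true, Bool.or_eq_true, beq_iff_eq] at hok
    exact (hQ i).cls hok.1.2 hok.2
  choose g hg3 hga hgb hgc using hc
  exact grp_iso hodd (fun i => jx (kk s i) K) g hg3 hgc h.step1 h.step2 e he (fun k => hgb _ (hne k)) (fun i hi => hga i (h1 i hi))
end
end TQ

namespace TQ

lemma tc_of_neg {K : Type*} [Field K] [NumberField K] (s : K) (d : ℤ) (hd : d < 0) (hs : s ^ 2 = (d : K)) :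
    IsTotallyComplex K := by
  refine ⟨fun v => ?_⟩
  rw [← InfinitePlace.not_isReal_iff_isComplex]
  intro hv
  have h1 := InfinitePlace.embedding_of_isReal hv
  let φ := InfinitePlace.embedding_of_isReal hv
  have h2 : (φ s) ^ 2 = (d : ℝ) := by rw [← map_pow, hs, map_intCast]
  have h3 : (d : ℝ) < 0 := by exact_mod_cast hd
  nlinarith [sq_nonneg (φ s)]

lemma trans_prime {F L : Type*} [Field F] [NumberField F] [Field L] [NumberField L] [Algebra F L] [IsGalois F L]
    (P Q : Ideal (𝓞 L)) (hP : P.IsPrime) (hQ : Q.IsPrime)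
    (hc : P.comap (algebraMap (𝓞 F) (𝓞 L)) = Q.comap (algebraMap (𝓞 F) (𝓞 L))) :
    ∃ g : L ≃ₐ[F] L, Q = cj g.toRingEquiv P := by
  obtain ⟨σ, hσ⟩ := Ideal.exists_comap_galRestrict_eq (R := 𝓞 F) (S := 𝓞 L) F L (P₁ := P) (P₂ := Q)
    (p := P.comap (algebraMap (𝓞 F) (𝓞 L))) ⟨hP, ⟨rfl⟩⟩ ⟨hQ, ⟨hc⟩⟩
  have key : ∀ x : 𝓞 L, galRestrict (𝓞 F) F L (𝓞 L) σ x = ra σ.toRingEquiv x := by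
    intro x
    apply NumberField.RingOfIntegers.ext
    rw [ra_coe]
    exact algebraMap_galRestrict_apply (𝓞 F) σ x
  refine ⟨σ.symm, ?_⟩
  rw [← hσ]
  ext x
  rw [mem_cj, Ideal.mem_comap]
  have h2 : ∀ x : 𝓞 L, ra (σ.symm).toRingEquiv (ra σ.toRingEquiv x) = x := by
    intro x; apply NumberField.RingOfIntegers.ext; rw [ra_coe, ra_coe]; exact σ.symm_apply_apply _
  constructor
  · intro h; exact ⟨_, h, by rw [show (galRestrict (𝓞 F) F L (𝓞 L) σ : 𝓞 L ≃ₐ[𝓞 F] 𝓞 L) x = ra σ.toRingEquiv x from key x]; exact h2 x⟩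
  · rintro ⟨y, hy, rfl⟩
    have : galRestrict (𝓞 F) F L (𝓞 L) σ (ra (σ.symm).toRingEquiv y) = y := by
      rw [key]; apply NumberField.RingOfIntegers.ext; rw [ra_coe, ra_coe]; exact σ.apply_symm_apply _
    show galRestrict (𝓞 F) F L (𝓞 L) σ (ra (σ.symm).toRingEquiv y) ∈ P
    rw [this]; exact hy

/-- uniqueness of the prime over `p` -/
def Uq (k : Type*) [Field k] (p : ℕ) : Prop :=
  ∀ P Q : Ideal (𝓞 k), P.IsPrime → Q.IsPrime → (p : 𝓞 k) ∈ P → (p : 𝓞 k) ∈ Q → P = Q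

/-- no roots mod p -/
def inert (D : ℤ) (p : ℕ) : Bool := (List.range p).all fun r => !(ff (tt D) (nn D) r % p == 0)

lemma QS.uq {k : Type*} [Field k] [NumberField k] {s : k} {D : ℤ} (h : QS k s D) (p : ℕ) (hp : p.Prime)
    (hi : inert D p = true) : Uq k p := by
  obtain ⟨ω, c, hq, -⟩ := h.qo
  have key : ∀ P : Ideal (𝓞 k), P.IsPrime → (p : 𝓞 k) ∈ P → P = Ideal.span {(p : 𝓞 k)} := by
    intro P hP hm
    rcases hq.primes P hP p hp hm with h1 | ⟨r, hr, hd, -⟩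
    · exact h1
    · exfalso
      unfold inert at hi
      rw [List.all_eq_true] at hi
      have := hi r (List.mem_range.mpr hr)
      rw [Int.emod_eq_zero_of_dvd hd] at this
      simp at this
  intro P Q hP hQ h1 h2
  rw [key P hP h1, key Q hQ h2]

lemma QS.uq4 {k : Type*} [Field k] [NumberField k] {s : k} (h : QS k s (-4)) : Uq k 2 := by
  obtain ⟨ω, c, hq, -⟩ := h.qo
  have ht : tt (-4) = 0 := by decide
  have hn : nn (-4) = 1 := by decide
  rw [ht, hn] at hq
  have key : ∀ P : Ideal (𝓞 k), P.IsPrime → ((2:ℕ) : 𝓞 k) ∈ P → P = J ω 2 1 := by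
    intro P hP hm
    rcases hq.primes P hP 2 Nat.prime_two hm with h1 | ⟨r, hr, hd, h1⟩
    · have h2 : ((ω - 1) ^ 2 : 𝓞 k) ∈ P := by
        have : ((ω - 1) ^ 2 : 𝓞 k) = ((2:ℕ) : 𝓞 k) * (-ω) := by
          have := hq.rel; push_cast at this ⊢; linear_combination this
        rw [this]; exact P.mul_mem_right _ hm
      have h3 := hP.mem_of_pow_mem _ h2
      apply le_antisymm
      · rw [h1, Ideal.span_le]
        rintro x rfl
        exact_mod_cast J_a ω 2 1
      · exact J_le (by exact_mod_cast hm) (by exact_mod_cast h3)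
    · interval_cases r
      · exfalso; revert hd; unfold ff; decide
      · exact_mod_cast h1
  intro P Q hP hQ h1 h2
  rw [key P hP h1, key Q hQ h2]

lemma exists_over {L : Type*} [Field L] [NumberField L] (p : ℕ) (hp : p.Prime) :
    ∃ P : Ideal (𝓞 L), P.IsPrime ∧ P ≠ ⊥ ∧ (p : 𝓞 L) ∈ P := by
  have h1 : Ideal.span {(p : 𝓞 L)} ≠ ⊤ := by
    rw [Ne, Ideal.span_singleton_eq_top]
    intro hu
    obtain ⟨y, hy⟩ := hu.exists_right_inv
    have h2 : (p : L) * (y : L) = 1 := by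
      have := congrArg (algebraMap (𝓞 L) L) hy
      simpa using this
    have hp0 : (p : L) ≠ 0 := by exact_mod_cast hp.ne_zero
    have h3 : (y : L) = (((1 / p : ℚ)) : L) := by
      push_cast; field_simp; linear_combination h2
    obtain ⟨m, hm⟩ := rat_int_of_isIntegral (k := L) (1 / p : ℚ) (by rw [← h3]; exact y.isIntegral_coe)
    have hpq : (p : ℚ) ≠ 0 := by exact_mod_cast hp.ne_zero
    have h4 : (m * p : ℤ) = 1 := by
      have : (m * p : ℚ) = 1 := by rw [hm]; field_simp
      exact_mod_cast this
    have h5 := Int.isUnit_iff.mp (IsUnit.of_mul_eq_one_right _ h4)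
    have := hp.two_le
    omega
  obtain ⟨P, hP, hle⟩ := Ideal.exists_le_maximal _ h1
  have hm : (p : 𝓞 L) ∈ P := hle (Ideal.mem_span_singleton_self _)
  refine ⟨P, hP.isPrime, ?_, hm⟩
  rintro rfl
  have : (p : 𝓞 L) = 0 := hm
  exact hp.ne_zero (by exact_mod_cast this)

lemma Uq.trans {F L : Type*} [Field F] [NumberField F] [Field L] [NumberField L] [Algebra F L] [IsGalois F L]
    {p : ℕ} (h : Uq F p)
    (P Q : Ideal (𝓞 L)) (hP : P.IsPrime) (hQ : Q.IsPrime) (h1 : (p : 𝓞 L) ∈ P) (h2 : (p : 𝓞 L) ∈ Q) :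
    ∃ g : L ≃ₐ[F] L, Q = cj g.toRingEquiv P := by
  apply trans_prime P Q hP hQ
  apply h _ _ (Ideal.comap_isPrime _ _) (Ideal.comap_isPrime _ _)
  · rw [Ideal.mem_comap, map_natCast]; exact h1
  · rw [Ideal.mem_comap, map_natCast]; exact h2

lemma uq_rat (p : ℕ) (hp : p.Prime) : Uq ℚ p := by
  have key : ∀ P : Ideal (𝓞 ℚ), P.IsPrime → (p : 𝓞 ℚ) ∈ P → P = Ideal.span {(p : 𝓞 ℚ)} := by
    intro P hP hm
    have hpr : Prime (p : 𝓞 ℚ) := by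
      have := (MulEquiv.prime_iff (Rat.ringOfIntegersEquiv.symm : ℤ ≃+* 𝓞 ℚ) (p := (p:ℤ))).mpr (Nat.prime_iff_prime_int.mp hp)
      simpa using this
    have h1 : (Ideal.span {(p : 𝓞 ℚ)}).IsPrime := (Ideal.span_singleton_prime hpr.ne_zero).mpr hpr
    have h2 : (Ideal.span {(p : 𝓞 ℚ)}).IsMaximal := h1.isMaximal (by simpa using hp.ne_zero)
    exact (h2.eq_of_le hP.ne_top ((Ideal.span_singleton_le_iff_mem _).mpr hm)).symm
  intro P Q hP hQ h1 h2
  rw [key P hP h1, key Q hQ h2]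

end TQ

namespace TQ

lemma padic_nonnorm (p : ℕ) [hp : Fact p.Prime] (d N : ℤ) (hd : d = p ∨ d = -p)
    (hN : ∀ r : ZMod p, r ^ 2 ≠ (N : ZMod p)) (R S : ℚ_[p]) (h : R ^ 2 - d * S ^ 2 = N) : False := by
  have hp1 : (1:ℝ) < p := by exact_mod_cast hp.out.one_lt
  have hdn : ‖(d : ℚ_[p])‖ = (p:ℝ)⁻¹ := by
    rcases hd with rfl | rfl
    · push_cast; exact Padic.norm_p
    · push_cast; rw [norm_neg]; exact Padic.norm_p
  have hN1 : ‖(N : ℚ_[p])‖ ≤ 1 := Padic.norm_int_le_one N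
  have hS : ‖S‖ ≤ 1 := by
    by_contra hS
    push Not at hS
    have hS0 : S ≠ 0 := by rintro rfl; simp at hS; linarith
    have h2 : R ^ 2 = N + d * S ^ 2 := by linear_combination h
    obtain ⟨n, hn'⟩ : ∃ n : ℤ, ‖S‖ = (p:ℝ) ^ (-n) := ⟨_, Padic.norm_eq_zpow_neg_valuation hS0⟩
    have hn0 : n < 0 := by
      by_contra h0
      push Not at h0
      rw [hn'] at hS
      have : (p:ℝ) ^ (-n) ≤ 1 := zpow_le_one_of_nonpos₀ hp1.le (by omega)
      linarith
    have h3 : ‖(d : ℚ_[p]) * S ^ 2‖ = (p:ℝ) ^ (-1 - 2 * n) := by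
      rw [norm_mul, norm_pow, hdn, hn', ← zpow_natCast, ← zpow_mul, ← zpow_neg_one, ← zpow_add₀ (by linarith)]
      congr 1; push_cast; ring
    have h4 : (1:ℝ) < (p:ℝ) ^ (-1 - 2 * n) := one_lt_zpow₀ hp1 (by omega)
    have h5 : ‖R ^ 2‖ = (p:ℝ) ^ (-1 - 2 * n) := by
      rw [h2, Padic.add_eq_max_of_ne (by rw [h3]; linarith [hN1]), h3, max_eq_right (by linarith)]
    have hR0 : R ≠ 0 := by rintro rfl; simp at h5; rw [← h5] at h4; linarith
    obtain ⟨m, hm'⟩ : ∃ m : ℤ, ‖R‖ = (p:ℝ) ^ (-m) := ⟨_, Padic.norm_eq_zpow_neg_valuation hR0⟩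
    rw [norm_pow, hm', ← zpow_natCast, ← zpow_mul] at h5
    have := zpow_right_injective₀ (by linarith) (by linarith) h5
    push_cast at this
    omega
  have hdS : ‖(d : ℚ_[p]) * S ^ 2‖ ≤ 1 := by
    rw [norm_mul, norm_pow, hdn]
    have h1 : (p:ℝ)⁻¹ ≤ 1 := inv_le_one_of_one_le₀ hp1.le
    have h2 : ‖S‖ ^ 2 ≤ 1 := pow_le_one₀ (norm_nonneg _) hS
    nlinarith [norm_nonneg S, sq_nonneg ‖S‖]
  have hR : ‖R‖ ≤ 1 := by
    have h2 : R ^ 2 = N + d * S ^ 2 := by linear_combination h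
    have h3 : ‖R ^ 2‖ ≤ 1 := by rw [h2]; exact (Padic.nonarchimedean _ _).trans (max_le hN1 hdS)
    rw [norm_pow] at h3
    nlinarith [norm_nonneg R]
  let R' : ℤ_[p] := ⟨R, hR⟩
  let S' : ℤ_[p] := ⟨S, hS⟩
  have h6 : R' ^ 2 - d * S' ^ 2 = N := by
    apply PadicInt.ext; push_cast; exact h
  have h7 := congrArg (PadicInt.toZMod (p := p)) h6
  rw [map_sub, map_mul, map_pow, map_pow, map_intCast, map_intCast] at h7
  have h8 : ((d : ℤ) : ZMod p) = 0 := by rcases hd with rfl | rfl <;> simp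
  rw [h8, zero_mul, sub_zero] at h7
  exact hN _ h7

lemma padic_sqrt (p : ℕ) [hp : Fact p.Prime] (hp2 : p ≠ 2) (c X : ℤ) (hX : (p:ℤ) ∣ X ^ 2 - c) (hc : ¬ (p:ℤ) ∣ c) :
    ∃ x : ℚ_[p], x ^ 2 = c := by
  have hXp : ¬ (p:ℤ) ∣ 2 * X := by
    intro h
    rcases (Nat.prime_iff_prime_int.mp hp.out).dvd_or_dvd h with h | h
    · have := Int.le_of_dvd (by norm_num) h
      have := hp.out.two_le
      omega
    · exact hc ((dvd_sub_right (dvd_pow h two_ne_zero)).mp hX)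
  let F : Polynomial ℤ_[p] := Polynomial.X ^ 2 - Polynomial.C (c : ℤ_[p])
  have h1 : ‖(Polynomial.aeval ((X : ℤ) : ℤ_[p])) F‖ < ‖(Polynomial.aeval ((X : ℤ) : ℤ_[p])) F.derivative‖ ^ 2 := by
    have e1 : (Polynomial.aeval ((X : ℤ) : ℤ_[p])) F = ((X ^ 2 - c : ℤ) : ℤ_[p]) := by simp [F]
    have e2 : (Polynomial.aeval ((X : ℤ) : ℤ_[p])) F.derivative = ((2 * X : ℤ) : ℤ_[p]) := by simp [F]; left; norm_num
    rw [e1, e2]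
    have n1 : ‖((X ^ 2 - c : ℤ) : ℤ_[p])‖ < 1 := (PadicInt.norm_int_lt_one_iff_dvd _).mpr hX
    have n2 : ‖((2 * X : ℤ) : ℤ_[p])‖ = 1 := by
      apply le_antisymm (PadicInt.norm_le_one _)
      by_contra hh
      push Not at hh
      exact hXp ((PadicInt.norm_int_lt_one_iff_dvd _).mp hh)
    rw [n2]; simpa using n1
  obtain ⟨z, hz, -⟩ := hensels_lemma h1
  refine ⟨(z : ℚ_[p]), ?_⟩
  have : z ^ 2 = (c : ℤ_[p]) := by
    have : z ^ 2 - (c : ℤ_[p]) = 0 := by simpa [F] using hz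
    exact sub_eq_zero.mp this
  have := congrArg (fun y : ℤ_[p] => (y : ℚ_[p])) this
  push_cast at this
  exact this

/-- splitting and nonresidue data -/
structure NN (p : ℕ) (c N : ℤ) : Prop where
  pr : p.Prime
  p2 : p ≠ 2
  X : ∃ X : ℤ, (p:ℤ) ∣ X ^ 2 - c
  nc : ¬ (p:ℤ) ∣ c
  nr : ∀ r : ZMod p, r ^ 2 ≠ (N : ZMod p)
  ns : ∀ a : ℚ, a ^ 2 ≠ c

lemma NN.nonnorm {p : ℕ} {c N : ℤ} (h : NN p c N) {L : Type*} [Field L] [CharZero L] (x s z z' : L) (d : ℤ) (hd : d = p ∨ d = -p)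
    (hx : x ^ 2 = (c : L)) (hs : s ^ 2 = (d : L)) (a b a' b' : ℚ) (h1 : (z + z') / 2 = a + b * x)
    (h2 : (z - z') / (2 * s) = a' + b' * x) (hz : z * z' = N) : False := by
  have : Fact p.Prime := ⟨h.pr⟩
  have hd0 : (d : L) ≠ 0 := by
    have := h.pr.ne_zero
    have : d ≠ 0 := by rcases hd with rfl | rfl <;> simpa
    exact_mod_cast this
  have hs0 : s ≠ 0 := by rintro rfl; apply hd0; rw [← hs]; ring
  have e1 : z + z' = 2 * (a + b * x) := by rw [← h1]; ring
  have e2 : z - z' = 2 * s * (a' + b' * x) := by rw [← h2]; field_simp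
  have e3 : (a + b * x) ^ 2 - d * (a' + b' * x) ^ 2 = (N : L) := by
    rw [← hz]
    have q1 : z = (a + b * x) + s * (a' + b' * x) := by linear_combination (e1 + e2) / 2
    have q2 : z' = (a + b * x) - s * (a' + b' * x) := by linear_combination (e1 - e2) / 2
    rw [q1, q2, ← hs]; ring
  let A : ℚ := a ^ 2 + b ^ 2 * c - d * (a' ^ 2 + b' ^ 2 * c) - N
  let B : ℚ := 2 * a * b - 2 * d * a' * b'
  have e4 : (A : L) + (B : L) * x = 0 := by
    simp only [A, B]; push_cast
    linear_combination e3 - (b ^ 2 - d * b' ^ 2 : L) * hx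
  have hB : B = 0 := by
    by_contra hB
    have hBL : (B : L) ≠ 0 := by exact_mod_cast hB
    apply h.ns (-A / B)
    have : x = ((-A / B : ℚ) : L) := by push_cast; field_simp; linear_combination e4
    rw [this] at hx
    exact_mod_cast hx
  have hA : A = 0 := by
    rw [hB] at e4
    have : (A : L) = 0 := by simpa using e4
    exact_mod_cast this
  obtain ⟨X, hX⟩ := h.X
  obtain ⟨y, hy⟩ := padic_sqrt p h.p2 c X hX h.nc
  refine padic_nonnorm p d N hd h.nr ((a:ℚ_[p]) + b * y) ((a':ℚ_[p]) + b' * y) ?_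
  have hA' : (A : ℚ_[p]) = 0 := by rw [hA]; simp
  have hB' : (B : ℚ_[p]) = 0 := by rw [hB]; simp
  simp only [A, B] at hA' hB'
  push_cast at hA' hB'
  linear_combination hA' + y * hB' + (b ^ 2 - d * b' ^ 2 : ℚ_[p]) * hy

end TQ

namespace TQ
section
open IntermediateField
variable {K : Type*} [Field K] [NumberField K] {n : ℕ} {s : Fin (n+1) → K} {d : Fin (n+1) → ℤ}

/-- the subfield generated by all but the last generator -/
def base (s : Fin (n+1) → K) : IntermediateField ℚ K := adjoin ℚ (Set.range fun i : Fin n => s i.castSucc)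

lemma mem_base (s : Fin (n+1) → K) (i : Fin n) : s i.castSucc ∈ base s := subset_adjoin _ _ ⟨i, rfl⟩

lemma fix_base (g : K ≃ₐ[ℚ] K) : (∀ y ∈ base s, g y = y) ↔ ∀ i : Fin n, g (s i.castSucc) = s i.castSucc := by
  constructor
  · intro h i; exact h _ (mem_base s i)
  · intro h y hy
    unfold base at hy
    induction hy using adjoin_induction with
    | mem y hy => obtain ⟨i, rfl⟩ := hy; exact h i
    | algebraMap r => simp
    | add y z _ _ iy iz => simp [iy, iz]
    | mul y z _ _ iy iz => simp [iy, iz]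
    | inv y _ iy => simp [iy]

lemma one_mul_iff (h : SF (n+1) K s d) (i : Fin (n+1)) (a : ℤˣ) : ((a : ℤ) : K) * s i = s i ↔ a = 1 := by
  constructor
  · intro h1; exact h.sg_uniq (i := i) (by rw [h1]; simp)
  · rintro rfl; simp

lemma SF.base_fr (h : SF (n+1) K s d) : Module.finrank (base s) K = 2 := by
  have := h.gal
  obtain ⟨e, he⟩ := h.iso
  rw [← IsGalois.card_fixingSubgroup_eq_finrank]
  have hm : ∀ g : K ≃ₐ[ℚ] K, g ∈ (base s).fixingSubgroup ↔ ∀ i : Fin n, e g i.castSucc = 1 := by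
    intro g
    rw [IntermediateField.mem_fixingSubgroup_iff, fix_base]
    simp only [he, one_mul_iff h]
  rw [show 2 = Nat.card ℤˣ by simp]
  apply Nat.card_eq_of_bijective (fun g : (base s).fixingSubgroup => e g.1 (Fin.last n))
  constructor
  · intro g g' hg
    apply Subtype.ext
    apply e.injective
    funext i
    refine Fin.lastCases hg (fun j => ?_) i
    rw [(hm _).mp g.2 j, (hm _).mp g'.2 j]
  · intro a
    refine ⟨⟨e.symm (Fin.lastCases a (fun _ => 1)), (hm _).mpr fun i => ?_⟩, ?_⟩
    · simp
    · simp

lemma SF.quad (h : SF (n+1) K s d) : ∃ σ : K ≃ₐ[base s] K, Quad (base s) K σ ∧ σ (s (Fin.last n)) = - s (Fin.last n) ∧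
    ∀ i : Fin n, σ (s i.castSucc) = s i.castSucc := by
  have := h.gal
  obtain ⟨e, he⟩ := h.iso
  let σ0 := e.symm (Fin.lastCases (-1) (fun _ => 1))
  have h1 : ∀ i : Fin n, σ0 (s i.castSucc) = s i.castSucc := by
    intro i; rw [he]; simp [σ0]
  have h2 : σ0 (s (Fin.last n)) = - s (Fin.last n) := by rw [he]; simp [σ0]
  have hfix := (fix_base σ0).mpr h1
  let σ : K ≃ₐ[base s] K := { σ0.toRingEquiv with commutes' := fun x => hfix x x.2 }
  refine ⟨σ, ⟨h.base_fr, ?_⟩, h2, h1⟩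
  intro hs
  have h3 : σ (s (Fin.last n)) = s (Fin.last n) := by rw [hs]; rfl
  have h4 : - s (Fin.last n) = s (Fin.last n) := h2.symm.trans h3
  exact h.s0 _ (self_eq_neg.mp h4.symm)

lemma adj_top {F E ι : Type*} [Field F] [Field E] [Algebra F E] (x : ι → E) :
    adjoin F (Set.range fun i => (⟨x i, subset_adjoin _ _ ⟨i, rfl⟩⟩ : adjoin F (Set.range x))) = ⊤ := by
  apply lift_injective
  rw [lift_adjoin, lift_top]
  congr 1
  rw [← Set.range_comp]; rfl

lemma SF.down (h : SF (n+1) K s d) : SF n (base s) (fun i => ⟨s i.castSucc, mem_base s i⟩) (fun i => d i.castSucc) := by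
  have hf := h.base_fr
  refine ⟨?_, fun i => h.nz _, ?_, ?_⟩
  · intro i; apply Subtype.ext
    show s i.castSucc ^ 2 = _
    rw [h.sq]; simp
  · have h1 := Module.finrank_mul_finrank ℚ (base s) K
    rw [hf, h.fr, pow_succ] at h1
    have h2 := mul_right_cancel₀ two_ne_zero h1
    convert h2
  · have key := adj_top (F := ℚ) (fun i : Fin n => s i.castSucc)
    have : (DivisionRing.toRatAlgebra : Algebra ℚ (base s)) = (base s).algebra' := Subsingleton.elim _ _
    rw [this]
    exact key

end
end TQ

namespace TQ
section
open IntermediateField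

lemma SF.qs {k : Type*} [Field k] [NumberField k] {s : Fin 1 → k} {d : Fin 1 → ℤ} (h : SF 1 k s d)
    (hf : fund (d 0) = true) : QS k (s 0) (d 0) := ⟨h.fr, h.sq 0, hf⟩

lemma quartic_integral {F : Type*} [Field F] (u : F) (c3 c2 c1 c0 : ℤ)
    (hu : u ^ 4 + c3 * u ^ 3 + c2 * u ^ 2 + c1 * u + c0 = 0) : IsIntegral ℤ u := by
  let q : Polynomial ℤ := Polynomial.X ^ 4 + Polynomial.C c3 * Polynomial.X ^ 3 + Polynomial.C c2 * Polynomial.X ^ 2 +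
    Polynomial.C c1 * Polynomial.X + Polynomial.C c0
  refine ⟨q, ?_, ?_⟩
  · simp only [q]; monicity!
  · simp only [q]
    simp only [Polynomial.eval₂_add, Polynomial.eval₂_mul, Polynomial.eval₂_pow, Polynomial.eval₂_X, Polynomial.eval₂_C]
    simpa using hu

lemma unit_of_poly {F : Type*} [Field F] [NumberField F] (u : F) (c3 c2 c1 ε : ℤ) (hε : ε * ε = 1)
    (hu : u ^ 4 + c3 * u ^ 3 + c2 * u ^ 2 + c1 * u + ε = 0) : ∃ U : (𝓞 F)ˣ, ((U : 𝓞 F) : F) = u := by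
  have h1 := quartic_integral u c3 c2 c1 ε hu
  let a : 𝓞 F := ⟨u, h1⟩
  have ha : (a : F) = u := rfl
  have h2 : a * (-ε * (a ^ 3 + c3 * a ^ 2 + c2 * a + c1)) = 1 := by
    apply NumberField.RingOfIntegers.ext
    have hε' : (ε : F) * ε = 1 := by exact_mod_cast hε
    change algebraMap (𝓞 F) F _ = algebraMap (𝓞 F) F _
    simp only [map_mul, map_add, map_pow, map_neg, map_one, map_intCast]
    rw [show algebraMap (𝓞 F) F a = u from rfl]
    linear_combination -(ε : F) * hu + hε'
  exact ⟨Units.mkOfMulEqOne _ _ h2, rfl⟩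

lemma theta {L : Type*} [Field L] [NumberField L] (x : L) {D : ℤ} (hD : fund D = true) (hx : x ^ 2 = (D : L)) :
    ∃ θ : 𝓞 L, (θ : L) = ((tt D : ℤ) + x) / 2 := by
  obtain ⟨-, h1⟩ := tn hD
  have h1' : (D : L) = (tt D : L) ^ 2 - 4 * (nn D : L) := by exact_mod_cast congrArg (Int.cast : ℤ → L) h1
  refine ⟨⟨((tt D : ℤ) + x) / 2, quartic_integral _ (-tt D) (nn D) 0 0 ?_⟩, rfl⟩
  push_cast
  linear_combination (((tt D : ℤ) + x) / 2) ^ 2 / 4 * (hx.trans h1')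

variable {L : Type*} [Field L] [NumberField L] {n : ℕ} {s : Fin (n+1) → L} {d : Fin (n+1) → ℤ}

lemma SF.ram (h : SF (n+1) L s d) (g : L ≃+* L) (hσ : g (s (Fin.last n)) = - s (Fin.last n))
    (hf : fund (d (Fin.last n)) = true) {p : ℕ} (hp : (d (Fin.last n)) ∣ (p : ℤ) ^ 3) :
    ∃ θ : 𝓞 L, ∀ Q : Ideal (𝓞 L), Q.IsPrime → θ - ra g θ ∈ Q → (p : 𝓞 L) ∈ Q := by
  obtain ⟨θ, hθ⟩ := theta (s (Fin.last n)) hf (h.sq _)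
  refine ⟨θ, fun Q hQ hm => ?_⟩
  have h1 : (θ - ra g θ) ^ 2 = ((d (Fin.last n) : ℤ) : 𝓞 L) := by
    apply NumberField.RingOfIntegers.ext
    have : (((θ - ra g θ) ^ 2 : 𝓞 L) : L) = ((θ : L) - g (θ : L)) ^ 2 := rfl
    rw [this, hθ, map_div₀, map_add, hσ, map_intCast, map_ofNat]
    have h2 := h.sq (Fin.last n)
    have h4 : (((d (Fin.last n) : ℤ) : 𝓞 L) : L) = ((d (Fin.last n) : ℤ) : L) := map_intCast (algebraMap (𝓞 L) L) _
    rw [h4, ← h2]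
    ring
  have h2 : ((d (Fin.last n) : ℤ) : 𝓞 L) ∈ Q := by rw [← h1]; exact Ideal.pow_mem_of_mem _ hm 2 two_pos
  obtain ⟨m, hm'⟩ := hp
  have h3 : (p : 𝓞 L) ^ 3 = (d (Fin.last n) : ℤ) * (m : 𝓞 L) := by exact_mod_cast congrArg (Int.cast : ℤ → 𝓞 L) hm'
  apply hQ.mem_of_pow_mem 3
  rw [h3]; exact Q.mul_mem_right _ h2

lemma SF.tc (h : SF n.succ L s d) (j : Fin n) (hj : d j.castSucc < 0) : IsTotallyComplex (base s) ∧ IsTotallyComplex L :=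
  ⟨tc_of_neg _ _ hj (h.down.sq j), tc_of_neg _ _ hj (h.sq _)⟩

theorem SF.T1 (h : SF (n+1) L s d) (j : Fin n) (hj : d j.castSucc < 0)
    (hodd : Odd (Nat.card (ClassGroup (𝓞 (base s))))) {p : ℕ} (hpp : p.Prime)
    (hf : fund (d (Fin.last n)) = true) (hp : (d (Fin.last n)) ∣ (p : ℤ) ^ 3) (hu : Uq (base s) p) :
    Odd (Nat.card (ClassGroup (𝓞 L))) := by
  obtain ⟨σ, hq, hσ, -⟩ := h.quad
  obtain ⟨t1, t2⟩ := h.tc j hj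
  have := hq.gal
  obtain ⟨θ, hθ⟩ := h.ram σ.toRingEquiv hσ hf hp
  obtain ⟨P, hP, hP0, hm⟩ := exists_over (L := L) p hpp
  refine hq.chev hodd θ (t := 1) (fun _ => P) (fun _ => hP) (fun _ => hP0) (fun Q hQ hQm => ⟨0, ?_⟩) (Or.inl rfl)
  obtain ⟨g, hg⟩ := hu.trans P Q hP hQ hm (hθ Q hQ hQm)
  rcases hq.all g with rfl | rfl
  · left; rw [hg]; exact cj_of_id _ (fun x => rfl) _
  · right; exact hg

theorem SF.T2 (h : SF (n+1) L s d) (j : Fin n) (hj : d j.castSucc < 0)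
    (hodd : Odd (Nat.card (ClassGroup (𝓞 (base s))))) {p : ℕ} (hpp : p.Prime)
    (hf : fund (d (Fin.last n)) = true) (hp : (d (Fin.last n)) ∣ (p : ℤ) ^ 3)
    {F : Type*} [Field F] [NumberField F] [Algebra F L] [IsGalois F L] (hu : Uq F p)
    {σ : L ≃ₐ[base s] L} (hq : Quad (base s) L σ) (hσ : σ (s (Fin.last n)) = - s (Fin.last n))
    (τ : L ≃+* L)
    (hall : ∀ g : L ≃ₐ[F] L, (∀ x, g x = x) ∨ (∀ x, g x = σ x) ∨ (∀ x, g x = τ x) ∨ (∀ x, g x = σ (τ x)))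
    (u : (𝓞 (base s))ˣ) (hun : ∀ x : L, x * σ x ≠ (((u : 𝓞 (base s)) : base s) : L)) :
    Odd (Nat.card (ClassGroup (𝓞 L))) := by
  obtain ⟨t1, t2⟩ := h.tc j hj
  obtain ⟨θ, hθ⟩ := h.ram σ.toRingEquiv hσ hf hp
  obtain ⟨P, hP, hP0, hm⟩ := exists_over (L := L) p hpp
  refine hq.chev hodd θ (t := 2) ![P, cj τ P] ?_ ?_ (fun Q hQ hQm => ?_) (Or.inr ⟨rfl, u, hun⟩)
  · intro i; fin_cases i
    · exact hP
    · exact cj_prime _ _ hP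
  · intro i; fin_cases i
    · exact hP0
    · exact cj_ne_bot _ _ hP0
  obtain ⟨g, hg⟩ := hu.trans P Q hP hQ hm (hθ Q hQ hQm)
  rcases hall g with h1 | h1 | h1 | h1
  · refine ⟨0, Or.inl ?_⟩; rw [hg]; exact cj_of_id _ h1 _
  · refine ⟨0, Or.inr ?_⟩; rw [hg]
    rw [show g.toRingEquiv = σ.toRingEquiv from RingEquiv.ext h1]; rfl
  · refine ⟨1, Or.inl ?_⟩; rw [hg]
    rw [show g.toRingEquiv = τ from RingEquiv.ext h1]; rfl
  · refine ⟨1, Or.inr ?_⟩; rw [hg]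
    rw [show g.toRingEquiv = τ.trans σ.toRingEquiv from RingEquiv.ext h1, ← cj_cj]; rfl

end
end TQ

namespace TQ
section
open IntermediateField

theorem SF.T4i {B : Type*} [Field B] [NumberField B] {s : Fin 2 → B} {d : Fin 2 → ℤ}
    (h : SF 2 B s d) (hd0 : d 0 = -4) (hodd : Odd (Nat.card (ClassGroup (𝓞 (base s))))) {p : ℕ}
    (hd1 : d 1 = p) (hf : fund (d 1) = true) (hN : NN p (-4) 2) :
    Odd (Nat.card (ClassGroup (𝓞 B))) := by
  have hgal := h.gal
  obtain ⟨σ, hq, hσ, hσ0⟩ := h.quad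
  have hσ0' : σ (s 0) = s 0 := hσ0 0
  have hσ1' : σ (s 1) = - s 1 := hσ
  obtain ⟨e, he⟩ := h.iso
  have hs0 : s 0 ^ 2 = -4 := by rw [h.sq, hd0]; simp
  have hs00 := h.s0 0
  have hmem : s 0 ∈ base s := mem_base s 0
  obtain ⟨U, hU⟩ := unit_of_poly (F := base s) (⟨s 0, hmem⟩ / 2) 0 0 0 (-1) (by norm_num) (by
    apply Subtype.ext
    push_cast
    show (s 0 / 2) ^ 4 + _ * _ + _ * _ + _ * _ + -1 = (0 : B)
    linear_combination (s 0 ^ 2 / 16 - 1 / 4) * hs0)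
  let τ : B ≃ₐ[ℚ] B := e.symm ![-1, 1]
  have hτ0 : τ (s 0) = - s 0 := by rw [he]; simp [τ]
  have hτ1 : τ (s 1) = s 1 := by rw [he]; simp [τ]
  let σ' : B ≃ₐ[ℚ] B := σ.restrictScalars ℚ
  have hσ'0 : σ' (s 0) = s 0 := hσ0'
  have hσ'1 : σ' (s 1) = - s 1 := hσ1'
  refine h.T2 0 (by show d 0 < 0; rw [hd0]; norm_num) hodd hN.pr hf (by show d 1 ∣ _; rw [hd1]; exact dvd_pow_self _ (by norm_num))
    (uq_rat p hN.pr) hq hσ τ.toRingEquiv ?_ U ?_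
  · intro g
    have key : ∀ g' : B ≃ₐ[ℚ] B, g (s 0) = g' (s 0) → g (s 1) = g' (s 1) → ∀ x, g x = g' x := by
      intro g' h1 h2 x
      rw [h.ext (g := g) (g' := g')]
      intro i; fin_cases i
      · exact h1
      · exact h2
    rcases h.pm g 0 with h1 | h1 <;> rcases h.pm g 1 with h2 | h2
    · left; exact key 1 h1 h2
    · right; left; exact key σ' (by rw [h1, hσ'0]) (by rw [h2, hσ'1])
    · right; right; left; exact key τ (by rw [h1, hτ0]) (by rw [h2, hτ1])
    · right; right; right; exact key (σ' * τ) (by rw [h1, AlgEquiv.mul_apply, hτ0, map_neg, hσ'0])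
        (by rw [h2, AlgEquiv.mul_apply, hτ1, hσ'1])
  · intro x hx
    rw [hU] at hx
    have hx' : x * σ x = s 0 / 2 := hx
    let v : B := (2 + s 0) / 4
    have hv : v * v * 2 = s 0 / 2 := by simp only [v]; linear_combination hs0 / 8
    have hv0 : v ≠ 0 := by
      intro h0; rw [h0] at hv
      apply hs00; linear_combination (-2) * hv
    have hσv : σ v = v := by simp only [v]; rw [map_div₀, map_add, hσ0', map_ofNat, map_ofNat]
    let z := x / v
    have hz : z * σ z = 2 := by
      simp only [z]; rw [map_div₀, hσv]; field_simp; rw [hx', ← hv]; ring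
    have rep : ∀ R : B, σ R = R → ∃ a b : ℚ, R = a + b * s 0 := by
      intro R hR
      obtain ⟨y, hy⟩ := hq.fixed R hR
      have hym : R ∈ ℚ⟮s 0⟯ := by
        have h1 : (y : B) ∈ base s := y.2
        have h2 : (y : B) = R := hy
        rw [h2] at h1
        have h3 : base s = ℚ⟮s 0⟯ := by
          unfold base; congr 1; ext w; simp
          exact eq_comm
        rwa [h3] at h1
      obtain ⟨a, b, hab⟩ := quad_rep (F := ℚ) (s 0) (-4) (by rw [hs0]; simp) R hym
      exact ⟨a, b, by simpa using hab⟩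
    have hs1 := h.s0 1
    have hinv := hq.invol z
    obtain ⟨a, b, h1⟩ := rep ((z + σ z) / 2) (by rw [map_div₀, map_add, hinv, map_ofNat]; ring)
    obtain ⟨a', b', h2⟩ := rep ((z - σ z) / (2 * s 1)) (by
      rw [map_div₀, map_sub, map_mul, hinv, map_ofNat, hσ1']; field_simp; ring)
    exact hN.nonnorm (s 0) (s 1) z (σ z) (d 1) (Or.inl hd1) (by rw [hs0]; simp) (h.sq 1) a b a' b' h1 h2 (by rw [hz]; simp)

/-- sign patterns -/
def ep (i : Fin 7) : Fin 3 → ℤˣ := if i = 0 then ![1, -1, 1] else if i = 1 then ![-1, 1, 1] else ![-1, -1, 1]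
def sg3 : Fin 3 → ℤˣ := ![1, 1, -1]

lemma ep_all : ∀ i : Fin 7, i.val < 3 → ∀ ε, chi i ε = 1 → ε = 1 ∨ ε = sg3 ∨ ε = ep i ∨ ε = sg3 * ep i := by decide
lemma ep_sq (i : Fin 7) : ep i * ep i = 1 := by funext j; exact Int.units_mul_self _
lemma ep_two : ∀ i : Fin 7, ep i 2 = 1 := by decide
lemma ep_chi : ∀ i : Fin 7, i.val < 3 → chi i (ep i) = 1 ∧ chi i sg3 = 1 := by decide

theorem SF.T8 {K : Type*} [Field K] [NumberField K] {s : Fin 3 → K} {d : Fin 3 → ℤ}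
    (h : SF 3 K s d) (hd0 : d 0 < 0) (hodd : Odd (Nat.card (ClassGroup (𝓞 (base s))))) {p : ℕ} {N : ℤ}
    (hd2 : d 2 = p ∨ d 2 = -p) (hf : fund (d 2) = true) (i j : Fin 7) (hi : i.val < 3) (hj : j.val < 3)
    (hu : Uq (kk s i) p) (hN : NN p (pd d j) N) (u v : K) (hub : u ∈ base s) (c3 c2 c1 ε : ℤ) (hε : ε * ε = 1)
    (hup : u ^ 4 + c3 * u ^ 3 + c2 * u ^ 2 + c1 * u + ε = 0) (hv : v ∈ kk s j) (hv0 : v ≠ 0)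
    (huv : ∀ τ : K ≃ₐ[ℚ] K, (∀ l, τ (s l) = ((ep j l : ℤˣ) : ℤ) * s l) → u * τ u = N * v ^ 2) :
    Odd (Nat.card (ClassGroup (𝓞 K))) := by
  have hgal := h.gal
  obtain ⟨σ, hq, hσ, hσ0⟩ := h.quad
  obtain ⟨e, he⟩ := h.iso
  obtain ⟨U, hU⟩ := unit_of_poly (F := base s) ⟨u, hub⟩ c3 c2 c1 ε hε (by
    apply Subtype.ext; push_cast; exact hup)
  let σ' : K ≃ₐ[ℚ] K := σ.restrictScalars ℚ
  have hσ'x : ∀ x, σ' x = σ x := fun x => rfl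
  have hσ2 : σ (s 2) = - s 2 := hσ
  have eσ : e σ' = sg3 := by
    funext l
    apply h.sg_uniq (i := l)
    rw [← he]
    fin_cases l
    · simp [sg3]; exact hσ0 0
    · simp [sg3]; exact hσ0 1
    · simp [sg3]; exact hσ
  refine h.T2 0 hd0 hodd hN.pr hf (by
      show d 2 ∣ _
      rcases hd2 with h1 | h1 <;> rw [h1]
      · exact dvd_pow_self _ (by norm_num)
      · exact (neg_dvd).mpr (dvd_pow_self _ (by norm_num))) hu hq hσ (e.symm (ep i)).toRingEquiv ?_ U ?_
  · intro g
    have h1 : chi i (e (g.restrictScalars ℚ)) = 1 := by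
      rw [← h.fix_iff e he]
      exact g.commutes ⟨ee s i, mem_adjoin_simple_self ℚ _⟩
    have key : ∀ g' : K ≃ₐ[ℚ] K, e (g.restrictScalars ℚ) = e g' → ∀ x, g x = g' x := by
      intro g' h2 x
      have := e.injective h2
      rw [← this]; rfl
    rcases ep_all i hi _ h1 with h2 | h2 | h2 | h2
    · left; exact key 1 (by rw [h2, map_one])
    · right; left; exact key σ' (by rw [h2, eσ])
    · right; right; left; exact key (e.symm (ep i)) (by rw [h2]; simp)
    · right; right; right; exact key (σ' * e.symm (ep i)) (by rw [h2, map_mul, eσ]; simp)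
  · intro x hx
    rw [hU] at hx
    have hx' : x * σ' x = u := hx
    let τ : K ≃ₐ[ℚ] K := e.symm (ep j)
    have eτ : e τ = ep j := by simp [τ]
    have hτ := huv τ (fun l => by rw [he, eτ])
    have hcomm : ∀ y, σ' (τ y) = τ (σ' y) := by
      intro y
      have : σ' * τ = τ * σ' := by apply e.injective; rw [map_mul, map_mul, mul_comm]
      exact DFunLike.congr_fun this y
    have hττ : ∀ y, τ (τ y) = y := by
      intro y
      have : τ * τ = 1 := by apply e.injective; rw [map_mul, map_one, eτ, ep_sq]
      exact DFunLike.congr_fun this y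
    have hσσ : ∀ y, σ' (σ' y) = y := hq.invol
    have hτ2 : τ (s 2) = s 2 := by rw [he, eτ, ep_two]; simp
    have hfixv : ∀ g : K ≃ₐ[ℚ] K, chi j (e g) = 1 → g v = v := by
      intro g hg
      exact (mem_simple g).mpr ((h.fix_iff e he g j).mpr hg) v hv
    have hvσ := hfixv σ' (by rw [eσ]; exact (ep_chi j hj).2)
    have hvτ := hfixv τ (by rw [eτ]; exact (ep_chi j hj).1)
    have rep : ∀ R : K, σ' R = R → τ R = R → ∃ a b : ℚ, R = a + b * ee s j := by
      intro R h1 h2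
      have hm : R ∈ ℚ⟮ee s j⟯ := by
        have := (IsGalois.mem_range_algebraMap_iff_fixed (F := kk s j) (E := K) R).mpr (by
          intro g
          have h3 : chi j (e (g.restrictScalars ℚ)) = 1 := by
            rw [← h.fix_iff e he]
            exact g.commutes ⟨ee s j, mem_adjoin_simple_self ℚ _⟩
          have key : ∀ g' : K ≃ₐ[ℚ] K, e (g.restrictScalars ℚ) = e g' → g R = g' R := by
            intro g' h4
            have := e.injective h4
            rw [← this]; rfl
          rcases ep_all j hj _ h3 with h4 | h4 | h4 | h4
          · exact key 1 (by rw [h4, map_one])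
          · exact (key σ' (by rw [h4, eσ])).trans h1
          · exact (key τ (by rw [h4, eτ])).trans h2
          · exact (key (σ' * τ) (by rw [h4, map_mul, eσ, eτ])).trans (by rw [AlgEquiv.mul_apply, h2, h1]))
        obtain ⟨y, hy⟩ := this
        rw [← hy]; exact y.2
      obtain ⟨a, b, hab⟩ := quad_rep (F := ℚ) (ee s j) ((pd d j : ℤ) : ℚ) (by rw [h.ee_sq]; simp) R hm
      exact ⟨a, b, by simpa using hab⟩
    let z := x * τ x / v
    have hz : z * σ' z = N := by
      simp only [z]; rw [map_div₀, map_mul, hvσ, hcomm]; field_simp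
      have h5 := hτ
      rw [← hx', map_mul] at h5
      linear_combination h5
    have hzτ : τ z = z := by simp only [z]; rw [map_div₀, map_mul, hvτ, hττ]; ring
    have hzτ' : τ (σ' z) = σ' z := by rw [← hcomm, hzτ]
    have hs2 := h.s0 2
    have hσ2' : σ' (s 2) = - s 2 := hσ2
    obtain ⟨a, b, h1⟩ := rep ((z + σ' z) / 2) (by rw [map_div₀, map_add, hσσ, map_ofNat]; ring)
      (by rw [map_div₀, map_add, hzτ, hzτ', map_ofNat])
    obtain ⟨a', b', h2⟩ := rep ((z - σ' z) / (2 * s 2)) (by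
      rw [map_div₀, map_sub, map_mul, hσσ, map_ofNat, hσ2']; field_simp; ring)
      (by rw [map_div₀, map_sub, map_mul, hzτ, hzτ', map_ofNat, hτ2])
    exact hN.nonnorm (ee s j) (s 2) z (σ' z) (d 2) hd2 (h.ee_sq j) (h.sq 2) a b a' b' h1 h2 hz

end
end TQ

namespace TQ
section
open IntermediateField

/-- naive primality -/
def ipr (p : ℕ) : Bool := decide (2 ≤ p) && (List.range p).all fun m => decide (m < 2) || !(p % m == 0)

lemma ipr_ok {p : ℕ} (h : ipr p = true) : p.Prime := by
  simp only [ipr, Bool.and_eq_true, List.all_eq_true, Bool.or_eq_true, decide_eq_true_eq,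
    List.mem_range, Bool.not_eq_true', beq_eq_false_iff_ne] at h
  rw [Nat.prime_def_lt']
  refine ⟨h.1, fun m hm hmp hd => ?_⟩
  rcases h.2 m hmp with h1 | h1
  · omega
  · exact h1 (Nat.mod_eq_zero_of_dvd hd)

/-- the check for `NN` -/
def nnb (p : ℕ) (c N : ℤ) : Bool :=
  ipr p && p != 2 && (List.range p).any (fun X => ((X : ℤ) ^ 2 - c) % p == 0) && c % p != 0 &&
    (List.range p).all (fun r => ((r : ℤ) ^ 2 - N) % p != 0) && (decide (c < 0) || fund c)

lemma nnb_ok {p : ℕ} {c N : ℤ} (h : nnb p c N = true) : NN p c N := by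
  simp only [nnb, Bool.and_eq_true, List.all_eq_true, List.any_eq_true, Bool.or_eq_true, decide_eq_true_eq,
    List.mem_range, bne_iff_ne, beq_iff_eq] at h
  obtain ⟨⟨⟨⟨⟨h1, h2⟩, X, -, h3⟩, h4⟩, h5⟩, h6⟩ := h
  have hp := ipr_ok h1
  refine ⟨hp, h2, ⟨X, Int.dvd_of_emod_eq_zero h3⟩, fun h => h4 (Int.emod_eq_zero_of_dvd h), ?_, ?_⟩
  · intro r hr
    haveI : NeZero p := ⟨hp.ne_zero⟩
    apply h5 r.val (ZMod.val_lt r)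
    apply Int.emod_eq_zero_of_dvd
    rw [← ZMod.intCast_eq_intCast_iff_dvd_sub]
    push_cast
    rw [ZMod.natCast_zmod_val, hr]
  · intro a ha
    rcases h6 with h6 | h6
    · have : (c : ℚ) < 0 := by exact_mod_cast h6
      nlinarith [sq_nonneg a]
    · exact fund_nonsq h6 a ha

/-- ramified prime -/
def pof (d : ℤ) : ℕ := if d = 8 then 2 else d.natAbs

/-- check for the first two layers -/
def b2 (d0 d1 a r : ℤ) : Bool :=
  fund d0 && fund d1 && decide (d0 < 0) && chk d0 0 a r false 64 && 
    ((ipr (pof d1) && inert d0 (pof d1) && ((pof d1 : ℤ) ^ 3 % d1 == 0)) ||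
     (d0 == -4 && d1 == 8) || (d0 == -4 && d1 == (pof d1 : ℤ) && nnb (pof d1) (-4) 2))

variable {K : Type*} [Field K] [NumberField K]

theorem SF.b2 {s : Fin 2 → K} {d : Fin 2 → ℤ} (h : SF 2 K s d) {a r : ℤ} (hb : b2 (d 0) (d 1) a r = true) :
    Odd (Nat.card (ClassGroup (𝓞 K))) := by
  simp only [TQ.b2, Bool.and_eq_true, Bool.or_eq_true, beq_iff_eq, decide_eq_true_eq] at hb
  obtain ⟨⟨⟨⟨h0, h1⟩, hneg⟩, hc⟩, hcases⟩ := hb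
  have hq := h.down.qs (show fund (d 0) = true from h0)
  have hodd := hq.odd (D := d 0) hc
  rcases hcases with (⟨⟨hp, hi⟩, hd⟩ | ⟨h4, h8⟩) | ⟨⟨h4, hp⟩, hn⟩
  · exact h.T1 0 hneg hodd (ipr_ok hp) h1 (Int.dvd_of_emod_eq_zero hd) (hq.uq _ (ipr_ok hp) hi)
  · refine h.T1 0 hneg hodd Nat.prime_two h1 (show d 1 ∣ _ by rw [h8]; norm_num) ?_
    have hq' : QS (base s) _ (d 0) := hq
    rw [h4] at hq'
    exact hq'.uq4
  · exact h.T4i h4 hodd hp h1 (nnb_ok hn)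

variable {s : Fin 3 → K} {d : Fin 3 → ℤ}

lemma pd0 : pd d 0 = d 0 := by
  simp [pd, Fin.prod_univ_three, show bt 0 0 = true by decide, show bt 0 1 = false by decide, show bt 0 2 = false by decide]
lemma pd1 : pd d 1 = d 1 := by
  simp [pd, Fin.prod_univ_three, show bt 1 0 = false by decide, show bt 1 1 = true by decide, show bt 1 2 = false by decide]
lemma pd2 : pd d 2 = d 0 * d 1 := by
  simp [pd, Fin.prod_univ_three, show bt 2 0 = true by decide, show bt 2 1 = true by decide, show bt 2 2 = false by decide]
lemma ee2 : ee s 2 = s 0 * s 1 := by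
  simp [ee, Fin.prod_univ_three, show bt 2 0 = true by decide, show bt 2 1 = true by decide, show bt 2 2 = false by decide]
lemma ee0 : ee s 0 = s 0 := by
  simp [ee, Fin.prod_univ_three, show bt 0 0 = true by decide, show bt 0 1 = false by decide, show bt 0 2 = false by decide]

lemma SF.uqk (h : SF 3 K s d) (i : Fin 7) {p : ℕ} (hp : p.Prime) (hf : fund (pd d i) = true) (hi : inert (pd d i) p = true) :
    Uq (kk s i) p :=
  (QS.of_gen (ee s i) (pd d i) 1 one_ne_zero hf (by rw [h.ee_sq]; simp)).uq p hp hi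

lemma mb0 : s 0 ∈ base s := mem_base s 0
lemma mb1 : s 1 ∈ base s := mem_base s 1

/-- common checks -/
def cm (d0 d1 d2 a r : ℤ) : Bool := b2 d0 d1 a r && fund d2 && (d2 == (d2.natAbs : ℤ) || d2 == -(d2.natAbs : ℤ))

lemma SF.common (h : SF 3 K s d) {a r : ℤ} (hc : cm (d 0) (d 1) (d 2) a r = true) :
    d 0 < 0 ∧ fund (d 0) = true ∧ fund (d 1) = true ∧ Odd (Nat.card (ClassGroup (𝓞 (base s)))) ∧ fund (d 2) = true ∧ (d 2 = (d 2).natAbs ∨ d 2 = -(d 2).natAbs) := by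
  simp only [TQ.cm, Bool.and_eq_true, Bool.or_eq_true, beq_iff_eq] at hc
  have hb := hc.1.1
  simp only [TQ.b2, Bool.and_eq_true, Bool.or_eq_true, beq_iff_eq, decide_eq_true_eq] at hb
  exact ⟨hb.1.1.2, hb.1.1.1.1, hb.1.1.1.2, h.down.b2 (show TQ.b2 (d 0) (d 1) a r = true from hc.1.1), hc.1.2, hc.2⟩

lemma two_term (s : Fin 3 → K) (a b c e : ℚ) : a + b * s 0 + c * s 1 + e * (s 0 * s 1) ∈ base s := by
  have h : ∀ a : ℚ, (a : K) ∈ base s := fun a => by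
    have := (base s).algebraMap_mem a
    simpa using this
  exact add_mem (add_mem (add_mem (h a) (mul_mem (h b) mb0)) (mul_mem (h c) mb1)) (mul_mem (h e) (mul_mem mb0 mb1))

lemma lin_mem (s : Fin 3 → K) (j : Fin 7) (a b : ℚ) : a + b * ee s j ∈ kk s j := by
  have h : ∀ a : ℚ, (a : K) ∈ kk s j := fun a => by
    have := (kk s j).algebraMap_mem a
    simpa using this
  exact add_mem (h a) (mul_mem (h b) (mem_adjoin_simple_self ℚ _))

/-- case i -/
def ci (d0 d1 d2 a b η : ℤ) : Bool :=
  d0 == -4 && a ^ 2 + d1 * b ^ 2 == 2 * η && η * η == 1 && inert d0 d2.natAbs && nnb d2.natAbs (d0 * d1) 2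

theorem SF.ci (h : SF 3 K s d) {A r a b η : ℤ} (hc : cm (d 0) (d 1) (d 2) A r = true)
    (hx : ci (d 0) (d 1) (d 2) a b η = true) : Odd (Nat.card (ClassGroup (𝓞 K))) := by
  obtain ⟨hneg, h0, h1, hodd, h2, hd2⟩ := h.common hc
  simp only [TQ.ci, Bool.and_eq_true, beq_iff_eq] at hx
  obtain ⟨⟨⟨⟨e0, e1⟩, e2⟩, hi⟩, hn⟩ := hx
  have hN := nnb_ok hn
  have s0 : s 0 ^ 2 = -4 := by rw [h.sq, e0]; simp
  have s1 := h.sq 1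
  have e1' : (a : K) ^ 2 + d 1 * b ^ 2 = 2 * η := by exact_mod_cast e1
  have e2' : (η : K) * η = 1 := by exact_mod_cast e2
  have ht : (2 * a + b * (s 0 * s 1)) ^ 2 = 4 * a * (2 * a + b * (s 0 * s 1)) - 8 * (η : K) := by
    linear_combination b ^ 2 * s 1 ^ 2 * s0 - 4 * b ^ 2 * s1 - 4 * e1'
  have hv0 : (2 * a + b * (s 0 * s 1) : K) ≠ 0 := by
    intro h5; rw [h5] at ht
    have : (η : K) = 0 := by linear_combination ht / 8
    rw [this] at e2'; simp at e2'
  refine h.T8 hneg hodd hd2 h2 0 2 (by decide) (by decide) (h.uqk 0 hN.pr (by rw [pd0]; exact h0) (by rw [pd0]; exact hi))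
    (N := 2) (by rw [pd2]; exact hN) ((2 + s 0) * (2 * a + b * (s 0 * s 1)) / 8) ((2 * a + b * (s 0 * s 1)) / 4)
    ?_ (-2 * a) (2 * a ^ 2) (-2 * a * η) 1 (by norm_num) ?_ ?_ ?_ ?_
  · have := two_term s (a / 2) (a / 4) (-b / 2) (b / 4)
    push_cast at this
    convert this using 1
    linear_combination b * s 1 * s0 / 8
  · push_cast
    set w := (2 * a + b * (s 0 * s 1) : K) with hw
    have hy : (2 + s 0) ^ 2 = 4 * s 0 := by linear_combination s0
    have e3 : ((2 + s 0) * w / 8) ^ 2 = s 0 * w ^ 2 / 16 := by linear_combination w ^ 2 * hy / 64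
    have e4 : ((2 + s 0) * w / 8) ^ 4 = - w ^ 4 / 64 := by
      rw [show ((2 + s 0) * w / 8) ^ 4 = (((2 + s 0) * w / 8) ^ 2) ^ 2 by ring, e3]
      linear_combination w ^ 4 * s0 / 256
    rw [show ((2 + s 0) * w / 8) ^ 3 = ((2 + s 0) * w / 8) ^ 2 * ((2 + s 0) * w / 8) by ring, e4, e3]
    linear_combination (-w ^ 2 / 64 + η / 8 - s 0 * a * w / 32) * ht - e2' - a * w ^ 3 / 64 * s0
  · have := lin_mem s 2 (a / 2) (b / 4)
    rw [ee2] at this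
    push_cast at this
    convert this using 1
    ring
  · exact div_ne_zero hv0 (by norm_num)
  · intro τ hτ
    have t0 : τ (s 0) = - s 0 := by rw [hτ, show ep 2 0 = -1 by decide]; simp
    have t1 : τ (s 1) = - s 1 := by rw [hτ, show ep 2 1 = -1 by decide]; simp
    simp only [map_div₀, map_mul, map_add, t0, t1, map_ofNat, map_intCast]
    push_cast
    linear_combination (-(2 * a + b * (s 0 * s 1)) ^ 2 / 64) * s0

/-- case ii -/
def cii (d1 d2 a b : ℤ) (c : ℤ) : Bool :=
  a ^ 2 - d1 * b ^ 2 == -4 && inert d1 d2.natAbs && nnb d2.natAbs c (-1)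

theorem SF.cii (h : SF 3 K s d) {A r a b : ℤ} (hc : cm (d 0) (d 1) (d 2) A r = true) (j : Fin 7) (hj : j = 0 ∨ j = 2)
    (hx : cii (d 1) (d 2) a b (pd d j) = true) : Odd (Nat.card (ClassGroup (𝓞 K))) := by
  obtain ⟨hneg, h0, h1, hodd, h2, hd2⟩ := h.common hc
  simp only [TQ.cii, Bool.and_eq_true, beq_iff_eq] at hx
  obtain ⟨⟨e1, hi⟩, hn⟩ := hx
  have hN := nnb_ok hn
  have s1 := h.sq 1
  have e1' : (a : K) ^ 2 - d 1 * b ^ 2 = -4 := by exact_mod_cast e1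
  refine h.T8 hneg hodd hd2 h2 1 j (by decide) (by rcases hj with rfl | rfl <;> decide) (h.uqk 1 hN.pr (by rw [pd1]; exact h1) (by rw [pd1]; exact hi))
    hN ((a + b * s 1) / 2) 1 ?_ (-a) 0 (-a) (-1) (by norm_num) ?_ (one_mem _) one_ne_zero ?_
  · have := two_term s (a / 2) 0 (b / 2) 0
    push_cast at this
    convert this using 1
    ring
  · push_cast
    have : ((a + b * s 1) / 2) ^ 2 = a * ((a + b * s 1) / 2) + 1 := by
      linear_combination b ^ 2 * s1 / 4 - e1' / 4
    set u := (a + b * s 1) / 2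
    linear_combination (u ^ 2 + 1) * this
  · intro τ hτ
    have t1 : τ (s 1) = - s 1 := by
      rw [hτ, show ep j 1 = -1 by rcases hj with rfl | rfl <;> decide]; simp
    simp only [map_div₀, map_mul, map_add, t1, map_ofNat, map_intCast]
    push_cast
    linear_combination e1' / 4 - b ^ 2 * s1 / 4

/-- case iii -/
def ciii (d0 d1 d2 x y : ℤ) : Bool :=
  x ^ 2 * d0 - y ^ 2 * d1 == -4 && inert d1 d2.natAbs && nnb d2.natAbs d0 (-1)

theorem SF.ciii (h : SF 3 K s d) {A r x y : ℤ} (hc : cm (d 0) (d 1) (d 2) A r = true)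
    (hx : ciii (d 0) (d 1) (d 2) x y = true) : Odd (Nat.card (ClassGroup (𝓞 K))) := by
  obtain ⟨hneg, h0, h1, hodd, h2, hd2⟩ := h.common hc
  simp only [TQ.ciii, Bool.and_eq_true, beq_iff_eq] at hx
  obtain ⟨⟨e1, hi⟩, hn⟩ := hx
  have hN := nnb_ok hn
  have s0 := h.sq 0
  have s1 := h.sq 1
  have e1' : (x : K) ^ 2 * d 0 - y ^ 2 * d 1 = -4 := by exact_mod_cast e1
  refine h.T8 hneg hodd hd2 h2 1 0 (by decide) (by decide) (h.uqk 1 hN.pr (by rw [pd1]; exact h1) (by rw [pd1]; exact hi))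
    (by rw [pd0]; exact hN) ((x * s 0 + y * s 1) / 2) 1 ?_ 0 (-(x ^ 2 * d 0 + 2)) 0 1 (by norm_num) ?_ (one_mem _) one_ne_zero ?_
  · have := two_term s 0 (x / 2) (y / 2) 0
    push_cast at this
    convert this using 1
    ring
  · push_cast
    rw [← s0] at e1' ⊢
    rw [← s1] at e1'
    linear_combination (-(((x * s 0 + y * s 1) / 2) ^ 2 - 1 + x * s 0 * ((x * s 0 + y * s 1) / 2)) / 4) * e1'
  · intro τ hτ
    have t0 : τ (s 0) = s 0 := by rw [hτ, show ep 0 0 = 1 by decide]; simp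
    have t1 : τ (s 1) = - s 1 := by rw [hτ, show ep 0 1 = -1 by decide]; simp
    simp only [map_div₀, map_mul, map_add, t0, t1, map_ofNat, map_intCast]
    push_cast
    linear_combination e1' / 4 - y ^ 2 * s1 / 4 + x ^ 2 * s0 / 4

/-- case z8 -/
def cz (d0 d1 d2 : ℤ) : Bool :=
  d0 == -4 && d1 == 8 && inert d1 d2.natAbs && (nnb d2.natAbs d0 2 || nnb d2.natAbs (d0 * d1) (-1))

theorem SF.cz (h : SF 3 K s d) {A r : ℤ} (hc : cm (d 0) (d 1) (d 2) A r = true)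
    (hx : cz (d 0) (d 1) (d 2) = true) : Odd (Nat.card (ClassGroup (𝓞 K))) := by
  obtain ⟨hneg, h0, h1, hodd, h2, hd2⟩ := h.common hc
  simp only [TQ.cz, Bool.and_eq_true, Bool.or_eq_true, beq_iff_eq] at hx
  obtain ⟨⟨⟨e0, e1⟩, hi⟩, hn⟩ := hx
  have s0 : s 0 ^ 2 = -4 := by rw [h.sq, e0]; simp
  have s1 : s 1 ^ 2 = 8 := by rw [h.sq, e1]; simp
  have s10 := h.s0 1
  have hm : (2 + s 0) / s 1 ∈ base s := by
    have := two_term s 0 0 (1/4) (1/8)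
    push_cast at this
    convert this using 1
    field_simp
    linear_combination (-4 * (2 + s 0)) * s1
  have hp : ((2 + s 0) / s 1) ^ 4 + ((0 : ℤ) : K) * ((2 + s 0) / s 1) ^ 3 + ((0 : ℤ) : K) * ((2 + s 0) / s 1) ^ 2 + ((0 : ℤ) : K) * ((2 + s 0) / s 1) + ((1 : ℤ) : K) = 0 := by
    push_cast
    have : ((2 + s 0) / s 1) ^ 2 = s 0 / 2 := by
      field_simp; linear_combination 2 * s0 - s 0 * s1
    linear_combination (((2 + s 0) / s 1) ^ 2 + s 0 / 2) * this + s0 / 4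
  rcases hn with hn | hn
  · have hN := nnb_ok hn
    refine h.T8 hneg hodd hd2 h2 1 0 (by decide) (by decide) (h.uqk 1 hN.pr (by rw [pd1]; exact h1) (by rw [pd1]; exact hi))
      (by rw [pd0]; exact hN) ((2 + s 0) / s 1) ((2 - s 0) / 4) hm 0 0 0 1 (by norm_num) hp ?_ ?_ ?_
    · have := lin_mem s 0 (1 / 2) (-1 / 4)
      rw [ee0] at this
      push_cast at this
      convert this using 1
      ring
    · intro h5
      have h6 : s 0 = 2 := by linear_combination (-4) * h5
      rw [h6] at s0; norm_num at s0
    · intro τ hτ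
      have t0 : τ (s 0) = s 0 := by rw [hτ, show ep 0 0 = 1 by decide]; simp
      have t1 : τ (s 1) = - s 1 := by rw [hτ, show ep 0 1 = -1 by decide]; simp
      simp only [map_div₀, map_mul, map_add, t0, t1, map_ofNat]
      push_cast
      field_simp
      rw [s1]
      linear_combination (-32) * s0
  · have hN := nnb_ok hn
    refine h.T8 hneg hodd hd2 h2 1 2 (by decide) (by decide) (h.uqk 1 hN.pr (by rw [pd1]; exact h1) (by rw [pd1]; exact hi))
      (by rw [pd2]; exact hN) ((2 + s 0) / s 1) 1 hm 0 0 0 1 (by norm_num) hp (one_mem _) one_ne_zero ?_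
    intro τ hτ
    have t0 : τ (s 0) = - s 0 := by rw [hτ, show ep 2 0 = -1 by decide]; simp
    have t1 : τ (s 1) = - s 1 := by rw [hτ, show ep 2 1 = -1 by decide]; simp
    simp only [map_div₀, map_mul, map_add, t0, t1, map_ofNat]
    push_cast
    field_simp
    linear_combination s1 + s0

end
end TQ

namespace TQ
section
open IntermediateField

/-- a square root -/
noncomputable def rt (n : ℤ) : ℂ := Classical.choose (IsAlgClosed.exists_pow_nat_eq (n : ℂ) (n := 2) two_pos)
lemma rt_sq (n : ℤ) : rt n ^ 2 = n := Classical.choose_spec (IsAlgClosed.exists_pow_nat_eq (n : ℂ) (n := 2) two_pos)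

lemma sup_eq (F : IntermediateField ℚ ℂ) (s : ℂ) : F ⊔ ℚ⟮s⟯ = (F⟮s⟯).restrictScalars ℚ :=
  (restrictScalars_adjoin_eq_sup ℚ F {s}).symm

lemma sup_fr (F : IntermediateField ℚ ℂ) (s : ℂ) (c : ℤ) (hs : s ^ 2 = c) (hn : s ∉ F) :
    Module.finrank ℚ ↥(F ⊔ ℚ⟮s⟯) = Module.finrank ℚ F * 2 := by
  rw [sup_eq]
  have h1 : Module.finrank F F⟮s⟯ = 2 := finrank_sq s (c : F) (by rw [hs]; simp) (fun a h => hn (by rw [h]; exact a.2))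
  rw [← h1]
  exact (Module.finrank_mul_finrank ℚ F F⟮s⟯).symm

lemma sup_sq (F : IntermediateField ℚ ℂ) (s : ℂ) (c : ℤ) (hs : s ^ 2 = c) (x : ℂ) (hx : x ∈ F ⊔ ℚ⟮s⟯) (e : ℤ)
    (hx2 : x ^ 2 = e) : (∃ y ∈ F, y ^ 2 = (e : ℂ)) ∨ ∃ y ∈ F, y ^ 2 = ((e * c : ℤ) : ℂ) := by
  rw [sup_eq] at hx
  rcases quad_sq (F := F) s (c : F) (by rw [hs]; simp) x hx (e : F) (by rw [hx2]; simp) with ⟨a, ha⟩ | ⟨a, ha⟩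
  · left; exact ⟨a, a.2, by rw [← hx2, ha]; rfl⟩
  · right; refine ⟨a, a.2, ?_⟩
    have : (a : ℂ) = x * s := ha.symm
    rw [this, mul_pow, hs, hx2]; push_cast; rfl

/-- the three layers -/
noncomputable def F1 (d : Fin 3 → ℤ) : IntermediateField ℚ ℂ := ⊥ ⊔ ℚ⟮rt (d 0)⟯
noncomputable def F2 (d : Fin 3 → ℤ) : IntermediateField ℚ ℂ := F1 d ⊔ ℚ⟮rt (d 1)⟯
noncomputable def F3 (d : Fin 3 → ℤ) : IntermediateField ℚ ℂ := F2 d ⊔ ℚ⟮rt (d 2)⟯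

/-- rational square -/
def RS (e : ℤ) : Prop := ∃ a : ℚ, a ^ 2 = e

lemma bot_sq (e : ℤ) (x : ℂ) (hx : x ∈ (⊥ : IntermediateField ℚ ℂ)) (hx2 : x ^ 2 = e) : RS e := by
  obtain ⟨a, rfl⟩ := mem_bot.mp hx
  refine ⟨a, ?_⟩
  simp at hx2
  exact_mod_cast hx2

lemma F1_sq (d : Fin 3 → ℤ) (e : ℤ) (x : ℂ) (hx : x ∈ F1 d) (hx2 : x ^ 2 = e) : RS e ∨ RS (e * d 0) := by
  rcases sup_sq _ _ _ (rt_sq (d 0)) x hx e hx2 with ⟨y, hy, h⟩ | ⟨y, hy, h⟩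
  · left; exact bot_sq _ y hy h
  · right; exact bot_sq _ y hy h

lemma F2_sq (d : Fin 3 → ℤ) (e : ℤ) (x : ℂ) (hx : x ∈ F2 d) (hx2 : x ^ 2 = e) :
    (RS e ∨ RS (e * d 0)) ∨ (RS (e * d 1) ∨ RS (e * d 1 * d 0)) := by
  rcases sup_sq _ _ _ (rt_sq (d 1)) x hx e hx2 with ⟨y, hy, h⟩ | ⟨y, hy, h⟩
  · left; exact F1_sq d _ y hy h
  · right; exact F1_sq d _ y hy h

lemma F3_sq (d : Fin 3 → ℤ) (e : ℤ) (x : ℂ) (hx : x ∈ F3 d) (hx2 : x ^ 2 = e) :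
    ((RS e ∨ RS (e * d 0)) ∨ (RS (e * d 1) ∨ RS (e * d 1 * d 0))) ∨
    ((RS (e * d 2) ∨ RS (e * d 2 * d 0)) ∨ (RS (e * d 2 * d 1) ∨ RS (e * d 2 * d 1 * d 0))) := by
  rcases sup_sq _ _ _ (rt_sq (d 2)) x hx e hx2 with ⟨y, hy, h⟩ | ⟨y, hy, h⟩
  · left; exact F2_sq d _ y hy h
  · right; exact F2_sq d _ y hy h

lemma F3_fr (d : Fin 3 → ℤ) (h : ∀ i, ¬ RS (pd d i)) : Module.finrank ℚ (F3 d) = 8 := by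
  have h0 : ¬ RS (d 0) := by simpa [pd, bt, Fin.prod_univ_three, Nat.testBit] using h 0
  have h1 : ¬ RS (d 1) := by simpa [pd, bt, Fin.prod_univ_three, Nat.testBit] using h 1
  have h2 : ¬ RS (d 0 * d 1) := by simpa [pd, bt, Fin.prod_univ_three, Nat.testBit] using h 2
  have h3 : ¬ RS (d 2) := by simpa [pd, bt, Fin.prod_univ_three, Nat.testBit] using h 3
  have h4 : ¬ RS (d 0 * d 2) := by simpa [pd, bt, Fin.prod_univ_three, Nat.testBit] using h 4
  have h5 : ¬ RS (d 1 * d 2) := by simpa [pd, bt, Fin.prod_univ_three, Nat.testBit] using h 5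
  have h6 : ¬ RS (d 0 * d 1 * d 2) := by simpa [pd, bt, Fin.prod_univ_three, Nat.testBit] using h 6
  have e1 : Module.finrank ℚ (F1 d) = 2 := by
    unfold F1
    rw [sup_fr _ _ _ (rt_sq (d 0)) (fun hx => h0 (bot_sq _ _ hx (rt_sq _)))]
    simp
  have e2 : Module.finrank ℚ (F2 d) = 4 := by
    unfold F2
    rw [sup_fr _ _ _ (rt_sq (d 1)), e1]
    intro hx
    rcases F1_sq d _ _ hx (rt_sq _) with h | h
    · exact h1 h
    · exact h2 (by rwa [mul_comm])
  unfold F3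
  rw [sup_fr _ _ _ (rt_sq (d 2)), e2]
  intro hx
  rcases F2_sq d _ _ hx (rt_sq _) with (h | h) | h | h
  · exact h3 h
  · exact h4 (by rwa [mul_comm])
  · exact h5 (by rwa [mul_comm])
  · exact h6 (by rwa [show d 0 * d 1 * d 2 = d 2 * d 1 * d 0 by ring])

/-- the field -/
noncomputable def KK (d : Fin 3 → ℤ) : IntermediateField ℚ ℂ := adjoin ℚ (Set.range fun i => rt (d i))

lemma KK_eq (d : Fin 3 → ℤ) : KK d = F3 d := by
  unfold KK F3 F2 F1
  rw [bot_sup_eq, ← adjoin_union, ← adjoin_union]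
  congr 1
  ext x
  simp only [Set.mem_range, Fin.exists_fin_succ, Set.mem_union, Set.mem_singleton_iff]
  simp
  tauto

lemma rt_mem (d : Fin 3 → ℤ) (i : Fin 3) : rt (d i) ∈ KK d := subset_adjoin _ _ ⟨i, rfl⟩

lemma KK_nf (d : Fin 3 → ℤ) (h : ∀ i, ¬ RS (pd d i)) : FiniteDimensional ℚ (KK d) := by
  apply FiniteDimensional.of_finrank_pos
  rw [KK_eq, F3_fr d h]; norm_num

lemma nz_of (d : Fin 3 → ℤ) (h : ∀ i, ¬ RS (pd d i)) (i : Fin 3) : d i ≠ 0 := by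
  intro h0
  have h00 : ¬ RS (d 0) := by simpa [pd, bt, Fin.prod_univ_three, Nat.testBit] using h 0
  have h1 : ¬ RS (d 1) := by simpa [pd, bt, Fin.prod_univ_three, Nat.testBit] using h 1
  have h3 : ¬ RS (d 2) := by simpa [pd, bt, Fin.prod_univ_three, Nat.testBit] using h 3
  have : ¬ RS (d i) := by fin_cases i <;> assumption
  exact this ⟨0, by rw [h0]; simp⟩

lemma KK_SF (d : Fin 3 → ℤ) (h : ∀ i, ¬ RS (pd d i)) [NumberField (KK d)] :
    SF 3 (KK d) (fun i => ⟨rt (d i), rt_mem d i⟩) d := by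
  refine ⟨?_, nz_of d h, ?_, ?_⟩
  · intro i; apply Subtype.ext
    show rt (d i) ^ 2 = _
    rw [rt_sq]; simp
  · have h2 : Module.finrank ℚ (KK d) = 2 ^ 3 := by rw [KK_eq, F3_fr d h]; norm_num
    convert h2
  · have key := adj_top (F := ℚ) (fun i : Fin 3 => rt (d i))
    have : (DivisionRing.toRatAlgebra : Algebra ℚ (KK d)) = (KK d).algebra' := Subsingleton.elim _ _
    rw [this]
    exact key

lemma units_zmod : Nonempty (ℤˣ ≃* Multiplicative (ZMod 2)) := by
  have h1 : IsCyclic ℤˣ := inferInstance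
  exact ⟨mulEquivOfPrimeCardEq (p := 2) (by simp) (by simp)⟩

end
end TQ
section
open TQ
lemma TQ.KK_nq (d : Fin 3 → ℤ) (h : ∀ i, ¬ RS (pd d i)) [NumberField (KK d)] :
  FiniteDimensional ℚ (KK d) ∧ IsGalois ℚ (KK d) ∧
    Nonempty ((KK d ≃ₐ[ℚ] KK d) ≃* (Fin 3 → Multiplicative (ZMod 2))) := by
  have hs := KK_SF d h
  have hg := hs.gal
  obtain ⟨e, -⟩ := hs.iso
  have : (DivisionRing.toRatAlgebra : Algebra ℚ (KK d)) = (KK d).algebra' := Subsingleton.elim _ _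
  obtain ⟨f⟩ := units_zmod
  rw [this] at hg e
  exact ⟨KK_nf d h, hg, ⟨e.trans (MulEquiv.piCongrRight fun _ => f)⟩⟩

lemma TQ.KK_im (d : Fin 3 → ℤ) (h : d 0 < 0) : ∃ x : KK d, (x : ℂ).im ≠ 0 := by
  refine ⟨⟨rt (d 0), rt_mem d 0⟩, fun h1 => ?_⟩
  have h2 := rt_sq (d 0)
  have h3 := congrArg Complex.re h2
  have h1' : (rt (d 0)).im = 0 := h1
  rw [pow_two, Complex.mul_re, h1'] at h3
  simp at h3
  have : (d 0 : ℝ) < 0 := by exact_mod_cast h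
  nlinarith [mul_self_nonneg (rt (d 0)).re]
end

namespace TQ
section

/-- certificate for one triquadratic field -/
structure Tri where
  d0 : ℤ
  d1 : ℤ
  d2 : ℤ
  kind : ℕ
  a : ℤ
  r : ℤ
  x : ℤ
  y : ℤ
  z : ℤ

/-- certificates for the quadratic fields -/
def tab : List QC := [
  ⟨-10707, 0, 31, 9956, 0, 0⟩, ⟨-7912, 0, 41, 34337, 0, 0⟩, ⟨-6963, 0, 37, 12626, 0, 0⟩, ⟨-4708, 0, 37, 42226, 0, 0⟩, ⟨-4648, 0, 11, 13, 0, 0⟩,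
  ⟨-4587, 0, 31, 5952, 0, 0⟩, ⟨-3972, 0, 49, 88157, 0, 0⟩, ⟨-3892, 0, 29, 9754, 0, 0⟩, ⟨-3652, 0, 37, 16953, 0, 0⟩, ⟨-3304, 0, 25, 7757, 0, 0⟩,
  ⟨-2728, 0, 49, 58655, 0, 0⟩, ⟨-2387, 0, 9, 12, 0, 0⟩, ⟨-1892, 0, 9, 713, 0, 0⟩, ⟨-1668, 0, 13, 1110, 0, 0⟩, ⟨-1419, 0, 25, 10380, 0, 0⟩,
  ⟨-1219, 0, 13, 44, 0, 0⟩, ⟨-1147, 0, 7, 336, 0, 0⟩, ⟨-1099, 0, 11, 33, 0, 0⟩, ⟨-1012, 0, 1, 0, 0, 0⟩, ⟨-996, 0, 25, 15501, 0, 0⟩,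
  ⟨-856, 0, 23, 10423, 0, 0⟩, ⟨-808, 0, 17, 3695, 0, 0⟩, ⟨-804, -10, 25, 13382, 0, 0⟩, ⟨-744, 0, 19, 4106, 0, 0⟩, ⟨-708, 0, 1, 0, 0, 0⟩,
  ⟨-707, 0, 9, 706, 0, 0⟩, ⟨-628, 0, 13, 1474, 0, 0⟩, ⟨-516, 0, 13, 1119, 0, 0⟩, ⟨-483, 0, 1, 0, 0, 0⟩, ⟨-472, 0, 7, 15, 0, 0⟩,
  ⟨-451, 0, 5, 122, 0, 0⟩, ⟨-427, 0, 1, 0, 0, 0⟩, ⟨-424, 0, 11, 35, 0, 0⟩, ⟨-403, 0, 1, 0, 0, 0⟩, ⟨-372, 0, 1, 0, 0, 0⟩,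
  ⟨-331, 0, 5, 7, 0, 0⟩, ⟨-247, 0, 4, 2, 0, 0⟩, ⟨-244, 0, 5, 117, 0, 0⟩, ⟨-232, 0, 1, 0, 0, 0⟩, ⟨-231, 0, 4, 62, 0, 0⟩,
  ⟨-212, 0, 9, 703, 0, 0⟩, ⟨-211, 0, 5, 117, 0, 0⟩, ⟨-152, 0, 7, 114, 0, 0⟩, ⟨-148, 0, 1, 0, 0, 0⟩, ⟨-139, 0, 5, 10, 0, 0⟩,
  ⟨-123, 0, 1, 0, 0, 0⟩, ⟨-116, 0, 5, 61, 0, 0⟩, ⟨-115, 0, 1, 0, 0, 0⟩, ⟨-107, 0, 3, 0, 0, 0⟩, ⟨-104, 0, 3, 1, 0, 0⟩,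
  ⟨-91, 0, 1, 0, 0, 0⟩, ⟨-88, 0, 1, 0, 0, 0⟩, ⟨-87, 0, 4, 58, 0, 0⟩, ⟨-83, 0, 3, 3, 0, 0⟩, ⟨-67, 0, 1, 0, 0, 0⟩,
  ⟨-59, 0, 3, 24, 0, 0⟩, ⟨-52, 0, 1, 0, 0, 0⟩, ⟨-43, 0, 1, 0, 0, 0⟩, ⟨-40, 0, 1, 0, 0, 0⟩, ⟨-35, 0, 1, 0, 0, 0⟩,
  ⟨-31, 0, 2, 0, 0, 0⟩, ⟨-24, 0, 1, 0, 0, 0⟩, ⟨-23, 0, 2, 2, 0, 0⟩, ⟨-20, 0, 1, 0, 0, 0⟩, ⟨-19, 0, 1, 0, 0, 0⟩,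
  ⟨-15, 0, 1, 0, 0, 0⟩, ⟨-11, 0, 1, 0, 0, 0⟩, ⟨-8, 0, 1, 0, 0, 0⟩, ⟨-7, 0, 1, 0, 0, 0⟩, ⟨-4, 0, 1, 0, 0, 0⟩,
  ⟨-3, 0, 1, 0, 0, 0⟩, ⟨5, 2, 1, 0, 0, 0⟩, ⟨8, 2, 1, 0, 0, 0⟩, ⟨12, 3, 1, 0, 0, 0⟩, ⟨13, 3, 1, 0, 0, 0⟩,
  ⟨21, 4, 1, 0, 0, 0⟩, ⟨24, 4, 1, 0, 0, 0⟩, ⟨28, 5, 1, 0, 0, 0⟩, ⟨29, 5, 1, 0, 0, 0⟩, ⟨33, 5, 1, 0, 0, 0⟩,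
  ⟨37, 6, 1, 0, 0, 0⟩, ⟨41, 6, 1, 0, 0, 0⟩, ⟨44, 6, 1, 0, 0, 0⟩, ⟨53, 7, 1, 0, 0, 0⟩, ⟨56, 7, 1, 0, 0, 0⟩,
  ⟨57, 7, 1, 0, 0, 0⟩, ⟨61, 7, 1, 0, 0, 0⟩, ⟨69, 8, 1, 0, 0, 0⟩, ⟨76, 8, 1, 0, 0, 0⟩, ⟨77, 8, 1, 0, 0, 0⟩,
  ⟨88, 9, 1, 0, 0, 0⟩, ⟨92, 9, 1, 0, 0, 0⟩, ⟨93, 9, 1, 0, 0, 0⟩, ⟨101, 10, 1, 0, 0, 0⟩, ⟨104, 10, 1, 0, 0, 0⟩,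
  ⟨124, 11, 1, 0, 0, 0⟩, ⟨129, 11, 1, 0, 0, 0⟩, ⟨133, 11, 1, 0, 0, 0⟩, ⟨152, 12, 1, 0, 0, 0⟩, ⟨157, 12, 1, 0, 0, 0⟩,
  ⟨161, 12, 1, 0, 0, 0⟩, ⟨172, 13, 1, 0, 0, 0⟩, ⟨177, 13, 1, 0, 0, 0⟩, ⟨184, 13, 1, 0, 0, 0⟩, ⟨201, 14, 1, 0, 0, 0⟩,
  ⟨209, 14, 1, 0, 0, 0⟩, ⟨217, 14, 1, 0, 0, 0⟩, ⟨232, 15, 1, 0, 0, 0⟩, ⟨236, 15, 1, 0, 0, 0⟩, ⟨248, 15, 1, 0, 0, 0⟩,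
  ⟨249, 15, 1, 0, 0, 0⟩, ⟨253, 15, 1, 0, 0, 0⟩, ⟨268, 16, 1, 0, 0, 0⟩, ⟨321, 17, 2, 0, 430, 24⟩, ⟨332, 18, 1, 0, 0, 0⟩,
  ⟨341, 18, 1, 0, 0, 0⟩, ⟨344, 18, 1, 0, 0, 0⟩, ⟨345, 18, 1, 0, 0, 0⟩, ⟨348, 18, 1, 0, 0, 0⟩, ⟨413, 20, 1, 0, 0, 0⟩,
  ⟨417, 20, 1, 0, 0, 0⟩, ⟨424, 20, 1, 0, 0, 0⟩, ⟨428, 20, 1, 0, 0, 0⟩, ⟨456, 21, 1, 0, 0, 0⟩, ⟨460, 21, 1, 0, 0, 0⟩,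
  ⟨472, 21, 1, 0, 0, 0⟩, ⟨473, 21, 2, 6, 174, 8⟩, ⟨556, 23, 1, 0, 0, 0⟩, ⟨581, 24, 1, 0, 0, 0⟩, ⟨589, 24, 1, 0, 0, 0⟩,
  ⟨633, 25, 1, 0, 0, 0⟩, ⟨649, 25, 1, 0, 0, 0⟩, ⟨664, 25, 1, 0, 0, 0⟩, ⟨696, 26, 1, 0, 0, 0⟩, ⟨728, 26, 1, 0, 0, 0⟩,
  ⟨805, 28, 1, 0, 0, 0⟩, ⟨856, 29, 1, 0, 0, 0⟩, ⟨913, 30, 1, 0, 0, 0⟩, ⟨920, 30, 1, 0, 0, 0⟩, ⟨973, 31, 1, 0, 0, 0⟩,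
  ⟨988, 31, 1, 0, 0, 0⟩, ⟨989, 31, 1, 0, 0, 0⟩, ⟨993, 31, 2, 0, 5294, 168⟩, ⟨1121, 33, 1, 0, 0, 0⟩, ⟨1177, 34, 1, 0, 0, 0⟩,
  ⟨1324, 36, 1, 0, 0, 0⟩, ⟨1353, 36, 1, 0, 0, 0⟩, ⟨1416, 37, 1, 0, 0, 0⟩, ⟨1529, 39, 1, 0, 0, 0⟩, ⟨1612, 40, 1, 0, 0, 0⟩,
  ⟨1672, 40, 1, 0, 0, 0⟩, ⟨1708, 41, 3, 7, 124, 3⟩, ⟨1729, 41, 1, 0, 0, 0⟩, ⟨1976, 44, 1, 0, 0, 0⟩, ⟨2033, 45, 1, 0, 0, 0⟩,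
  ⟨2321, 48, 1, 0, 0, 0⟩, ⟨2568, 50, 1, 0, 0, 0⟩, ⟨2821, 53, 1, 0, 0, 0⟩, ⟨3224, 56, 1, 0, 0, 0⟩, ⟨3569, 59, 2, 4, 85003950, 1422872⟩,
  ⟨4396, 66, 1, 0, 0, 0⟩, ⟨4588, 67, 1, 0, 0, 0⟩, ⟨4876, 69, 1, 0, 0, 0⟩, ⟨5192, 72, 1, 0, 0, 0⟩, ⟨5656, 75, 1, 0, 0, 0⟩,
  ⟨6313, 79, 1, 0, 0, 0⟩, ⟨7657, 87, 1, 0, 0, 0⟩, ⟨8968, 94, 1, 0, 0, 0⟩, ⟨9416, 97, 1, 0, 0, 0⟩, ⟨9752, 98, 1, 0, 0, 0⟩,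
  ⟨16264, 127, 1, 0, 0, 0⟩, ⟨50504, 224, 1, 0, 0, 0⟩]

/-- triples -/
def lst1 : List Tri := [
  ⟨-4, -31, -3, 0, 1, 0, 39, 7, 1⟩, ⟨-4, -43, -3, 0, 1, 0, 59, 9, -1⟩, ⟨-4, -3, -59, 0, 1, 0, 1, 1, -1⟩, ⟨-4, -67, -3, 0, 1, 0, 221, 27, -1⟩,
  ⟨-4, -23, -11, 0, 1, 0, 5, 1, 1⟩, ⟨-4, 13, -19, 1, 1, 0, 3, 1, 0⟩, ⟨-4, 5, -23, 1, 1, 0, 1, 1, 0⟩, ⟨-4, 13, -31, 1, 1, 0, 3, 1, 0⟩,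
  ⟨-8, 29, -3, 1, 1, 0, 5, 1, 0⟩, ⟨-8, 13, -7, 1, 1, 0, 3, 1, 0⟩, ⟨-8, 5, -23, 1, 1, 0, 1, 1, 0⟩, ⟨-3, 41, -11, 1, 1, 0, 64, 10, 0⟩,
  ⟨-3, 8, -19, 1, 1, 0, 2, 1, 0⟩, ⟨-3, 5, -23, 1, 1, 0, 1, 1, 0⟩, ⟨-7, 13, -19, 1, 1, 0, 3, 1, 0⟩, ⟨-7, 5, -23, 1, 1, 0, 1, 1, 0⟩,
  ⟨-7, 13, -31, 1, 1, 0, 3, 1, 0⟩, ⟨-11, 8, -19, 1, 1, 0, 2, 1, 0⟩, ⟨-3, -11, -7, 2, 1, 0, 4, 2, 0⟩, ⟨-3, -23, -7, 2, 1, 0, 3, 1, 0⟩,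
  ⟨-4, 8, -19, 3, 1, 0, 0, 0, 0⟩, ⟨-4, 8, 13, 3, 1, 0, 0, 0, 0⟩, ⟨-4, 8, 29, 3, 1, 0, 0, 0, 0⟩]

/-- triples -/
def lst2 : List Tri := [
  ⟨-4, -3, -83, 0, 1, 0, 1, 1, -1⟩, ⟨-4, -139, -3, 0, 1, 0, 8807, 747, -1⟩, ⟨-4, -7, -139, 0, 1, 0, 3, 1, 1⟩, ⟨-4, -11, -43, 0, 1, 0, 3, 1, -1⟩,
  ⟨-4, -11, -83, 0, 1, 0, 3, 1, -1⟩, ⟨-4, -11, -107, 0, 1, 0, 3, 1, -1⟩, ⟨-4, 29, -3, 1, 1, 0, 5, 1, 0⟩, ⟨-4, 61, -7, 1, 1, 0, 39, 5, 0⟩,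
  ⟨-4, 157, -7, 1, 1, 0, 213, 17, 0⟩, ⟨-4, 37, -31, 1, 1, 0, 12, 2, 0⟩, ⟨-8, 101, -7, 1, 1, 0, 20, 2, 0⟩, ⟨-8, 13, -19, 1, 1, 0, 3, 1, 0⟩,
  ⟨-8, 13, -31, 1, 1, 0, 3, 1, 0⟩, ⟨-3, 8, -59, 1, 1, 0, 2, 1, 0⟩, ⟨-11, 8, -59, 1, 1, 0, 2, 1, 0⟩, ⟨-11, 8, -107, 1, 1, 0, 2, 1, 0⟩,
  ⟨-19, 13, -31, 1, 1, 0, 3, 1, 0⟩, ⟨-8, -31, -3, 2, 1, 0, 4, 2, 0⟩, ⟨-8, -7, -59, 2, 1, 0, 2, 2, 0⟩, ⟨-8, -7, -83, 2, 1, 0, 2, 2, 0⟩,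
  ⟨-8, -31, -11, 2, 1, 0, 4, 2, 0⟩, ⟨-8, -23, -43, 2, 1, 0, 78, 46, 0⟩, ⟨-3, -11, -43, 2, 1, 0, 4, 2, 0⟩, ⟨-3, -11, -139, 2, 1, 0, 4, 2, 0⟩,
  ⟨-3, -11, -211, 2, 1, 0, 4, 2, 0⟩, ⟨-7, -31, -11, 2, 1, 0, 1048, 498, 0⟩, ⟨-4, 8, -59, 3, 1, 0, 0, 0, 0⟩, ⟨-4, 8, -107, 3, 1, 0, 0, 0, 0⟩,
  ⟨-4, 8, 53, 3, 1, 0, 0, 0, 0⟩]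

/-- triples -/
def lst3 : List Tri := [
  ⟨-4, -331, -3, 0, 1, 0, 52778687, 2900979, -1⟩, ⟨-4, 53, -23, 1, 1, 0, 7, 1, 0⟩, ⟨-8, 53, -23, 1, 1, 0, 7, 1, 0⟩, ⟨-3, 8, -107, 1, 1, 0, 2, 1, 0⟩,
  ⟨-19, 8, -59, 1, 1, 0, 2, 1, 0⟩, ⟨-19, 8, -107, 1, 1, 0, 2, 1, 0⟩, ⟨-3, -83, -43, 2, 1, 0, 2388, 454, 0⟩]

/-- triples -/
def lst4 : List Tri := [
  ⟨-59, 8, -107, 1, 3, 24, 2, 1, 0⟩]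

def QC.dflt : QC := ⟨-3, 0, 1, 0, 0, 0⟩

/-- lookup -/
def lk (n : ℤ) : QC × ℤ :=
  match tab.find? (fun q => q.D == n) with
  | some q => (q, 1)
  | none => match tab.find? (fun q => q.D == n / 4) with
    | some q => (q, 2)
    | none => (QC.dflt, 1)

set_option maxRecDepth 100000 in
lemma tab_ok : (QC.dflt.ok && tab.all QC.ok) = true := by decide +kernel

lemma lk_ok (n : ℤ) : (lk n).1.ok = true ∧ (lk n).2 ≠ 0 := by
  have h := tab_ok
  rw [Bool.and_eq_true, List.all_eq_true] at h
  unfold lk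
  split
  · rename_i q hq; exact ⟨h.2 q (List.mem_of_find?_eq_some hq), one_ne_zero⟩
  · split
    · rename_i q hq; exact ⟨h.2 q (List.mem_of_find?_eq_some hq), two_ne_zero⟩
    · exact ⟨h.1, one_ne_zero⟩

def Tri.d (t : Tri) : Fin 3 → ℤ := ![t.d0, t.d1, t.d2]

/-- oddness check -/
def Tri.oddb (t : Tri) : Bool :=
  cm (t.d 0) (t.d 1) (t.d 2) t.a t.r &&
  ((t.kind == 0 && ci (t.d 0) (t.d 1) (t.d 2) t.x t.y t.z) ||
   (t.kind == 1 && (cii (t.d 1) (t.d 2) t.x t.y (pd t.d 0) || cii (t.d 1) (t.d 2) t.x t.y (pd t.d 2))) ||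
   (t.kind == 2 && ciii (t.d 0) (t.d 1) (t.d 2) t.x t.y) ||
   (t.kind == 3 && cz (t.d 0) (t.d 1) (t.d 2)))

/-- full check -/
def Tri.ok (t : Tri) (r : ℕ) : Bool :=
  t.oddb && decide (∀ i : Fin 7, pd t.d i = (lk (pd t.d i)).2 ^ 2 * (lk (pd t.d i)).1.D) &&
    decide ((Finset.univ.filter fun i : Fin 7 => (lk (pd t.d i)).1.a ≠ 1).card = r)

theorem Tri.main (t : Tri) (r : ℕ) (h : t.ok r = true) :
    (FiniteDimensional ℚ (KK t.d) ∧ IsGalois ℚ (KK t.d) ∧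
    Nonempty ((KK t.d ≃ₐ[ℚ] KK t.d) ≃* (Fin 3 → Multiplicative (ZMod 2)))) ∧
    (∃ x : KK t.d, (x : ℂ).im ≠ 0) ∧ Nonempty (ClassGroup (𝓞 (KK t.d)) ≃* (Fin r → Multiplicative (ZMod 3))) := by
  simp only [Tri.ok, Bool.and_eq_true, decide_eq_true_eq] at h
  obtain ⟨⟨ho, hp⟩, hc⟩ := h
  have hns : ∀ i, ¬ RS (pd t.d i) := by
    rintro i ⟨a, ha⟩
    obtain ⟨hq, hm⟩ := lk_ok (pd t.d i)
    have hf : fund (lk (pd t.d i)).1.D = true := by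
      simp only [QC.ok, Bool.and_eq_true] at hq; exact hq.1.1
    rw [hp i] at ha
    push_cast at ha
    have hm' : ((lk (pd t.d i)).2 : ℚ) ≠ 0 := by exact_mod_cast hm
    apply fund_nonsq hf (a / (lk (pd t.d i)).2)
    rw [div_pow, ha]; field_simp
  haveI hn : NumberField (KK t.d) := by
    refine { to_charZero := inferInstance, to_finiteDimensional := ?_ }
    have := KK_nf t.d hns
    convert this
  have hS := KK_SF t.d hns
  simp only [Tri.oddb, Bool.and_eq_true, Bool.or_eq_true] at ho
  obtain ⟨hcm, hk⟩ := ho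
  have hodd : Odd (Nat.card (ClassGroup (𝓞 (KK t.d)))) := by
    rcases hk with ((⟨-, hk⟩ | ⟨-, hk | hk⟩) | ⟨-, hk⟩) | ⟨-, hk⟩
    · exact hS.ci hcm hk
    · exact hS.cii hcm 0 (Or.inl rfl) hk
    · exact hS.cii hcm 2 (Or.inr rfl) hk
    · exact hS.ciii hcm hk
    · exact hS.cz hcm hk
  refine ⟨KK_nq t.d hns, KK_im t.d (hS.common hcm).1, ?_⟩
  let A := Finset.univ.filter fun i : Fin 7 => (lk (pd t.d i)).1.a ≠ 1
  have hcA : A.card = r := hc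
  refine hS.final hodd (fun i => (lk (pd t.d i)).1) (fun i => (lk (pd t.d i)).2) (fun i => (lk_ok _).1)
    (fun i => ⟨(lk_ok _).2, hp i⟩) (A.orderEmbOfFin hcA) (A.orderEmbOfFin hcA).injective ?_ ?_
  · intro k
    have := A.orderEmbOfFin_mem hcA k
    exact (Finset.mem_filter.mp this).2
  · intro i hi
    by_contra hne
    have hiA : i ∈ A := Finset.mem_filter.mpr ⟨Finset.mem_univ _, hne⟩
    have : i ∈ Set.range (A.orderEmbOfFin hcA) := by rw [Finset.range_orderEmbOfFin]; exact hiA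
    obtain ⟨k, hk⟩ := this
    exact hi k hk

lemma RS_no {m : ℤ} (h : nsqt m = true) : ¬ RS m := by
  rintro ⟨a, ha⟩
  have h1 : IsSquare ((m : ℤ) : ℚ) := ⟨a, by rw [← ha]; ring⟩
  rw [Rat.isSquare_intCast_iff] at h1
  obtain ⟨b, hb⟩ := h1
  exact nsqt_ok h b (by rw [hb]; ring)

def sep1 (d : Fin 3 → ℤ) (e : ℤ) : Bool :=
  nsqt e && nsqt (e * d 0) && nsqt (e * d 1) && nsqt (e * d 1 * d 0) && nsqt (e * d 2) &&
    nsqt (e * d 2 * d 0) && nsqt (e * d 2 * d 1) && nsqt (e * d 2 * d 1 * d 0)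

/-- separation of fields -/
def Tri.sep (t t' : Tri) : Bool := sep1 t.d (t'.d 0) || sep1 t.d (t'.d 1) || sep1 t.d (t'.d 2)

lemma sep1_ok {d d' : Fin 3 → ℤ} (i : Fin 3) (h : sep1 d (d' i) = true) : KK d ≠ KK d' := by
  intro he
  simp only [sep1, Bool.and_eq_true] at h
  have hm : rt (d' i) ∈ F3 d := by rw [← KK_eq, he]; exact rt_mem d' i
  obtain ⟨⟨⟨⟨⟨⟨⟨h0, h1⟩, h2⟩, h3⟩, h4⟩, h5⟩, h6⟩, h7⟩ := h
  rcases F3_sq d _ _ hm (rt_sq _) with ((h | h) | h | h) | (h | h) | h | h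
  · exact RS_no h0 h
  · exact RS_no h1 h
  · exact RS_no h2 h
  · exact RS_no h3 h
  · exact RS_no h4 h
  · exact RS_no h5 h
  · exact RS_no h6 h
  · exact RS_no h7 h

lemma Tri.sep_ok {t t' : Tri} (h : t.sep t' = true) : KK t.d ≠ KK t'.d := by
  simp only [Tri.sep, Bool.or_eq_true] at h
  rcases h with (h | h) | h
  · exact sep1_ok 0 h
  · exact sep1_ok 1 h
  · exact sep1_ok 2 h

theorem fin_of (l : List Tri) (r n : ℕ) (h1 : l.all (fun t => t.ok r) = true)
    (h2 : l.Pairwise fun t t' => t.sep t' = true) (h3 : l.length = n) :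
    ∃ S : Finset (IntermediateField ℚ ℂ), n ≤ S.card ∧
      ∀ K ∈ S, (FiniteDimensional ℚ K ∧ IsGalois ℚ K ∧ Nonempty ((K ≃ₐ[ℚ] K) ≃* (Fin 3 → Multiplicative (ZMod 2)))) ∧
        (∃ x : K, (x : ℂ).im ≠ 0) ∧
        Nonempty (ClassGroup (𝓞 K) ≃* (Fin r → Multiplicative (ZMod 3))) := by
  classical
  have hnd : (l.map fun t => KK t.d).Nodup := by
    unfold List.Nodup
    rw [List.pairwise_map]
    exact h2.imp fun h => Tri.sep_ok h
  refine ⟨(l.map fun t => KK t.d).toFinset, ?_, ?_⟩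
  · rw [List.toFinset_card_of_nodup hnd, List.length_map, h3]
  · intro K hK
    rw [List.mem_toFinset, List.mem_map] at hK
    obtain ⟨t, ht, rfl⟩ := hK
    rw [List.all_eq_true] at h1
    exact t.main r (h1 t ht)

set_option maxRecDepth 100000 in
lemma ok1 : lst1.all (fun t => t.ok 1) = true := by decide +kernel
set_option maxRecDepth 100000 in
lemma ok2 : lst2.all (fun t => t.ok 2) = true := by decide +kernel
set_option maxRecDepth 100000 in
lemma ok3 : lst3.all (fun t => t.ok 3) = true := by decide +kernel
set_option maxRecDepth 100000 in
lemma ok4 : lst4.all (fun t => t.ok 4) = true := by decide +kernel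
set_option maxRecDepth 100000 in
lemma sp1 : lst1.Pairwise fun t t' => t.sep t' = true := by decide +kernel
set_option maxRecDepth 100000 in
lemma sp2 : lst2.Pairwise fun t t' => t.sep t' = true := by decide +kernel
set_option maxRecDepth 100000 in
lemma sp3 : lst3.Pairwise fun t t' => t.sep t' = true := by decide +kernel
set_option maxRecDepth 100000 in
lemma sp4 : lst4.Pairwise fun t t' => t.sep t' = true := by decide +kernel

end
end TQ

theorem stmt1 :
    (∃ S : Finset (IntermediateField ℚ ℂ), 23 ≤ S.card ∧
      ∀ K ∈ S, IsNQuadratic 3 K ∧ IsImaginary K ∧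
        Nonempty (ClassGroup (𝓞 K) ≃* (Fin 1 → Multiplicative (ZMod 3)))) ∧
    (∃ S : Finset (IntermediateField ℚ ℂ), 29 ≤ S.card ∧
      ∀ K ∈ S, IsNQuadratic 3 K ∧ IsImaginary K ∧
        Nonempty (ClassGroup (𝓞 K) ≃* (Fin 2 → Multiplicative (ZMod 3)))) ∧
    (∃ S : Finset (IntermediateField ℚ ℂ), 7 ≤ S.card ∧
      ∀ K ∈ S, IsNQuadratic 3 K ∧ IsImaginary K ∧
        Nonempty (ClassGroup (𝓞 K) ≃* (Fin 3 → Multiplicative (ZMod 3)))) ∧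
    (∃ S : Finset (IntermediateField ℚ ℂ), 1 ≤ S.card ∧
      ∀ K ∈ S, IsNQuadratic 3 K ∧ IsImaginary K ∧
        Nonempty (ClassGroup (𝓞 K) ≃* (Fin 4 → Multiplicative (ZMod 3)))) := by
  exact ⟨TQ.fin_of TQ.lst1 1 23 TQ.ok1 TQ.sp1 rfl, TQ.fin_of TQ.lst2 2 29 TQ.ok2 TQ.sp2 rfl,
    TQ.fin_of TQ.lst3 3 7 TQ.ok3 TQ.sp3 rfl, TQ.fin_of TQ.lst4 4 1 TQ.ok4 TQ.sp4 rfl⟩
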